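/- arXiv:1602.01916 — 3 statements merged into one kernel-verified Lean document; each statement's English description precedes it below -/
import Mathlib

section
/- Let n ≥ 3 and m ≥ 2 be an integer. For every ε > 0 there exist points z₁, …, z_m ∈ ℝⁿ such that, setting u = Σ_{i=1}^m v₁[z_i,1] and K = ( Σ_{i=1}^m v₁[z_i,1]^p ) / u^p, the function u is positive, solves −Δu = K u^p on ℝⁿ, and satisfies ‖K u^p − u^p‖_{L^{2n/(n+2)}(ℝⁿ)} < ε. -/
open MeasureTheory Real Filter

noncomputable section

/-- Euclidean space ℝⁿ. -/
abbrev Euc (n : ℕ) := EuclideanSpace ℝ (Fin n)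

/-- The critical Sobolev exponent `2* = 2n/(n-2)`. -/
def twoStar (n : ℕ) : ℝ := 2 * (n : ℝ) / ((n : ℝ) - 2)

/-- The exponent `p = (n+2)/(n-2)`. -/
def pexp (n : ℕ) : ℝ := ((n : ℝ) + 2) / ((n : ℝ) - 2)

/-- The Aubin–Talenti bubble `v_κ(x) = (n(n-2)/κ)^((n-2)/4) (1+|x|²)^(-(n-2)/2)`. -/
def bubble (n : ℕ) (κ : ℝ) (x : Euc n) : ℝ :=
  ((n : ℝ) * ((n : ℝ) - 2) / κ) ^ (((n : ℝ) - 2) / 4) *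
    (1 + ‖x‖ ^ 2) ^ (-(((n : ℝ) - 2) / 2))

/-- Translation/dilation `v[z,λ](x) = λ^((n-2)/2) v(λ(x-z))`. -/
def rescale (n : ℕ) (v : Euc n → ℝ) (z : Euc n) (lam : ℝ) (x : Euc n) : ℝ :=
  lam ^ (((n : ℝ) - 2) / 2) * v (lam • (x - z))

/-- The Laplacian of `u : ℝⁿ → ℝ`, as a sum of second partial derivatives. -/
def lap {n : ℕ} (u : Euc n → ℝ) (x : Euc n) : ℝ :=
  ∑ i, fderiv ℝ (fun y => fderiv ℝ u y (EuclideanSpace.single i 1)) x (EuclideanSpace.single i 1)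

/-- Membership in the homogeneous Sobolev space `Ḣ¹(ℝⁿ)`, the closure of `C_c^∞(ℝⁿ)`
under the norm `‖∇·‖_{L²}`. -/
def MemH1dot (n : ℕ) (u : Euc n → ℝ) : Prop :=
  ∃ φ : ℕ → Euc n → ℝ,
    (∀ k, ContDiff ℝ (⊤ : ℕ∞) (φ k) ∧ HasCompactSupport (φ k)) ∧
    Tendsto (fun k => ∫ x, ‖gradient (φ k) x - gradient u x‖ ^ 2) atTop (nhds 0)

/-- The sharp Sobolev constant `S`. -/
def sobolevS (n : ℕ) : ℝ :=
  sInf { c : ℝ | ∃ v : Euc n → ℝ, v ≠ 0 ∧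
    (∀ t : ℝ, 0 < t → volume {x | t < |v x|} < ⊤) ∧
    c = (∫ x, ‖gradient v x‖ ^ 2) ^ (1 / 2 : ℝ) / (∫ x, |v x| ^ twoStar n) ^ (1 / twoStar n) }

/-- `K₀(u) = ∫|∇u|² / ∫ u^{2*}`. -/
def Kzero (n : ℕ) (u : Euc n → ℝ) : ℝ :=
  (∫ x, ‖gradient u x‖ ^ 2) / ∫ x, u x ^ twoStar n

/-- The deficit `δ(u)`. -/
def deficit (n : ℕ) (u : Euc n → ℝ) : ℝ :=
  (∫ x, |lap u x / u x ^ pexp n + Kzero n u| ^ (2 * (n : ℝ) / ((n : ℝ) + 2))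
      * u x ^ twoStar n) ^ (((n : ℝ) + 2) / (2 * (n : ℝ)))

/-- `m = (n-2)/(n+2)`. -/
def mexp (n : ℕ) : ℝ := ((n : ℝ) - 2) / ((n : ℝ) + 2)

/-- The energy functional `J`. -/
def Jfun (n : ℕ) (v : Euc n → ℝ) : ℝ :=
  (∫ x, ‖gradient v x‖ ^ 2) / 2 - (1 / ((1 - mexp n) * twoStar n)) * ∫ x, v x ^ twoStar n

lemma rescale_one {n : ℕ} (v : Euc n → ℝ) (z x : Euc n) : rescale n v z 1 x = v (x - z) := by
  simp [rescale]

lemma bubble_pos {n : ℕ} (hn : 3 ≤ n) (x : Euc n) : 0 < bubble n 1 x := by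
  have h3 : (3 : ℝ) ≤ n := by exact_mod_cast hn
  have h : 0 < (n : ℝ) * ((n : ℝ) - 2) / 1 := by
    have : 0 < (n : ℝ) - 2 := by linarith
    positivity
  unfold bubble
  positivity

lemma continuous_bubble (n : ℕ) : Continuous (bubble n 1) := by
  unfold bubble
  refine continuous_const.mul (Continuous.rpow_const (by fun_prop) fun x => Or.inl ?_)
  positivity

/-- Powers of the profile `1 + ‖x - z‖²` are differentiable. -/
lemma hasFDerivAt_one_add_norm_sub_sq_rpow {n : ℕ} (z x : Euc n) (a : ℝ) :
    HasFDerivAt (fun y : Euc n => (1 + ‖y - z‖ ^ 2) ^ a)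
      ((a * (1 + ‖x - z‖ ^ 2) ^ (a - 1)) • ((2 : ℝ) • innerSL ℝ (x - z))) x := by
  have h1 : HasFDerivAt (fun y : Euc n => 1 + ‖y - z‖ ^ 2) ((2 : ℝ) • innerSL ℝ (x - z)) x := by
    have h := (((hasFDerivAt_id (𝕜 := ℝ) x).sub_const z).norm_sq).const_add 1
    refine h.congr_fderiv ?_
    ext y
    simp [two_smul]
  exact h1.rpow_const (Or.inl (by positivity))

lemma fderiv_one_add_norm_sub_sq_rpow_single {n : ℕ} (z x : Euc n) (a : ℝ) (i : Fin n) :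
    fderiv ℝ (fun y : Euc n => (1 + ‖y - z‖ ^ 2) ^ a) x (EuclideanSpace.single i 1) =
      2 * a * ((x i - z i) * (1 + ‖x - z‖ ^ 2) ^ (a - 1)) := by
  rw [(hasFDerivAt_one_add_norm_sub_sq_rpow z x a).fderiv]
  simp [EuclideanSpace.inner_single_right]
  ring

lemma fderiv_coord_mul_one_add_norm_sub_sq_rpow_single {n : ℕ} (z x : Euc n) (a : ℝ) (i : Fin n) :
    fderiv ℝ (fun y : Euc n => (y i - z i) * (1 + ‖y - z‖ ^ 2) ^ a) x
        (EuclideanSpace.single i 1) =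
      (1 + ‖x - z‖ ^ 2) ^ a + 2 * a * ((x i - z i) ^ 2 * (1 + ‖x - z‖ ^ 2) ^ (a - 1)) := by
  have h1 : HasFDerivAt (fun y : Euc n => y i - z i) (EuclideanSpace.proj (𝕜 := ℝ) i) x :=
    (EuclideanSpace.proj (𝕜 := ℝ) i : Euc n →L[ℝ] ℝ).hasFDerivAt.sub_const (z i)
  rw [(h1.fun_mul (hasFDerivAt_one_add_norm_sub_sq_rpow z x a)).fderiv]
  simp [EuclideanSpace.inner_single_right]
  ring

lemma bubble_sub_eq {n : ℕ} (z y : Euc n) :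
    bubble n 1 (y - z) = ((n : ℝ) * ((n : ℝ) - 2)) ^ (((n : ℝ) - 2) / 4) *
      (1 + ‖y - z‖ ^ 2) ^ (-(((n : ℝ) - 2) / 2)) := by
  simp [bubble]

lemma bubble_rpow_pexp {n : ℕ} (hn : 3 ≤ n) (x : Euc n) :
    bubble n 1 x ^ pexp n = (n : ℝ) * ((n : ℝ) - 2) *
      ((n : ℝ) * ((n : ℝ) - 2)) ^ (((n : ℝ) - 2) / 4) *
        (1 + ‖x‖ ^ 2) ^ (-((n : ℝ) / 2) - 1) := by
  have h3 : (3 : ℝ) ≤ n := by exact_mod_cast hn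
  have h2 : 0 < (n : ℝ) - 2 := by linarith
  have hc : 0 < (n : ℝ) * ((n : ℝ) - 2) := by positivity
  rw [bubble, pexp, div_one, mul_rpow (by positivity) (by positivity), ← rpow_mul hc.le,
    ← rpow_mul (by positivity)]
  congr 1
  · rw [← rpow_one_add' hc.le (by positivity)]
    congr 1
    field_simp
    ring
  · congr 1
    field_simp
    ring

/-- The Laplacian of a sum of translated unit bubbles. -/
lemma neg_lap_sum_bubble {n : ℕ} (hn : 3 ≤ n) {ι : Type*} [Fintype ι] (z : ι → Euc n) (x : Euc n) :
    -lap (fun y => ∑ k, bubble n 1 (y - z k)) x = ∑ k, bubble n 1 (x - z k) ^ pexp n := by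
  set c : ℝ := ((n : ℝ) * ((n : ℝ) - 2)) ^ (((n : ℝ) - 2) / 4) with hc
  have hfirst (i : Fin n) (y : Euc n) :
      fderiv ℝ (fun y => ∑ k, bubble n 1 (y - z k)) y (EuclideanSpace.single i 1) =
        ∑ k, -(((n : ℝ) - 2) * c) *
          ((y i - z k i) * (1 + ‖y - z k‖ ^ 2) ^ (-((n : ℝ) / 2))) := by
    simp only [bubble_sub_eq]
    rw [fderiv_fun_sum fun k _ =>
      (hasFDerivAt_one_add_norm_sub_sq_rpow (z k) y _).differentiableAt.const_mul _]
    simp only [FunLike.coe_sum, Finset.sum_apply]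
    refine Finset.sum_congr rfl fun k _ => ?_
    rw [fderiv_const_mul (hasFDerivAt_one_add_norm_sub_sq_rpow (z k) y _).differentiableAt,
      _root_.smul_apply, fderiv_one_add_norm_sub_sq_rpow_single, smul_eq_mul,
      show -(((n : ℝ) - 2) / 2) - 1 = -((n : ℝ) / 2) by ring]
    ring
  have hdiff (i : Fin n) (k : ι) : DifferentiableAt ℝ
      (fun y : Euc n => (y i - z k i) * (1 + ‖y - z k‖ ^ 2) ^ (-((n : ℝ) / 2))) x := by
    have h1 : DifferentiableAt ℝ (fun y : Euc n => y i - z k i) x := by fun_prop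
    exact h1.mul (hasFDerivAt_one_add_norm_sub_sq_rpow (z k) x _).differentiableAt
  have hsecond (i : Fin n) :
      fderiv ℝ (fun y => fderiv ℝ (fun y => ∑ k, bubble n 1 (y - z k)) y
        (EuclideanSpace.single i 1)) x (EuclideanSpace.single i 1) =
      ∑ k, -(((n : ℝ) - 2) * c) * ((1 + ‖x - z k‖ ^ 2) ^ (-((n : ℝ) / 2)) +
        2 * (-((n : ℝ) / 2)) *
          ((x i - z k i) ^ 2 * (1 + ‖x - z k‖ ^ 2) ^ (-((n : ℝ) / 2) - 1))) := by
    simp only [hfirst]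
    rw [fderiv_fun_sum fun k _ => (hdiff i k).const_mul _]
    simp only [FunLike.coe_sum, Finset.sum_apply]
    refine Finset.sum_congr rfl fun k _ => ?_
    rw [fderiv_const_mul (hdiff i k), _root_.smul_apply,
      fderiv_coord_mul_one_add_norm_sub_sq_rpow_single, smul_eq_mul]
  simp only [lap, hsecond]
  rw [Finset.sum_comm, ← Finset.sum_neg_distrib]
  refine Finset.sum_congr rfl fun k _ => ?_
  have hnorm : ∑ i, (x i - z k i) ^ 2 = ‖x - z k‖ ^ 2 := by
    simp [EuclideanSpace.real_norm_sq_eq]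
  have hsplit : (1 + ‖x - z k‖ ^ 2) ^ (-((n : ℝ) / 2)) =
      (1 + ‖x - z k‖ ^ 2) * (1 + ‖x - z k‖ ^ 2) ^ (-((n : ℝ) / 2) - 1) := by
    have hpos : 0 < 1 + ‖x - z k‖ ^ 2 := by positivity
    rw [rpow_sub_one hpos.ne']
    field_simp
  rw [← Finset.mul_sum, Finset.sum_add_distrib, ← Finset.mul_sum, ← Finset.sum_mul, hnorm,
    bubble_rpow_pexp hn, hsplit]
  simp
  ring

/-- The defect of additivity of `t ↦ t ^ p` is controlled by an interaction of two distinct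
terms. -/
lemma abs_sum_rpow_sub_rpow_sum_le {m : ℕ} (hm : 2 ≤ m) {p : ℝ} (hp : 1 ≤ p) {a : Fin m → ℝ}
    (ha : ∀ i, 0 < a i) :
    ∃ j k, j ≠ k ∧ |∑ i, a i ^ p - (∑ i, a i) ^ p| ≤
      p * (m : ℝ) ^ p * (a j ^ (p - 1 / 2) * a k ^ (1 / 2 : ℝ)) := by
  have : NeZero m := ⟨by omega⟩
  obtain ⟨j, -, hj⟩ := Finset.exists_max_image Finset.univ a Finset.univ_nonempty
  have hne : (Finset.univ.erase j).Nonempty := by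
    rw [← Finset.card_pos, Finset.card_erase_of_mem (Finset.mem_univ j)]
    simp
    omega
  obtain ⟨k, hk, hkmax⟩ := Finset.exists_max_image (Finset.univ.erase j) a hne
  refine ⟨j, k, (Finset.ne_of_mem_erase hk).symm, ?_⟩
  have hm0 : (0 : ℝ) < m := by positivity
  set S := ∑ i, a i with hS
  have hjS : a j ≤ S := Finset.single_le_sum (fun i _ => (ha i).le) (Finset.mem_univ j)
  have hSpos : 0 < S := (ha j).trans_le hjS
  have hSm : S ≤ m * a j := by
    simpa using Finset.sum_le_card_nsmul Finset.univ a (a j) hj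
  have hrest : S - a j ≤ m * a k := by
    have h1 : S - a j = ∑ i ∈ Finset.univ.erase j, a i := by
      rw [hS, ← Finset.add_sum_erase _ _ (Finset.mem_univ j)]
      ring
    have h2 := Finset.sum_le_card_nsmul (Finset.univ.erase j) a (a k) hkmax
    have h3 : ((Finset.univ.erase j).card : ℝ) ≤ m := by
      exact_mod_cast (Finset.card_erase_le).trans (by simp)
    rw [nsmul_eq_mul] at h2
    rw [h1]
    exact h2.trans (mul_le_mul_of_nonneg_right h3 (ha k).le)
  have hle : ∑ i, a i ^ p ≤ S ^ p := by
    have hterm (i : Fin m) : a i ^ p ≤ a i * S ^ (p - 1) := by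
      have hiS : a i ≤ S := Finset.single_le_sum (fun i _ => (ha i).le) (Finset.mem_univ i)
      have h : a i ^ p = a i * a i ^ (p - 1) := by
        rw [rpow_sub_one (ha i).ne', mul_div_cancel₀ _ (ha i).ne']
      rw [h]
      exact mul_le_mul_of_nonneg_left
        (rpow_le_rpow (ha i).le hiS (by linarith)) (ha i).le
    calc ∑ i, a i ^ p ≤ ∑ i, a i * S ^ (p - 1) := Finset.sum_le_sum fun i _ => hterm i
      _ = S ^ p := by
        rw [← Finset.sum_mul, ← hS, rpow_sub_one hSpos.ne', mul_div_cancel₀ _ hSpos.ne']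
  have hbern : S ^ p - a j ^ p ≤ p * S ^ (p - 1) * (S - a j) := by
    have h1 := one_add_mul_self_le_rpow_one_add (s := a j / S - 1)
      (by have : 0 ≤ a j / S := div_nonneg (ha j).le hSpos.le
          linarith) hp
    rw [add_sub_cancel, div_rpow (ha j).le hSpos.le, le_div_iff₀ (by positivity)] at h1
    have h2 : p * S ^ (p - 1) * (S - a j) = -(p * (a j / S - 1)) * S ^ p := by
      rw [rpow_sub_one hSpos.ne']
      field_simp
      ring
    rw [h2]
    linarith
  have hj' : a j ^ p ≤ ∑ i, a i ^ p :=
    Finset.single_le_sum (f := fun i => a i ^ p) (fun i _ => (rpow_pos_of_pos (ha i) p).le)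
      (Finset.mem_univ j)
  have hkj : a k ≤ a j := hj k (Finset.mem_univ k)
  have hinter : a j ^ (p - 1) * a k ≤ a j ^ (p - 1 / 2) * a k ^ (1 / 2 : ℝ) := by
    have h1 : a k = a k ^ (1 / 2 : ℝ) * a k ^ (1 / 2 : ℝ) := by
      rw [← rpow_add (ha k)]
      norm_num
    have h2 : a j ^ (p - 1 / 2) = a j ^ (p - 1) * a j ^ (1 / 2 : ℝ) := by
      rw [← rpow_add (ha j)]
      congr 1
      ring
    have hkj2 : a k ^ (1 / 2 : ℝ) ≤ a j ^ (1 / 2 : ℝ) :=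
      rpow_le_rpow (ha k).le hkj (by norm_num)
    calc a j ^ (p - 1) * a k
        = a j ^ (p - 1) * a k ^ (1 / 2 : ℝ) * a k ^ (1 / 2 : ℝ) := by
          conv_lhs => rw [h1]
          ring
      _ ≤ a j ^ (p - 1) * a j ^ (1 / 2 : ℝ) * a k ^ (1 / 2 : ℝ) := by
          have := (rpow_pos_of_pos (ha j) (p - 1)).le
          have := (rpow_pos_of_pos (ha k) (1 / 2)).le
          gcongr
      _ = _ := by rw [h2]
  rw [abs_sub_comm, abs_of_nonneg (by linarith)]
  have hSp : S ^ (p - 1) ≤ (m : ℝ) ^ (p - 1) * a j ^ (p - 1) := by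
    rw [← mul_rpow hm0.le (ha j).le]
    exact rpow_le_rpow hSpos.le hSm (by linarith)
  have hmp : (m : ℝ) ^ p = (m : ℝ) ^ (p - 1) * m := by
    rw [rpow_sub_one hm0.ne', div_mul_cancel₀ _ hm0.ne']
  have hjp := (rpow_pos_of_pos (ha j) (p - 1)).le
  have hkp := (ha k).le
  calc S ^ p - ∑ i, a i ^ p ≤ p * S ^ (p - 1) * (S - a j) := by linarith
    _ ≤ p * ((m : ℝ) ^ (p - 1) * a j ^ (p - 1)) * (m * a k) := by
        have : 0 ≤ S - a j := by linarith
        gcongr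
    _ = p * (m : ℝ) ^ p * (a j ^ (p - 1) * a k) := by rw [hmp]; ring
    _ ≤ _ := by gcongr

/-- Translating a bounded function vanishing at infinity off to infinity kills its integral
against an integrable function. -/
lemma tendsto_integral_mul_translate {E : Type*} [NormedAddCommGroup E] [MeasurableSpace E]
    [BorelSpace E] {μ : Measure E} {f g : E → ℝ} (hf : Integrable f μ)
    (hg : Continuous g) {M : ℝ} (hM : ∀ x, |g x| ≤ M)
    (hg0 : Tendsto g (comap norm atTop) (nhds 0)) {w : ℕ → E}
    (hw : Tendsto (fun k => ‖w k‖) atTop atTop) :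
    Tendsto (fun k => ∫ x, f x * g (x - w k) ∂μ) atTop (nhds 0) := by
  rw [← integral_zero E ℝ (μ := μ)]
  refine tendsto_integral_of_dominated_convergence (fun x => |f x| * M) (fun k => ?_)
    (hf.abs.mul_const M) (fun k => .of_forall fun x => ?_) (.of_forall fun x => ?_)
  · exact hf.aestronglyMeasurable.mul
      (hg.measurable.comp (measurable_id.sub_const (w k))).aestronglyMeasurable
  · rw [norm_mul, Real.norm_eq_abs, Real.norm_eq_abs]
    exact mul_le_mul_of_nonneg_left (hM _) (abs_nonneg _)
  · have h : Tendsto (fun k => x - w k) atTop (comap norm atTop) := by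
      rw [tendsto_comap_iff]
      refine tendsto_atTop_mono (fun k => ?_) (tendsto_atTop_add_const_right _ (-‖x‖) hw)
      have := norm_sub_norm_le (w k) x
      rw [norm_sub_rev] at this
      simpa [sub_eq_add_neg] using this
    simpa using (hg0.comp h).const_mul (f x)

lemma bubble_rpow {n : ℕ} (hn : 3 ≤ n) (b : ℝ) (x : Euc n) :
    bubble n 1 x ^ b = (((n : ℝ) * ((n : ℝ) - 2)) ^ (((n : ℝ) - 2) / 4)) ^ b *
      (1 + ‖x‖ ^ 2) ^ (-(((n : ℝ) - 2) * b) / 2) := by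
  have h3 : (3 : ℝ) ≤ n := by exact_mod_cast hn
  have h2 : 0 < (n : ℝ) - 2 := by linarith
  rw [bubble, div_one, mul_rpow (by positivity) (by positivity),
    ← rpow_mul (by positivity : 0 ≤ 1 + ‖x‖ ^ 2)]
  congr 2
  ring

lemma integrable_bubble_rpow {n : ℕ} (hn : 3 ≤ n) {b : ℝ} (hb : (n : ℝ) < ((n : ℝ) - 2) * b) :
    Integrable (fun x : Euc n => bubble n 1 x ^ b) := by
  simp only [bubble_rpow hn]
  exact (integrable_rpow_neg_one_add_norm_sq (by simpa using hb)).const_mul _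

lemma tendsto_bubble_rpow {n : ℕ} (hn : 3 ≤ n) {b : ℝ} (hb : 0 < b) :
    Tendsto (fun x : Euc n => bubble n 1 x ^ b) (comap norm atTop) (nhds 0) := by
  have h3 : (3 : ℝ) ≤ n := by exact_mod_cast hn
  have h2 : 0 < (n : ℝ) - 2 := by linarith
  simp only [bubble_rpow hn, neg_div]
  have h : Tendsto (fun x : Euc n => 1 + ‖x‖ ^ 2) (comap norm atTop) atTop :=
    tendsto_atTop_add_const_left _ _ ((tendsto_pow_atTop two_ne_zero).comp tendsto_comap)
  simpa using ((tendsto_rpow_neg_atTop (y := ((n : ℝ) - 2) * b / 2) (by positivity)).comp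
    h).const_mul ((((n : ℝ) * ((n : ℝ) - 2)) ^ (((n : ℝ) - 2) / 4)) ^ b)

lemma bubble_le_bubble_zero {n : ℕ} (hn : 3 ≤ n) (x : Euc n) : bubble n 1 x ≤ bubble n 1 0 := by
  have h3 : (3 : ℝ) ≤ n := by exact_mod_cast hn
  have h2 : 0 < (n : ℝ) - 2 := by linarith
  unfold bubble
  refine mul_le_mul_of_nonneg_left ?_ (by positivity)
  simpa using rpow_le_one_of_one_le_of_nonpos (by simp : (1 : ℝ) ≤ 1 + ‖x‖ ^ 2)
    (by linarith : -(((n : ℝ) - 2) / 2) ≤ 0)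

lemma continuous_bubble_rpow {n : ℕ} (hn : 3 ≤ n) (b : ℝ) :
    Continuous fun x : Euc n => bubble n 1 x ^ b :=
  (continuous_bubble n).rpow_const fun x => Or.inl (bubble_pos hn x).ne'

lemma abs_bubble_rpow_le {n : ℕ} (hn : 3 ≤ n) {b : ℝ} (hb : 0 < b) (x : Euc n) :
    |bubble n 1 x ^ b| ≤ bubble n 1 0 ^ b := by
  rw [abs_of_pos (rpow_pos_of_pos (bubble_pos hn x) b)]
  exact rpow_le_rpow (bubble_pos hn x).le (bubble_le_bubble_zero hn x) hb.le

lemma integrable_bubble_interaction {n : ℕ} (hn : 3 ≤ n) {a b : ℝ}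
    (ha : (n : ℝ) < ((n : ℝ) - 2) * a) (hb : 0 < b) (z w : Euc n) :
    Integrable fun x => bubble n 1 (x - z) ^ a * bubble n 1 (x - w) ^ b :=
  ((integrable_bubble_rpow hn ha).comp_sub_right z).mul_bdd
    ((continuous_bubble_rpow hn b).comp (continuous_id.sub continuous_const)).aestronglyMeasurable
    (.of_forall fun x => abs_bubble_rpow_le hn hb (x - w))

lemma tendsto_integral_bubble_interaction {n : ℕ} (hn : 3 ≤ n) {a b : ℝ}
    (ha : (n : ℝ) < ((n : ℝ) - 2) * a) (hb : 0 < b) {z w : ℕ → Euc n}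
    (hzw : Tendsto (fun R => ‖w R - z R‖) atTop atTop) :
    Tendsto (fun R => ∫ x, bubble n 1 (x - z R) ^ a * bubble n 1 (x - w R) ^ b)
      atTop (nhds 0) := by
  refine (tendsto_integral_mul_translate (integrable_bubble_rpow hn ha)
    (continuous_bubble_rpow hn b) (abs_bubble_rpow_le hn hb)
    (tendsto_bubble_rpow hn hb) hzw).congr fun R => ?_
  rw [← integral_sub_right_eq_self _ (z R)]
  refine integral_congr_ae (.of_forall fun x => ?_)
  simp

/-- Mutually separating bubbles become additive for `t ↦ t ^ p` in the limit. -/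
lemma tendsto_integral_bubble_defect {n m : ℕ} (hn : 3 ≤ n) (hm : 2 ≤ m)
    {z : ℕ → Fin m → Euc n}
    (hz : ∀ j k, j ≠ k → Tendsto (fun R => ‖z R k - z R j‖) atTop atTop) :
    Tendsto (fun R => ∫ x, |∑ i, bubble n 1 (x - z R i) ^ pexp n -
      (∑ i, bubble n 1 (x - z R i)) ^ pexp n| ^ (2 * (n : ℝ) / ((n : ℝ) + 2)))
      atTop (nhds 0) := by
  have h3 : (3 : ℝ) ≤ n := by exact_mod_cast hn
  have h2 : 0 < (n : ℝ) - 2 := by linarith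
  set p := pexp n with hp
  set q := 2 * (n : ℝ) / ((n : ℝ) + 2) with hq
  have hp1 : 1 ≤ p := by
    rw [hp, pexp, le_div_iff₀ h2]
    linarith
  have hq0 : 0 < q := by positivity
  have ha : (n : ℝ) < ((n : ℝ) - 2) * ((p - 1 / 2) * q) := by
    rw [hp, hq, pexp, show ((n : ℝ) - 2) * ((((n : ℝ) + 2) / ((n : ℝ) - 2) - 1 / 2) *
      (2 * (n : ℝ) / ((n : ℝ) + 2))) = (n : ℝ) + 4 * n / (n + 2) by field_simp; ring]
    have : 0 < 4 * (n : ℝ) / (n + 2) := by positivity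
    linarith
  have hb : 0 < 1 / 2 * q := by positivity
  set C := (p * (m : ℝ) ^ p) ^ q with hC
  have hC0 : 0 ≤ C := by positivity
  let I (R : ℕ) (jk : Fin m × Fin m) (x : Euc n) : ℝ :=
    bubble n 1 (x - z R jk.1) ^ ((p - 1 / 2) * q) * bubble n 1 (x - z R jk.2) ^ (1 / 2 * q)
  have hI0 (R : ℕ) (jk : Fin m × Fin m) (x : Euc n) : 0 ≤ I R jk x :=
    mul_nonneg (rpow_pos_of_pos (bubble_pos hn _) _).le (rpow_pos_of_pos (bubble_pos hn _) _).le
  have hlim : Tendsto (fun R => C * ∑ jk ∈ Finset.univ.filter fun jk : Fin m × Fin m =>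
      jk.1 ≠ jk.2, ∫ x, I R jk x) atTop (nhds 0) := by
    rw [show (0 : ℝ) = C * ∑ jk ∈ Finset.univ.filter fun jk : Fin m × Fin m =>
      jk.1 ≠ jk.2, 0 by simp]
    refine (tendsto_finsetSum _ fun jk hjk => ?_).const_mul C
    exact tendsto_integral_bubble_interaction hn ha hb (hz _ _ (Finset.mem_filter.mp hjk).2)
  refine squeeze_zero (fun R => integral_nonneg fun x => by positivity) (fun R => ?_) hlim
  have hint (jk : Fin m × Fin m) : Integrable (I R jk) :=
    integrable_bubble_interaction hn ha hb _ _
  rw [← integral_finsetSum _ fun jk _ => hint jk, ← integral_const_mul]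
  refine integral_mono_of_nonneg (.of_forall fun x => by positivity)
    ((integrable_finsetSum _ fun jk _ => hint jk).const_mul C) (.of_forall fun x => ?_)
  obtain ⟨j, k, hjk, hle⟩ := abs_sum_rpow_sub_rpow_sum_le hm hp1
    (a := fun i => bubble n 1 (x - z R i)) fun i => bubble_pos hn _
  have hj := bubble_pos hn (x - z R j)
  have hk := bubble_pos hn (x - z R k)
  calc _ ≤ (p * (m : ℝ) ^ p * (bubble n 1 (x - z R j) ^ (p - 1 / 2) *
        bubble n 1 (x - z R k) ^ (1 / 2 : ℝ))) ^ q := rpow_le_rpow (abs_nonneg _) hle hq0.le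
    _ = C * I R (j, k) x := by
      rw [mul_rpow (x := p * (m : ℝ) ^ p) (by positivity) (by positivity),
        mul_rpow (x := bubble n 1 (x - z R j) ^ (p - 1 / 2)) (by positivity) (by positivity),
        ← rpow_mul hj.le, ← rpow_mul hk.le]
    _ ≤ _ := by
      refine mul_le_mul_of_nonneg_left ?_ hC0
      exact Finset.single_le_sum (f := fun jk => I R jk x) (fun jk _ => hI0 R jk x)
        (Finset.mem_filter.mpr ⟨Finset.mem_univ (j, k), hjk⟩)

/-- **Bubbling makes the deficit small.** For `n ≥ 3`, `m ≥ 2` and every `ε > 0` there are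
points `z₁, …, z_m ∈ ℝⁿ` such that `u = Σᵢ v₁[zᵢ,1]` is positive, solves `-Δu = K u^p` with
`K = (Σᵢ v₁[zᵢ,1]^p)/u^p`, and `‖K u^p - u^p‖_{L^{2n/(n+2)}} < ε`. -/
theorem multibubble_small_deficit (n m : ℕ) (hn : 3 ≤ n) (hm : 2 ≤ m) :
    ∀ ε : ℝ, 0 < ε → ∃ z : Fin m → Euc n,
      (∀ x, 0 < ∑ i, rescale n (bubble n 1) (z i) 1 x) ∧
      (∀ x, -lap (fun y => ∑ i, rescale n (bubble n 1) (z i) 1 y) x =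
          ((∑ i, rescale n (bubble n 1) (z i) 1 x ^ pexp n) /
              (∑ i, rescale n (bubble n 1) (z i) 1 x) ^ pexp n) *
            (∑ i, rescale n (bubble n 1) (z i) 1 x) ^ pexp n) ∧
      (∫ x, |((∑ i, rescale n (bubble n 1) (z i) 1 x ^ pexp n) /
              (∑ i, rescale n (bubble n 1) (z i) 1 x) ^ pexp n) *
            (∑ i, rescale n (bubble n 1) (z i) 1 x) ^ pexp n -
            (∑ i, rescale n (bubble n 1) (z i) 1 x) ^ pexp n| ^ (2 * (n : ℝ) / ((n : ℝ) + 2)))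
          ^ (((n : ℝ) + 2) / (2 * (n : ℝ))) < ε := by
  intro ε hε
  have h3 : (3 : ℝ) ≤ n := by exact_mod_cast hn
  have : NeZero m := ⟨by omega⟩
  have : NeZero n := ⟨by omega⟩
  let z (R : ℕ) (i : Fin m) : Euc n := EuclideanSpace.single 0 ((R : ℝ) * (i : ℕ))
  have hz : ∀ j k, j ≠ k → Tendsto (fun R => ‖z R k - z R j‖) atTop atTop := by
    intro j k hjk
    have hne : (0 : ℝ) < |((k : ℕ) : ℝ) - (j : ℕ)| := by
      rw [abs_pos, sub_ne_zero]
      exact_mod_cast fun h : (k : ℕ) = j => hjk (Fin.ext h.symm)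
    refine (tendsto_natCast_atTop_atTop.atTop_mul_const hne).congr fun R => ?_
    have hsub : z R k - z R j =
        EuclideanSpace.single 0 ((R : ℝ) * (((k : ℕ) : ℝ) - (j : ℕ))) := by
      ext i
      by_cases hi : i = 0 <;> simp [z, hi, mul_sub]
    rw [hsub, PiLp.norm_single, Real.norm_eq_abs, abs_mul, Nat.abs_cast]
  have hexp : 0 < ((n : ℝ) + 2) / (2 * (n : ℝ)) := by positivity
  have hlim := (tendsto_integral_bubble_defect hn hm hz).rpow_const (Or.inr hexp.le)
  rw [zero_rpow hexp.ne'] at hlim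
  obtain ⟨R, hR⟩ := (hlim.eventually (gt_mem_nhds hε)).exists
  have hpos (x : Euc n) : 0 < ∑ i, bubble n 1 (x - z R i) :=
    Finset.sum_pos (fun i _ => bubble_pos hn _) Finset.univ_nonempty
  have hcancel (x : Euc n) : (∑ i, bubble n 1 (x - z R i) ^ pexp n) /
      (∑ i, bubble n 1 (x - z R i)) ^ pexp n * (∑ i, bubble n 1 (x - z R i)) ^ pexp n =
        ∑ i, bubble n 1 (x - z R i) ^ pexp n :=
    div_mul_cancel₀ _ (rpow_pos_of_pos (hpos x) _).ne'
  refine ⟨z R, ?_⟩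
  simp only [rescale_one, hcancel]
  exact ⟨hpos, neg_lap_sum_bubble hn (z R), hR⟩
end
end

section
/- Let n ≥ 3, m = (n−2)/(n+2), p = (n+2)/(n−2), 2* = 2n/(n−2), and let w : (0,∞) × ℝⁿ → (0,∞) be a smooth positive solution of ∂_s (w^p) = Δw + w^p/(1−m). Assume that for each s, w(s,·) ∈ Ḣ¹(ℝⁿ) ∩ L^{2*}(ℝⁿ), that ∫_{ℝⁿ} (Δw(s)/w(s)^p + 1/(1−m))² w(s)^{2*} < ∞, and that w has sufficient decay in x, locally uniformly in s, to integrate by parts and differentiate under the integral sign (e.g., w(s,x) and its space-time derivatives are bounded by C(1+|x|)^{−(n−2)} locally uniformly in s, with the corresponding decay for derivatives). Then s ↦ J[w(s)] is differentiable and d/ds J[w(s)] = −(1/p) ∫_{ℝⁿ} ( Δw(s)/w(s)^p + 1/(1−m) )² w(s)^{2*}. In particular s ↦ J[w(s)] is nonincreasing. -/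
open MeasureTheory Real Filter

noncomputable section

lemma gradient_apply_eq_fderiv {n : ℕ} (u : Euc n → ℝ) (x : Euc n) (i : Fin n) :
    gradient u x i = fderiv ℝ u x (EuclideanSpace.single i 1) := by
  have h : inner ℝ (gradient u x) (EuclideanSpace.single i (1 : ℝ))
      = fderiv ℝ u x (EuclideanSpace.single i 1) := by
    rw [gradient, InnerProductSpace.toDual_symm_apply]
  rw [← h, EuclideanSpace.inner_single_right]
  simp

lemma inner_gradient_eq_sum {n : ℕ} (u v : Euc n → ℝ) (x : Euc n) :
    inner ℝ (gradient u x) (gradient v x) =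
      ∑ i, fderiv ℝ u x (EuclideanSpace.single i 1) * fderiv ℝ v x (EuclideanSpace.single i 1) := by
  rw [PiLp.inner_apply]
  refine Finset.sum_congr rfl fun i _ => ?_
  rw [gradient_apply_eq_fderiv, gradient_apply_eq_fderiv, Real.inner_apply]

lemma norm_gradient_eq_norm_fderiv {n : ℕ} (u : Euc n → ℝ) (x : Euc n) :
    ‖gradient u x‖ = ‖fderiv ℝ u x‖ := by
  rw [gradient, LinearIsometryEquiv.norm_map]

lemma ContDiff.continuous_gradient {n : ℕ} {u : Euc n → ℝ} (hu : ContDiff ℝ 1 u) :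
    Continuous (gradient u) :=
  (InnerProductSpace.toDual ℝ (Euc n)).symm.continuous.comp (hu.continuous_fderiv one_ne_zero)

lemma ContDiff.fderiv_apply_const {n : ℕ} {u : Euc n → ℝ} (hu : ContDiff ℝ 2 u) (e : Euc n) :
    ContDiff ℝ 1 fun y => fderiv ℝ u y e :=
  (hu.fderiv_right (m := 1) (by norm_num)).clm_apply contDiff_const

lemma ContDiff.continuous_lap {n : ℕ} {u : Euc n → ℝ} (hu : ContDiff ℝ 2 u) :
    Continuous (lap u) := by
  refine continuous_finsetSum _ fun i _ => ?_
  exact ((hu.fderiv_apply_const _).continuous_fderiv one_ne_zero).clm_apply continuous_const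

lemma lap_add {n : ℕ} {u v : Euc n → ℝ} (hu : ContDiff ℝ 2 u) (hv : ContDiff ℝ 2 v) (x : Euc n) :
    lap (fun y => u y + v y) x = lap u x + lap v x := by
  rw [lap, lap, lap, ← Finset.sum_add_distrib]
  refine Finset.sum_congr rfl fun i _ => ?_
  have h : (fun y => fderiv ℝ (fun y => u y + v y) y (EuclideanSpace.single i 1)) =
      fun y => fderiv ℝ u y (EuclideanSpace.single i 1)
        + fderiv ℝ v y (EuclideanSpace.single i 1) := by
    funext y
    rw [fderiv_fun_add (hu.differentiable two_ne_zero y) (hv.differentiable two_ne_zero y)]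
    rfl
  rw [h, fderiv_fun_add ((hu.fderiv_apply_const _).differentiable one_ne_zero x)
    ((hv.fderiv_apply_const _).differentiable one_ne_zero x)]
  rfl

lemma gradient_fun_add {n : ℕ} {u v : Euc n → ℝ} {x : Euc n} (hu : DifferentiableAt ℝ u x)
    (hv : DifferentiableAt ℝ v x) :
    gradient (fun y => u y + v y) x = gradient u x + gradient v x := by
  simp only [gradient, fderiv_fun_add hu hv, map_add]

lemma gradient_fun_sub {n : ℕ} {u v : Euc n → ℝ} {x : Euc n} (hu : DifferentiableAt ℝ u x)
    (hv : DifferentiableAt ℝ v x) :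
    gradient (fun y => u y - v y) x = gradient u x - gradient v x := by
  simp only [gradient, fderiv_fun_sub hu hv, map_sub]

lemma gradient_fun_mul {n : ℕ} {u v : Euc n → ℝ} {x : Euc n} (hu : DifferentiableAt ℝ u x)
    (hv : DifferentiableAt ℝ v x) :
    gradient (fun y => u y * v y) x = u x • gradient v x + v x • gradient u x := by
  simp only [gradient, fderiv_fun_mul hu hv, map_add, map_smul]

/-- Green's identity against a compactly supported test function. -/
lemma integral_inner_gradient_of_hasCompactSupport {n : ℕ} {η v : Euc n → ℝ}
    (hη : ContDiff ℝ 1 η) (hc : HasCompactSupport η) (hv : ContDiff ℝ 2 v) :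
    ∫ x, inner ℝ (gradient η x) (gradient v x) = -∫ x, η x * lap v x := by
  have hv' (i : Fin n) := hv.fderiv_apply_const (EuclideanSpace.single i 1)
  have hη' (i : Fin n) : Continuous fun x => fderiv ℝ η x (EuclideanSpace.single i 1) :=
    (hη.continuous_fderiv one_ne_zero).clm_apply continuous_const
  have hv'' (i : Fin n) : Continuous fun x => fderiv ℝ
      (fun y => fderiv ℝ v y (EuclideanSpace.single i 1)) x (EuclideanSpace.single i 1) :=
    ((hv' i).continuous_fderiv one_ne_zero).clm_apply continuous_const
  have hint₁ (i : Fin n) : Integrable fun x => fderiv ℝ η x (EuclideanSpace.single i 1) *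
      fderiv ℝ v x (EuclideanSpace.single i 1) :=
    ((hη' i).mul (hv' i).continuous).integrable_of_hasCompactSupport
      (hc.fderiv_apply ℝ _).mul_right
  have hint₂ (i : Fin n) : Integrable fun x => η x * fderiv ℝ
      (fun y => fderiv ℝ v y (EuclideanSpace.single i 1)) x (EuclideanSpace.single i 1) :=
    (hη.continuous.mul (hv'' i)).integrable_of_hasCompactSupport hc.mul_right
  have hint₃ (i : Fin n) : Integrable fun x => η x * fderiv ℝ v x (EuclideanSpace.single i 1) :=
    (hη.continuous.mul (hv' i).continuous).integrable_of_hasCompactSupport hc.mul_right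
  simp only [inner_gradient_eq_sum, lap, Finset.mul_sum]
  rw [integral_finsetSum _ fun i _ => hint₁ i, integral_finsetSum _ fun i _ => hint₂ i,
    ← Finset.sum_neg_distrib]
  refine Finset.sum_congr rfl fun i _ => ?_
  rw [integral_mul_fderiv_eq_neg_fderiv_mul_of_integrable (hint₁ i) (hint₂ i) (hint₃ i)
    (fun x _ => hη.differentiable one_ne_zero x)
    (fun x _ => (hv' i).differentiable one_ne_zero x), neg_neg]

/-- Smooth cutoffs at scale `k + 1`, exhausting the space. -/
lemma exists_cutoff_sequence (n : ℕ) : ∃ (χ : ℕ → Euc n → ℝ) (C : ℝ), 0 ≤ C ∧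
    (∀ k, ContDiff ℝ 1 (χ k)) ∧ (∀ k, HasCompactSupport (χ k)) ∧ (∀ k x, |χ k x| ≤ 1) ∧
    (∀ x, Tendsto (fun k => χ k x) atTop (nhds 1)) ∧
    ∀ k x, ‖gradient (χ k) x‖ ≤ C / (k + 1 + ‖x‖) := by
  obtain ⟨φ⟩ : Nonempty (ContDiffBump (0 : Euc n)) := inferInstance
  have hφ : ContDiff ℝ 1 φ := φ.contDiff
  obtain ⟨C, hC⟩ : ∃ C, ∀ y, ‖(1 + ‖y‖) • fderiv ℝ φ y‖ ≤ C :=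
    have hcont : Continuous fun y : Euc n => (1 + ‖y‖) • fderiv ℝ φ y :=
      (continuous_const.add continuous_norm).smul (hφ.continuous_fderiv one_ne_zero)
    have hsupp : HasCompactSupport fun y : Euc n => (1 + ‖y‖) • fderiv ℝ φ y :=
      (φ.hasCompactSupport.fderiv ℝ).mono fun y hy => by
        contrapose! hy
        simp_all
    hsupp.exists_bound_of_continuous hcont
  have hk (k : ℕ) : (0 : ℝ) < k + 1 := by positivity
  have hsmooth (k : ℕ) : ContDiff ℝ 1 fun x => φ (((k : ℝ) + 1)⁻¹ • x) :=
    hφ.comp (contDiff_id.const_smul _)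
  have hsupp (k : ℕ) : HasCompactSupport fun x => φ (((k : ℝ) + 1)⁻¹ • x) :=
    φ.hasCompactSupport.comp_smul (inv_ne_zero (hk k).ne')
  refine ⟨fun k x => φ (((k : ℝ) + 1)⁻¹ • x), C, (norm_nonneg _).trans (hC 0),
    hsmooth, hsupp, fun k x => ?_, fun x => ?_, fun k x => ?_⟩
  · rw [abs_of_nonneg φ.nonneg]
    exact φ.le_one
  · have h0 : Tendsto (fun k : ℕ => φ (((k : ℝ) + 1)⁻¹ • x)) atTop (nhds (φ ((0 : ℝ) • x))) := by
      refine (φ.continuous.tendsto _).comp (Tendsto.smul_const ?_ x)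
      simpa using tendsto_one_div_add_atTop_nhds_zero_nat (𝕜 := ℝ)
    rwa [zero_smul, φ.one_of_mem_closedBall (Metric.mem_closedBall_self φ.rIn_pos.le)] at h0
  · have hd : fderiv ℝ (fun x => φ (((k : ℝ) + 1)⁻¹ • x)) x =
        ((k : ℝ) + 1)⁻¹ • fderiv ℝ φ (((k : ℝ) + 1)⁻¹ • x) := by
      exact fderiv_comp_smul (f := φ) _
    have h := hC (((k : ℝ) + 1)⁻¹ • x)
    have hk := hk k
    rw [norm_smul, norm_smul, Real.norm_of_nonneg (by positivity),
      Real.norm_of_nonneg (by positivity)] at h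
    rw [norm_gradient_eq_norm_fderiv, hd, norm_smul, Real.norm_of_nonneg (by positivity),
      le_div_iff₀ (by positivity)]
    refine le_of_eq_of_le ?_ h
    field_simp

/-- Green's identity for functions with enough decay at infinity. -/
lemma integral_inner_gradient_of_decay {n : ℕ} {u v b : Euc n → ℝ}
    (hu : ContDiff ℝ 1 u) (hv : ContDiff ℝ 2 v) (hb : Integrable b)
    (hgrad : ∀ x, ‖gradient u x‖ * ‖gradient v x‖ ≤ b x)
    (hflux : ∀ x, |u x| * ‖gradient v x‖ ≤ b x * (1 + ‖x‖))
    (hlap : ∀ x, |u x| * |lap v x| ≤ b x) :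
    ∫ x, inner ℝ (gradient u x) (gradient v x) = -∫ x, u x * lap v x := by
  obtain ⟨χ, C, hC0, hχ, hχc, hχ1, hχlim, hχgrad⟩ := exists_cutoff_sequence n
  have hgu := hu.continuous_gradient
  have hgv := (hv.of_le one_le_two).continuous_gradient
  have hb0 (x : Euc n) : 0 ≤ b x := le_trans (by positivity) (hgrad x)
  have hexp (k : ℕ) (x : Euc n) : inner ℝ (gradient (fun y => χ k y * u y) x) (gradient v x) =
      χ k x * inner ℝ (gradient u x) (gradient v x)
        + u x * inner ℝ (gradient (χ k) x) (gradient v x) := by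
    rw [gradient_fun_mul ((hχ k).differentiable one_ne_zero x) (hu.differentiable one_ne_zero x),
      inner_add_left, real_inner_smul_left, real_inner_smul_left]
  have hlim₁ : Tendsto
      (fun k => ∫ x, inner ℝ (gradient (fun y => χ k y * u y) x) (gradient v x)) atTop
      (nhds (∫ x, inner ℝ (gradient u x) (gradient v x))) := by
    refine tendsto_integral_of_dominated_convergence (fun x => b x + C * b x)
      (fun k => ((((hχ k).mul hu).continuous_gradient).inner hgv).aestronglyMeasurable)
      (hb.add (hb.const_mul C)) (fun k => ae_of_all _ fun x => ?_) (ae_of_all _ fun x => ?_)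
    · rw [hexp]
      refine (norm_add_le _ _).trans (add_le_add ?_ ?_)
      · rw [norm_mul, Real.norm_eq_abs]
        exact (mul_le_of_le_one_left (norm_nonneg _) (hχ1 k x)).trans
          ((norm_inner_le_norm _ _).trans (hgrad x))
      · have hx : ‖gradient (χ k) x‖ ≤ C / (1 + ‖x‖) := by
          refine (hχgrad k x).trans (div_le_div_of_nonneg_left hC0 (by positivity) ?_)
          have : (0 : ℝ) ≤ k := by positivity
          linarith
        calc ‖u x * inner ℝ (gradient (χ k) x) (gradient v x)‖
            ≤ |u x| * (‖gradient (χ k) x‖ * ‖gradient v x‖) := by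
              rw [norm_mul, Real.norm_eq_abs]
              gcongr
              exact norm_inner_le_norm _ _
          _ = ‖gradient (χ k) x‖ * (|u x| * ‖gradient v x‖) := by ring
          _ ≤ C / (1 + ‖x‖) * (b x * (1 + ‖x‖)) :=
              mul_le_mul hx (hflux x) (by positivity) (by positivity)
          _ = C * b x := by field_simp
    · simp only [hexp]
      have hg0 : Tendsto (fun k => gradient (χ k) x) atTop (nhds 0) := by
        refine squeeze_zero_norm (hχgrad · x) (Tendsto.div_atTop tendsto_const_nhds ?_)
        exact tendsto_atTop_add_const_right _ _
          (tendsto_atTop_add_const_right _ _ tendsto_natCast_atTop_atTop)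
      simpa using ((hχlim x).mul_const (inner ℝ (gradient u x) (gradient v x))).add
        ((hg0.inner (tendsto_const_nhds (x := gradient v x))).const_mul (u x))
  have hlim₂ : Tendsto (fun k => ∫ x, χ k x * u x * lap v x) atTop
      (nhds (∫ x, u x * lap v x)) := by
    refine tendsto_integral_of_dominated_convergence b
      (fun k => (((hχ k).continuous.mul hu.continuous).mul
        hv.continuous_lap).aestronglyMeasurable) hb
      (fun k => ae_of_all _ fun x => ?_) (ae_of_all _ fun x => ?_)
    · rw [norm_mul, norm_mul, mul_assoc]
      exact (mul_le_of_le_one_left (by positivity) (hχ1 k x)).trans (hlap x)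
    · simpa using ((hχlim x).mul_const (u x)).mul_const (lap v x)
  refine tendsto_nhds_unique hlim₁ ?_
  simp only [fun k => integral_inner_gradient_of_hasCompactSupport ((hχ k).mul hu)
    ((hχc k).mul_right) hv]
  exact hlim₂.neg

lemma one_add_norm_rpow_mul_rpow {n : ℕ} (x : Euc n) (a b : ℝ) :
    (1 + ‖x‖) ^ a * (1 + ‖x‖) ^ b = (1 + ‖x‖) ^ (a + b) :=
  (rpow_add (by positivity) a b).symm

lemma integrable_one_add_norm_rpow {n : ℕ} (hn : 3 ≤ n) :
    Integrable fun x : Euc n => (1 + ‖x‖) ^ (-(2 * (n : ℝ) - 2)) := by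
  refine integrable_one_add_norm ?_
  have : (3 : ℝ) ≤ n := by exact_mod_cast hn
  rw [finrank_euclideanSpace_fin]
  linarith

/-- The Dirichlet energy of a decaying family is differentiable in the parameter. No bound on the
mixed derivative `∂ₛ∇u` is needed: the difference quotient is integrated by parts first. -/
lemma hasDerivAt_integral_norm_gradient_sq {n : ℕ} (hn : 3 ≤ n) {u : ℝ → Euc n → ℝ} {s C : ℝ}
    {K : Set ℝ} (hK : K ∈ nhds s) (hKc : Convex ℝ K) (hC : 0 ≤ C)
    (hu : ∀ r ∈ K, ContDiff ℝ 2 (u r))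
    (hdiff : ∀ x, ∀ r ∈ K, DifferentiableAt ℝ (fun t => u t x) r)
    (hlap_cont : ∀ x, ContinuousAt (fun r => lap (u r) x) s)
    (hval : ∀ r ∈ K, ∀ x, |u r x| ≤ C * (1 + ‖x‖) ^ (-((n : ℝ) - 2)))
    (hgrad : ∀ r ∈ K, ∀ x, ‖gradient (u r) x‖ ≤ C * (1 + ‖x‖) ^ (-((n : ℝ) - 1)))
    (hlap : ∀ r ∈ K, ∀ x, |lap (u r) x| ≤ C * (1 + ‖x‖) ^ (-(n : ℝ)))
    (hderiv : ∀ r ∈ K, ∀ x, |deriv (fun t => u t x) r| ≤ C * (1 + ‖x‖) ^ (-((n : ℝ) - 2))) :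
    HasDerivAt (fun r => ∫ x, ‖gradient (u r) x‖ ^ 2)
      (-∫ x, deriv (fun t => u t x) s * (2 * lap (u s) x)) s := by
  have hs : s ∈ K := mem_of_mem_nhds hK
  have hint := integrable_one_add_norm_rpow hn
  have hsq (r : ℝ) (hr : r ∈ K) : Integrable fun x => ‖gradient (u r) x‖ ^ 2 := by
    refine (hint.const_mul (C ^ 2)).mono'
      (((hu r hr).of_le one_le_two).continuous_gradient.norm.pow 2).aestronglyMeasurable
      (ae_of_all _ fun x => ?_)
    rw [Real.norm_of_nonneg (by positivity)]
    refine (pow_le_pow_left₀ (norm_nonneg _) (hgrad r hr x) 2).trans (le_of_eq ?_)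
    rw [mul_pow, sq ((1 + ‖x‖) ^ _), one_add_norm_rpow_mul_rpow]
    ring_nf
  have hgreen (r : ℝ) (hr : r ∈ K) :
      (∫ x, ‖gradient (u r) x‖ ^ 2) - ∫ x, ‖gradient (u s) x‖ ^ 2 =
        -∫ x, (u r x - u s x) * (lap (u r) x + lap (u s) x) := by
    have hr1 := (hu r hr).differentiable two_ne_zero
    have hs1 := (hu s hs).differentiable two_ne_zero
    have hval' (x : Euc n) : |u r x - u s x| ≤ 2 * C * (1 + ‖x‖) ^ (-((n : ℝ) - 2)) := by
      refine (abs_sub _ _).trans ?_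
      linarith [hval r hr x, hval s hs x]
    have hlap' (x : Euc n) :
        |lap (u r) x + lap (u s) x| ≤ 2 * C * (1 + ‖x‖) ^ (-(n : ℝ)) := by
      refine (abs_add_le _ _).trans ?_
      linarith [hlap r hr x, hlap s hs x]
    have hgrad_add (x : Euc n) : ‖gradient (u r) x + gradient (u s) x‖ ≤
        2 * C * (1 + ‖x‖) ^ (-((n : ℝ) - 1)) := by
      refine (norm_add_le _ _).trans ?_
      linarith [hgrad r hr x, hgrad s hs x]
    have hgrad_sub (x : Euc n) : ‖gradient (u r) x - gradient (u s) x‖ ≤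
        2 * C * (1 + ‖x‖) ^ (-((n : ℝ) - 1)) := by
      refine (norm_sub_le _ _).trans ?_
      linarith [hgrad r hr x, hgrad s hs x]
    have hg := integral_inner_gradient_of_decay
      (u := fun x => u r x - u s x) (v := fun x => u r x + u s x)
      (b := fun x => 4 * C ^ 2 * (1 + ‖x‖) ^ (-(2 * (n : ℝ) - 2)))
      (((hu r hr).sub (hu s hs)).of_le one_le_two) ((hu r hr).add (hu s hs))
      (hint.const_mul _)
      (fun x => by
        rw [gradient_fun_sub (hr1 x) (hs1 x), gradient_fun_add (hr1 x) (hs1 x)]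
        refine (mul_le_mul (hgrad_sub x) (hgrad_add x) (by positivity) (by positivity)).trans
          (le_of_eq ?_)
        rw [mul_mul_mul_comm, one_add_norm_rpow_mul_rpow]
        ring_nf)
      (fun x => by
        rw [gradient_fun_add (hr1 x) (hs1 x)]
        refine (mul_le_mul (hval' x) (hgrad_add x) (by positivity) (by positivity)).trans
          (le_of_eq ?_)
        have h1 : (1 + ‖x‖) = (1 + ‖x‖) ^ (1 : ℝ) := (rpow_one _).symm
        rw [mul_mul_mul_comm, one_add_norm_rpow_mul_rpow, mul_assoc (4 * C ^ 2)]
        nth_rw 3 [h1]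
        rw [one_add_norm_rpow_mul_rpow]
        ring_nf)
      (fun x => by
        rw [lap_add (hu r hr) (hu s hs)]
        refine (mul_le_mul (hval' x) (hlap' x) (by positivity) (by positivity)).trans
          (le_of_eq ?_)
        rw [mul_mul_mul_comm, one_add_norm_rpow_mul_rpow]
        ring_nf)
    simp only [lap_add (hu r hr) (hu s hs)] at hg
    rw [← hg, ← integral_sub (hsq r hr) (hsq s hs)]
    refine integral_congr_ae (ae_of_all _ fun x => ?_)
    simp only
    rw [gradient_fun_sub (hr1 x) (hs1 x), gradient_fun_add (hr1 x) (hs1 x), inner_sub_left,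
      inner_add_right, inner_add_right, real_inner_self_eq_norm_sq, real_inner_self_eq_norm_sq,
      real_inner_comm (gradient (u r) x)]
    ring
  have hK' : ∀ᶠ r in nhdsWithin s {s}ᶜ, r ∈ K := mem_nhdsWithin_of_mem_nhds hK
  rw [hasDerivAt_iff_tendsto_slope]
  have hlim : Tendsto
      (fun r => ∫ x, slope (fun t => u t x) s r * (lap (u r) x + lap (u s) x))
      (nhdsWithin s {s}ᶜ) (nhds (∫ x, deriv (fun t => u t x) s * (2 * lap (u s) x))) := by
    refine tendsto_integral_filter_of_dominated_convergence
      (fun x => 2 * C ^ 2 * (1 + ‖x‖) ^ (-(2 * (n : ℝ) - 2))) ?_ ?_ (hint.const_mul _) ?_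
    · filter_upwards [hK'] with r hr
      simp only [slope_def_field]
      exact ((((hu r hr).continuous.sub (hu s hs).continuous).div_const _).mul
        ((hu r hr).continuous_lap.add (hu s hs).continuous_lap)).aestronglyMeasurable
    · filter_upwards [hK', self_mem_nhdsWithin] with r hr hne
      refine ae_of_all _ fun x => ?_
      have hslope : ‖slope (fun t => u t x) s r‖ ≤ C * (1 + ‖x‖) ^ (-((n : ℝ) - 2)) := by
        rw [slope_def_field, norm_div, div_le_iff₀ (norm_pos_iff.2 (sub_ne_zero.2 hne))]
        exact hKc.norm_image_sub_le_of_norm_deriv_le (f := fun t => u t x) (hdiff x)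
          (fun t ht => hderiv t ht x) hs hr
      have hlap' : ‖lap (u r) x + lap (u s) x‖ ≤ 2 * C * (1 + ‖x‖) ^ (-(n : ℝ)) := by
        refine (abs_add_le _ _).trans ?_
        linarith [hlap r hr x, hlap s hs x]
      rw [norm_mul]
      refine (mul_le_mul hslope hlap' (norm_nonneg _) (by positivity)).trans (le_of_eq ?_)
      rw [mul_mul_mul_comm, one_add_norm_rpow_mul_rpow]
      ring_nf
    · refine ae_of_all _ fun x => ?_
      rw [two_mul]
      exact (hasDerivAt_iff_tendsto_slope.1 (hdiff x s hs).hasDerivAt).mul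
        (((hlap_cont x).tendsto.mono_left nhdsWithin_le_nhds).add tendsto_const_nhds)
  refine hlim.neg.congr' ?_
  filter_upwards [hK'] with r hr
  rw [slope_def_field, hgreen r hr, neg_div, ← integral_div]
  simp only [slope_def_field, div_mul_eq_mul_div]

/-- Differentiation of `∫ u ^ q` along a positive decaying family. -/
lemma hasDerivAt_integral_rpow {n : ℕ} {u : ℝ → Euc n → ℝ} {s C a q : ℝ}
    {K : Set ℝ} (hK : K ∈ nhds s) (hq : 1 ≤ q) (ha : (n : ℝ) < a * q)
    (hu : ∀ r ∈ K, Continuous (u r)) (hpos : ∀ r ∈ K, ∀ x, 0 < u r x)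
    (hdiff : ∀ x, ∀ r ∈ K, DifferentiableAt ℝ (fun t => u t x) r)
    (hmeas : Continuous fun x => deriv (fun t => u t x) s)
    (hint : Integrable fun x => u s x ^ q)
    (hval : ∀ r ∈ K, ∀ x, u r x ≤ C * (1 + ‖x‖) ^ (-a))
    (hderiv : ∀ r ∈ K, ∀ x, |deriv (fun t => u t x) r| ≤ C * (1 + ‖x‖) ^ (-a)) :
    Integrable (fun x => deriv (fun t => u t x) s * q * u s x ^ (q - 1)) ∧
    HasDerivAt (fun r => ∫ x, u r x ^ q)
      (∫ x, deriv (fun t => u t x) s * q * u s x ^ (q - 1)) s := by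
  have hs : s ∈ K := mem_of_mem_nhds hK
  have hC : 0 ≤ C := by
    have h := (hpos s hs 0).le.trans (hval s hs 0)
    simpa using h
  have hdecay : Integrable fun x : Euc n => (1 + ‖x‖) ^ (-(a * q)) :=
    integrable_one_add_norm (by rwa [finrank_euclideanSpace_fin])
  refine hasDerivAt_integral_of_dominated_loc_of_deriv_le
    (bound := fun x => C * q * C ^ (q - 1) * (1 + ‖x‖) ^ (-(a * q))) hK ?_ hint ?_
    (ae_of_all _ fun x r hr => ?_) (hdecay.const_mul _) (ae_of_all _ fun x r hr => ?_)
    (F' := fun r x => deriv (fun t => u t x) r * q * u r x ^ (q - 1))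
  · filter_upwards [hK] with r hr
    exact ((hu r hr).rpow_const fun x => Or.inl (hpos r hr x).ne').aestronglyMeasurable
  · exact ((hmeas.mul continuous_const).mul
      ((hu s hs).rpow_const fun x => Or.inl (hpos s hs x).ne')).aestronglyMeasurable
  · have hpow : u r x ^ (q - 1) ≤ C ^ (q - 1) * (1 + ‖x‖) ^ (-a * (q - 1)) := by
      refine (rpow_le_rpow (hpos r hr x).le (hval r hr x) (by linarith)).trans (le_of_eq ?_)
      rw [mul_rpow hC (by positivity), ← rpow_mul (by positivity)]
    rw [norm_mul, norm_mul, Real.norm_of_nonneg (by linarith : 0 ≤ q),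
      Real.norm_of_nonneg (rpow_nonneg (hpos r hr x).le _), Real.norm_eq_abs]
    calc |deriv (fun t => u t x) r| * q * u r x ^ (q - 1)
        ≤ C * (1 + ‖x‖) ^ (-a) * q * (C ^ (q - 1) * (1 + ‖x‖) ^ (-a * (q - 1))) := by
          gcongr
          · exact rpow_nonneg (hpos r hr x).le _
          · exact hderiv r hr x
      _ = C * q * C ^ (q - 1) * ((1 + ‖x‖) ^ (-a) * (1 + ‖x‖) ^ (-a * (q - 1))) := by ring
      _ = C * q * C ^ (q - 1) * (1 + ‖x‖) ^ (-(a * q)) := by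
          rw [one_add_norm_rpow_mul_rpow]
          ring_nf
  · exact (hdiff x r hr).hasDerivAt.rpow_const (Or.inl (hpos r hr x).ne')

/-- **Energy dissipation along the rescaled flow.** If `w` is a smooth positive solution of
`∂_s(w^p) = Δw + w^p/(1-m)` with `w(s) ∈ Ḣ¹ ∩ L^{2*}`, finite dissipation integral, and
enough decay to integrate by parts and differentiate under the integral sign, then
`s ↦ J[w(s)]` is differentiable with
`d/ds J[w(s)] = -(1/p) ∫ (Δw/w^p + 1/(1-m))² w^{2*}`; in particular it is nonincreasing. -/
theorem energy_dissipation (n : ℕ) (hn : 3 ≤ n)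
    (w : ℝ → Euc n → ℝ)
    (hpos : ∀ s, 0 < s → ∀ x, 0 < w s x)
    (hsmooth : ContDiffOn ℝ (⊤ : ℕ∞) (fun q : ℝ × Euc n => w q.1 q.2) (Set.Ioi 0 ×ˢ Set.univ))
    (hpde : ∀ s, 0 < s → ∀ x,
      HasDerivAt (fun r => w r x ^ pexp n)
        (lap (fun y => w s y) x + w s x ^ pexp n / (1 - mexp n)) s)
    (hH1 : ∀ s, 0 < s → MemH1dot n (w s))
    (hL2star : ∀ s, 0 < s → Integrable fun x => w s x ^ twoStar n)
    (hdissip : ∀ s, 0 < s → Integrable fun x =>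
      (lap (w s) x / w s x ^ pexp n + 1 / (1 - mexp n)) ^ 2 * w s x ^ twoStar n)
    (hdecay : ∀ K : Set ℝ, IsCompact K → K ⊆ Set.Ioi 0 → ∃ C : ℝ, 0 < C ∧
      ∀ s ∈ K, ∀ x : Euc n,
        w s x ≤ C * (1 + ‖x‖) ^ (-((n : ℝ) - 2)) ∧
        ‖gradient (w s) x‖ ≤ C * (1 + ‖x‖) ^ (-((n : ℝ) - 1)) ∧
        |lap (w s) x| ≤ C * (1 + ‖x‖) ^ (-(n : ℝ)) ∧
        |deriv (fun r => w r x) s| ≤ C * (1 + ‖x‖) ^ (-((n : ℝ) - 2))) :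
    (∀ s, 0 < s →
      HasDerivAt (fun r => Jfun n (w r))
        (-(1 / pexp n) *
          ∫ x, (lap (w s) x / w s x ^ pexp n + 1 / (1 - mexp n)) ^ 2 * w s x ^ twoStar n) s) ∧
    AntitoneOn (fun s => Jfun n (w s)) (Set.Ioi 0) := by
  have hn' : (3 : ℝ) ≤ n := by exact_mod_cast hn
  have hp : 0 < pexp n := div_pos (by linarith) (by linarith)
  have hq : twoStar n = pexp n + 1 := by
    have : (n : ℝ) - 2 ≠ 0 := by linarith
    rw [twoStar, pexp]
    field_simp
    ring
  have hm : 1 - mexp n ≠ 0 := by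
    have h : 1 - mexp n = 4 / ((n : ℝ) + 2) := by
      rw [mexp]
      field_simp
      ring
    rw [h]
    positivity
  have hspace (s : ℝ) (hs : 0 < s) : ContDiff ℝ 2 (w s) := by
    have h : ContDiffOn ℝ (⊤ : ℕ∞) (w s) Set.univ :=
      hsmooth.comp (f := fun x : Euc n => (s, x)) (contDiff_prodMk_right s).contDiffOn
        fun x _ => ⟨hs, Set.mem_univ x⟩
    exact contDiff_infty.1 (contDiffOn_univ.1 h) 2
  have htime (x : Euc n) : ContDiffOn ℝ 1 (fun r => w r x) (Set.Ioi 0) := by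
    have h : ContDiffOn ℝ (⊤ : ℕ∞) (fun r => w r x) (Set.Ioi 0) :=
      hsmooth.comp (f := fun r : ℝ => (r, x)) (contDiff_prodMk_left x).contDiffOn
        fun r hr => ⟨hr, Set.mem_univ x⟩
    exact h.of_le (by exact_mod_cast le_top)
  have hdiff (x : Euc n) (s : ℝ) (hs : 0 < s) : DifferentiableAt ℝ (fun r => w r x) s :=
    ((htime x).differentiableOn one_ne_zero).differentiableAt (Ioi_mem_nhds hs)
  have heq (s : ℝ) (hs : 0 < s) (x : Euc n) :
      deriv (fun r => w r x) s * pexp n * w s x ^ (pexp n - 1) =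
        lap (w s) x + w s x ^ pexp n / (1 - mexp n) :=
    ((hdiff x s hs).hasDerivAt.rpow_const (Or.inl (hpos s hs x).ne')).unique (hpde s hs x)
  have hderiv_cont (s : ℝ) (hs : 0 < s) : Continuous fun x => deriv (fun r => w r x) s := by
    have hrpow (e : ℝ) : Continuous fun x => w s x ^ e :=
      (hspace s hs).continuous.rpow_const fun x => Or.inl (hpos s hs x).ne'
    have h : (fun x => deriv (fun r => w r x) s) = fun x =>
        (lap (w s) x + w s x ^ pexp n / (1 - mexp n)) / (pexp n * w s x ^ (pexp n - 1)) := by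
      funext x
      rw [← heq s hs x, mul_assoc, mul_div_cancel_right₀]
      exact (mul_pos hp (rpow_pos_of_pos (hpos s hs x) _)).ne'
    rw [h]
    exact ((hspace s hs).continuous_lap.add ((hrpow _).div_const _)).div
      (continuous_const.mul (hrpow _))
      fun x => (mul_pos hp (rpow_pos_of_pos (hpos s hs x) _)).ne'
  have hlap_cont (s : ℝ) (hs : 0 < s) (x : Euc n) : ContinuousAt (fun r => lap (w r) x) s := by
    have hD : ContinuousAt (deriv fun r => w r x) s :=
      ((htime x).continuousOn_deriv_of_isOpen isOpen_Ioi le_rfl).continuousAt (Ioi_mem_nhds hs)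
    have hrpow (e : ℝ) : ContinuousAt (fun r => w r x ^ e) s :=
      (hdiff x s hs).continuousAt.rpow_const (Or.inl (hpos s hs x).ne')
    have hrhs : ContinuousAt (fun r => deriv (fun t => w t x) r * pexp n * w r x ^ (pexp n - 1)
        - w r x ^ pexp n / (1 - mexp n)) s :=
      ((hD.mul continuousAt_const).mul (hrpow _)).sub ((hrpow _).div_const _)
    refine hrhs.congr ?_
    filter_upwards [Ioi_mem_nhds hs] with r hr
    rw [heq r hr x, add_sub_cancel_right]
  have hmain (s : ℝ) (hs : 0 < s) : HasDerivAt (fun r => Jfun n (w r))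
      (-(1 / pexp n) *
        ∫ x, (lap (w s) x / w s x ^ pexp n + 1 / (1 - mexp n)) ^ 2 * w s x ^ twoStar n) s := by
    have hK : Set.Icc (s / 2) (2 * s) ∈ nhds s := Icc_mem_nhds (by linarith) (by linarith)
    have hKpos : Set.Icc (s / 2) (2 * s) ⊆ Set.Ioi 0 := fun r hr =>
      lt_of_lt_of_le (half_pos hs) hr.1
    obtain ⟨C, hC, hbd⟩ := hdecay _ isCompact_Icc hKpos
    have hdirichlet := hasDerivAt_integral_norm_gradient_sq hn hK (convex_Icc _ _) hC.le
      (fun r hr => hspace r (hKpos hr)) (fun x r hr => hdiff x r (hKpos hr)) (hlap_cont s hs)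
      (fun r hr x => by
        rw [abs_of_pos (hpos r (hKpos hr) x)]
        exact (hbd r hr x).1)
      (fun r hr x => (hbd r hr x).2.1) (fun r hr x => (hbd r hr x).2.2.1)
      (fun r hr x => (hbd r hr x).2.2.2)
    obtain ⟨hpot_int, hpot⟩ := hasDerivAt_integral_rpow (q := twoStar n) hK
      (by linarith) (by
        have h : ((n : ℝ) - 2) * twoStar n = 2 * n := mul_div_cancel₀ _ (by linarith)
        rw [h]
        linarith)
      (fun r hr => (hspace r (hKpos hr)).continuous) (fun r hr => hpos r (hKpos hr))
      (fun x r hr => hdiff x r (hKpos hr)) (hderiv_cont s hs) (hL2star s hs)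
      (fun r hr x => (hbd r hr x).1) (fun r hr x => (hbd r hr x).2.2.2)
    have hdir_int : Integrable fun x => deriv (fun t => w t x) s * (2 * lap (w s) x) := by
      refine ((integrable_one_add_norm_rpow hn).const_mul (2 * C ^ 2)).mono'
        ((hderiv_cont s hs).mul
          (continuous_const.mul (hspace s hs).continuous_lap)).aestronglyMeasurable
        (ae_of_all _ fun x => ?_)
      obtain ⟨-, -, hL, hD⟩ := hbd s (mem_of_mem_nhds hK) x
      calc ‖deriv (fun t => w t x) s * (2 * lap (w s) x)‖
          = 2 * (|deriv (fun t => w t x) s| * |lap (w s) x|) := by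
            rw [Real.norm_eq_abs, abs_mul, abs_mul, abs_two]
            ring
        _ ≤ 2 * (C * (1 + ‖x‖) ^ (-((n : ℝ) - 2)) * (C * (1 + ‖x‖) ^ (-(n : ℝ)))) := by
            gcongr
        _ = 2 * C ^ 2 * ((1 + ‖x‖) ^ (-((n : ℝ) - 2)) * (1 + ‖x‖) ^ (-(n : ℝ))) := by ring
        _ = 2 * C ^ 2 * (1 + ‖x‖) ^ (-(2 * (n : ℝ) - 2)) := by
            rw [one_add_norm_rpow_mul_rpow]
            ring_nf
    refine ((hdirichlet.div_const 2).sub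
      (hpot.const_mul (1 / ((1 - mexp n) * twoStar n)))).congr_deriv ?_
    rw [neg_div, ← integral_div, ← integral_const_mul, ← neg_add', neg_mul, neg_inj,
      ← integral_add (hdir_int.div_const 2) (hpot_int.const_mul _), ← integral_const_mul]
    refine integral_congr_ae (ae_of_all _ fun x => ?_)
    have hw := hpos s hs x
    have hP := rpow_pos_of_pos hw (pexp n)
    have hq0 : twoStar n ≠ 0 := by linarith
    have h := heq s hs x
    rw [rpow_sub_one hw.ne'] at h
    simp only
    rw [show twoStar n - 1 = pexp n by linarith,
      show w s x ^ twoStar n = w s x ^ pexp n * w s x by rw [hq, rpow_add_one hw.ne']]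
    generalize deriv (fun t => w t x) s = D at h ⊢
    generalize w s x ^ pexp n = P at hP h ⊢
    generalize lap (w s) x = L at h ⊢
    have hL : L = D * pexp n * (P / w s x) - P / (1 - mexp n) := by linarith
    subst hL
    field_simp
    ring
  refine ⟨hmain, antitoneOn_of_deriv_nonpos (convex_Ioi 0)
    (fun s hs => (hmain s hs).continuousAt.continuousWithinAt) ?_ ?_⟩ <;> rw [interior_Ioi]
  · exact fun s hs => (hmain s hs).differentiableAt.differentiableWithinAt
  · intro s hs
    rw [(hmain s hs).deriv, neg_mul, neg_nonpos]
    exact mul_nonneg (by positivity) (integral_nonneg fun x =>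
      mul_nonneg (sq_nonneg _) (rpow_nonneg (hpos s hs x).le _))
end
end

section
/- Let n ≥ 3, m = (n−2)/(n+2), p = (n+2)/(n−2), 2* = 2n/(n−2), and let w : (0,∞) × ℝⁿ → (0,∞) be a smooth positive solution of ∂_s (w^p) = Δw + w^p/(1−m), with w(r,·) ∈ L^{2*}(ℝⁿ) and Δw(r,·) + w(r,·)^p/(1−m) ∈ L^{2n/(n+2)}(ℝⁿ) for each r, and with sufficient regularity to differentiate ∫ w^{2*} in s under the integral sign. Then for all 0 < t < s, ∫_{ℝⁿ} |w(s,·) − w(t,·)|^{2*} ≤ (2n/(n+2)) ∫_t^s ‖Δw(r,·) + w(r,·)^p/(1−m)‖_{L^{2n/(n+2)}(ℝⁿ)} ‖w(r,·)‖_{L^{2*}(ℝⁿ)} dr. -/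
open MeasureTheory Real Filter

noncomputable section

section FlowEstimates

open Set Function Topology

/-- The `i`-th partial derivative. -/
def pderiv {n : ℕ} (i : Fin n) (u : Euc n → ℝ) (x : Euc n) : ℝ :=
  fderiv ℝ u x (EuclideanSpace.single i 1)

/-- The squared norm of the gradient. -/
def gradSq {n : ℕ} (u : Euc n → ℝ) (x : Euc n) : ℝ := ∑ i, pderiv i u x ^ 2

lemma lap_eq_sum_pderiv {n : ℕ} (u : Euc n → ℝ) (x : Euc n) :
    lap u x = ∑ i, pderiv i (pderiv i u) x := rfl

lemma gradSq_nonneg {n : ℕ} (u : Euc n → ℝ) (x : Euc n) : 0 ≤ gradSq u x :=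
  Finset.sum_nonneg fun _ _ => sq_nonneg _

lemma ContDiff.pderiv {n : ℕ} {u : Euc n → ℝ} (hu : ContDiff ℝ (⊤ : ℕ∞) u) (i : Fin n) :
    ContDiff ℝ (⊤ : ℕ∞) (pderiv i u) :=
  (hu.fderiv_right (m := (⊤ : ℕ∞)) (by simp)).clm_apply contDiff_const

lemma ContDiff.continuous_gradSq {n : ℕ} {u : Euc n → ℝ} (hu : ContDiff ℝ (⊤ : ℕ∞) u) :
    Continuous (gradSq u) :=
  continuous_finsetSum _ fun i _ => (hu.pderiv i).continuous.pow 2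

lemma pderiv_mul {n : ℕ} {f g : Euc n → ℝ} (hf : Differentiable ℝ f) (hg : Differentiable ℝ g)
    (i : Fin n) (x : Euc n) :
    pderiv i (fun y => f y * g y) x = f x * pderiv i g x + g x * pderiv i f x := by
  simp only [pderiv]
  rw [fderiv_fun_mul (hf x) (hg x)]
  simp

lemma HasCompactSupport.pderiv {n : ℕ} {u : Euc n → ℝ} (hu : HasCompactSupport u) (i : Fin n) :
    HasCompactSupport (pderiv i u) :=
  hu.fderiv_apply (𝕜 := ℝ) _

/-- Integration by parts against a compactly supported function. -/
lemma integral_mul_lap {n : ℕ} {φ g : Euc n → ℝ} (hφ : ContDiff ℝ (⊤ : ℕ∞) φ)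
    (hφc : HasCompactSupport φ) (hg : ContDiff ℝ (⊤ : ℕ∞) g) :
    ∫ x, φ x * lap g x = -∫ x, ∑ i, pderiv i φ x * pderiv i g x := by
  have h1 : ∀ i : Fin n, Integrable fun x => φ x * pderiv i (pderiv i g) x := fun i =>
    (hφ.continuous.mul ((hg.pderiv i).pderiv i).continuous).integrable_of_hasCompactSupport
      hφc.mul_right
  have h2 : ∀ i : Fin n, Integrable fun x => pderiv i φ x * pderiv i g x := fun i =>
    ((hφ.pderiv i).continuous.mul (hg.pderiv i).continuous).integrable_of_hasCompactSupport
      (hφc.pderiv i).mul_right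
  have h3 : ∀ i : Fin n, Integrable fun x => φ x * pderiv i g x := fun i =>
    (hφ.continuous.mul (hg.pderiv i).continuous).integrable_of_hasCompactSupport hφc.mul_right
  simp only [lap_eq_sum_pderiv, Finset.mul_sum]
  rw [integral_finsetSum _ fun i _ => h1 i, integral_finsetSum _ fun i _ => h2 i,
    ← Finset.sum_neg_distrib]
  refine Finset.sum_congr rfl fun i _ => ?_
  exact integral_mul_fderiv_eq_neg_fderiv_mul_of_integrable (h2 i) (h1 i) (h3 i)
    (fun x _ => (hφ.differentiable (by simp)).differentiableAt)
    (fun x _ => ((hg.pderiv i).differentiable (by simp)).differentiableAt)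

section CompactSupport

variable {X : Type*} [TopologicalSpace X] [FirstCountableTopology X] [LocallyCompactSpace X]
  {n : ℕ} {K : Set (Euc n)}

/-- The integral of a jointly continuous function supported in a fixed compact set depends
continuously on the parameter. -/
lemma continuous_integral_of_compact {F : X → Euc n → ℝ} (hF : Continuous (uncurry F))
    (hK : IsCompact K) (hz : ∀ r, ∀ x ∉ K, F r x = 0) : Continuous fun r => ∫ x, F r x := by
  have h := continuous_parametric_integral_of_continuous (μ := volume) hF hK
  refine h.congr fun r => ?_
  exact setIntegral_eq_integral_of_forall_compl_eq_zero (hz r)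

lemma integrable_of_compact {f : Euc n → ℝ} (hf : Continuous f)
    (hK : IsCompact K) (hz : ∀ x ∉ K, f x = 0) : Integrable f :=
  hf.integrable_of_hasCompactSupport (HasCompactSupport.intro hK hz)

lemma integrable_prod_of_compact {F : ℝ → Euc n → ℝ} (hF : Continuous (uncurry F))
    (hK : IsCompact K) (hz : ∀ r, ∀ x ∉ K, F r x = 0) {a b : ℝ} {s : Set ℝ} (hs : s ⊆ Icc a b)
    (hsm : MeasurableSet s) :
    Integrable (uncurry F) ((volume.restrict s).prod volume) := by
  have h1 : IntegrableOn (uncurry F) (Icc a b ×ˢ K) (volume.prod volume) :=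
    hF.continuousOn.integrableOn_compact (isCompact_Icc.prod hK)
  have h2 : IntegrableOn (uncurry F) (s ×ˢ univ) (volume.prod volume) := by
    refine (h1.mono_set (prod_mono_left hs)).of_forall_sdiff_eq_zero
      (hsm.prod MeasurableSet.univ) ?_
    rintro ⟨r, x⟩ ⟨⟨hr, -⟩, hx⟩
    exact hz r x fun hxK => hx ⟨hr, hxK⟩
  rwa [IntegrableOn, ← Measure.prod_restrict, Measure.restrict_univ] at h2

/-- Fubini's theorem for jointly continuous functions supported in a fixed compact set. -/
lemma integral_intervalIntegral_of_compact {F : ℝ → Euc n → ℝ} (hF : Continuous (uncurry F))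
    (hK : IsCompact K) (hz : ∀ r, ∀ x ∉ K, F r x = 0) (a b : ℝ) :
    ∫ x, (∫ r in a..b, F r x) = ∫ r in a..b, ∫ x, F r x :=
  (intervalIntegral_integral_swap (integrable_prod_of_compact hF hK hz
    uIoc_subset_uIcc measurableSet_uIoc)).symm

end CompactSupport

lemma sq_intervalIntegral_le {f : ℝ → ℝ} (hf : Continuous f) {a h : ℝ} (hh : 0 < h) :
    (∫ r in a..a + h, f r) ^ 2 ≤ h * ∫ r in a..a + h, f r ^ 2 := by
  set m := (∫ r in a..a + h, f r) / h with hm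
  have h0 : 0 ≤ ∫ r in a..a + h, (f r - m) ^ 2 :=
    intervalIntegral.integral_nonneg (by linarith) fun _ _ => sq_nonneg _
  have h1 : ∫ r in a..a + h, (f r - m) ^ 2 =
      (∫ r in a..a + h, f r ^ 2) - 2 * m * (∫ r in a..a + h, f r) + h * m ^ 2 := by
    have : ∀ r, (f r - m) ^ 2 = f r ^ 2 - 2 * m * f r + m ^ 2 := fun r => by ring
    simp only [this]
    rw [intervalIntegral.integral_add, intervalIntegral.integral_sub,
      intervalIntegral.integral_const_mul, intervalIntegral.integral_const]
    · simp
    all_goals exact Continuous.intervalIntegrable (by fun_prop) _ _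
  have h2 : (∫ r in a..a + h, f r) = h * m := by rw [hm]; field_simp
  rw [h1, h2] at h0
  rw [h2]
  nlinarith

/-- Cutoff functions whose gradients are bounded in the scale-invariant norm `L^n`. -/
lemma exists_cutoff (n : ℕ) : ∃ (ζ : ℕ → Euc n → ℝ) (C : ℝ), ∀ k,
    ContDiff ℝ (⊤ : ℕ∞) (ζ k) ∧ HasCompactSupport (ζ k) ∧ (∀ x, 0 ≤ ζ k x ∧ ζ k x ≤ 1) ∧
    (∀ x, ‖x‖ ≤ k → ζ k x = 1) ∧ (∀ x, ‖x‖ < k → gradSq (ζ k) x = 0) ∧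
    ∫ x, gradSq (ζ k) x ^ ((n : ℝ) / 2) ≤ C := by
  let χ : ContDiffBump (0 : Euc n) := ⟨1, 2, one_pos, one_lt_two⟩
  have hχ : ContDiff ℝ (⊤ : ℕ∞) χ := χ.contDiff
  refine ⟨fun k x => χ (((k : ℝ) + 1)⁻¹ • x), ∫ x, gradSq χ x ^ ((n : ℝ) / 2), fun k => ?_⟩
  have hk : (0 : ℝ) < (k : ℝ) + 1 := by positivity
  have hone : ∀ x : Euc n, ‖x‖ ≤ k → χ (((k : ℝ) + 1)⁻¹ • x) = 1 := by
    intro x hx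
    refine χ.one_of_mem_closedBall ?_
    rw [mem_closedBall_zero_iff, norm_smul, norm_inv, Real.norm_of_nonneg hk.le]
    rw [inv_mul_le_iff₀ hk]
    show ‖x‖ ≤ ((k : ℝ) + 1) * 1
    linarith
  have hg : ∀ x : Euc n, gradSq (fun x => χ (((k : ℝ) + 1)⁻¹ • x)) x =
      (((k : ℝ) + 1)⁻¹) ^ 2 * gradSq χ (((k : ℝ) + 1)⁻¹ • x) := by
    intro x
    simp only [gradSq, pderiv, Finset.mul_sum]
    refine Finset.sum_congr rfl fun i _ => ?_
    rw [fderiv_comp_smul]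
    simp [mul_pow]
  refine ⟨hχ.comp (by fun_prop), ?_, fun x => ⟨χ.nonneg, χ.le_one⟩, hone, ?_, le_of_eq ?_⟩
  · exact χ.hasCompactSupport.comp_smul (inv_ne_zero hk.ne')
  · intro x hx
    have : (fun x : Euc n => χ (((k : ℝ) + 1)⁻¹ • x)) =ᶠ[𝓝 x] fun _ => 1 := by
      filter_upwards [(isOpen_lt continuous_norm continuous_const).mem_nhds hx] with y hy
      exact hone y (le_of_lt hy)
    simp [gradSq, pderiv, this.fderiv_eq]
  · have hpow : ∀ x : Euc n, gradSq (fun x => χ (((k : ℝ) + 1)⁻¹ • x)) x ^ ((n : ℝ) / 2) =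
        (((k : ℝ) + 1) ^ n)⁻¹ *
          (fun y => gradSq χ y ^ ((n : ℝ) / 2)) (((k : ℝ) + 1)⁻¹ • x) := by
      intro x
      rw [hg, mul_rpow (by positivity) (gradSq_nonneg _ _)]
      congr 1
      rw [← Real.rpow_natCast, ← Real.rpow_mul (by positivity)]
      rw [show ((2 : ℕ) : ℝ) * ((n : ℝ) / 2) = (n : ℝ) by push_cast; ring, Real.rpow_natCast,
        inv_pow]
    simp only [hpow]
    rw [integral_const_mul, Measure.integral_comp_inv_smul volume
      (fun y => gradSq χ y ^ ((n : ℝ) / 2)) ((k : ℝ) + 1)]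
    simp only [finrank_euclideanSpace, Fintype.card_fin, smul_eq_mul, abs_of_pos (pow_pos hk n)]
    field_simp

/-- The exponent `2n/(n+2)`, dual to `twoStar n`. -/
def qexp (n : ℕ) : ℝ := 2 * (n : ℝ) / ((n : ℝ) + 2)

lemma three_le_cast {n : ℕ} (hn : 3 ≤ n) : (3 : ℝ) ≤ n := by exact_mod_cast hn

lemma pexp_pos {n : ℕ} (hn : 3 ≤ n) : 0 < pexp n := by
  have := three_le_cast hn
  unfold pexp
  apply div_pos <;> linarith

lemma qexp_pos {n : ℕ} (hn : 3 ≤ n) : 0 < qexp n := by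
  have := three_le_cast hn
  unfold qexp
  apply div_pos <;> linarith

lemma twoStar_pos {n : ℕ} (hn : 3 ≤ n) : 0 < twoStar n := by
  have := three_le_cast hn
  unfold twoStar
  apply div_pos <;> linarith

lemma one_lt_qexp {n : ℕ} (hn : 3 ≤ n) : 1 < qexp n := by
  have := three_le_cast hn
  unfold qexp
  rw [lt_div_iff₀ (by linarith)]
  linarith

lemma one_le_twoStar {n : ℕ} (hn : 3 ≤ n) : 1 ≤ twoStar n := by
  have := three_le_cast hn
  unfold twoStar
  rw [le_div_iff₀ (by linarith)]
  linarith

lemma pexp_mul_qexp {n : ℕ} (hn : 3 ≤ n) : pexp n * qexp n = twoStar n := by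
  have := three_le_cast hn
  have h1 : (n : ℝ) - 2 ≠ 0 := by linarith
  have h2 : (n : ℝ) + 2 ≠ 0 := by linarith
  unfold pexp qexp twoStar
  field_simp

lemma pexp_mul_qexp_sub_one {n : ℕ} (hn : 3 ≤ n) : pexp n * (qexp n - 1) = 1 := by
  have := three_le_cast hn
  have h1 : (n : ℝ) - 2 ≠ 0 := by linarith
  have h2 : (n : ℝ) + 2 ≠ 0 := by linarith
  unfold pexp qexp
  field_simp
  ring

/-- A positive solution of `∂ᵣ(w ^ p) = Δw` for times in `(A, B)`, continuous together with its
first and second spatial derivatives for all times. -/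
structure IsFastDiffusion (n : ℕ) (w : ℝ → Euc n → ℝ) (A B : ℝ) : Prop where
  smooth : ∀ r, ContDiff ℝ (⊤ : ℕ∞) (w r)
  cont : Continuous fun q : ℝ × Euc n => w q.1 q.2
  cont_pderiv : ∀ i, Continuous fun q : ℝ × Euc n => pderiv i (w q.1) q.2
  cont_lap : Continuous fun q : ℝ × Euc n => lap (w q.1) q.2
  pos : ∀ r x, 0 < w r x
  hasDerivAt : ∀ r ∈ Ioo A B, ∀ x, HasDerivAt (fun r => w r x ^ pexp n) (lap (w r) x) r

lemma pderiv_eq_zero_of_notMem_tsupport {n : ℕ} {ζ : Euc n → ℝ} {x : Euc n}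
    (hx : x ∉ tsupport ζ) (i : Fin n) : pderiv i ζ x = 0 := by
  simp [pderiv, fderiv_of_notMem_tsupport ℝ hx]

lemma gradSq_eq_zero_of_notMem_tsupport {n : ℕ} {ζ : Euc n → ℝ} {x : Euc n}
    (hx : x ∉ tsupport ζ) : gradSq ζ x = 0 := by
  simp [gradSq, pderiv_eq_zero_of_notMem_tsupport hx]

lemma pderiv_sq_mul {n : ℕ} {ζ f : Euc n → ℝ} (hζ : ContDiff ℝ (⊤ : ℕ∞) ζ)
    (hf : ContDiff ℝ (⊤ : ℕ∞) f) (i : Fin n) (x : Euc n) :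
    pderiv i (fun y => ζ y ^ 2 * f y) x =
      ζ x ^ 2 * pderiv i f x + 2 * ζ x * f x * pderiv i ζ x := by
  have hd : Differentiable ℝ ζ := hζ.differentiable (by simp)
  have hd' : Differentiable ℝ f := hf.differentiable (by simp)
  simp only [pow_two]
  rw [pderiv_mul (hd.fun_mul hd) hd', pderiv_mul hd hd]
  ring

namespace IsFastDiffusion

variable {n : ℕ} {w : ℝ → Euc n → ℝ} {A B : ℝ}

lemma cont_gradSq (H : IsFastDiffusion n w A B) :
    Continuous fun q : ℝ × Euc n => gradSq (w q.1) q.2 :=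
  continuous_finsetSum _ fun i _ => (H.cont_pderiv i).pow 2

lemma cont_rpow (H : IsFastDiffusion n w A B) (c : ℝ) :
    Continuous fun q : ℝ × Euc n => w q.1 q.2 ^ c :=
  H.cont.rpow_const fun q => Or.inl (H.pos q.1 q.2).ne'

lemma hasDerivAt_rpow_twoStar (H : IsFastDiffusion n w A B) (hn : 3 ≤ n) {r : ℝ}
    (hr : r ∈ Ioo A B) (x : Euc n) :
    HasDerivAt (fun r => w r x ^ twoStar n) (qexp n * (w r x * lap (w r) x)) r := by
  have h := (H.hasDerivAt r hr x).rpow_const (p := qexp n)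
    (Or.inl (rpow_pos_of_pos (H.pos r x) _).ne')
  refine (h.congr_of_eventuallyEq (Eventually.of_forall fun s => ?_)).congr_deriv ?_
  · simp only
    rw [← rpow_mul (H.pos s x).le, pexp_mul_qexp hn]
  · rw [← rpow_mul (H.pos r x).le, pexp_mul_qexp_sub_one hn, rpow_one]
    ring

lemma hasDerivAt_self (H : IsFastDiffusion n w A B) (hn : 3 ≤ n) {r : ℝ}
    (hr : r ∈ Ioo A B) (x : Euc n) :
    HasDerivAt (fun r => w r x) (lap (w r) x * w r x ^ (1 - pexp n) / pexp n) r := by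
  have hp := pexp_pos hn
  have h := (H.hasDerivAt r hr x).rpow_const (p := (pexp n)⁻¹)
    (Or.inl (rpow_pos_of_pos (H.pos r x) _).ne')
  refine (h.congr_of_eventuallyEq (Eventually.of_forall fun s => ?_)).congr_deriv ?_
  · simp only
    rw [← rpow_mul (H.pos s x).le, mul_inv_cancel₀ hp.ne', rpow_one]
  · rw [← rpow_mul (H.pos r x).le,
      show pexp n * ((pexp n)⁻¹ - 1) = 1 - pexp n by field_simp]
    field_simp

lemma intervalIntegral_lap (H : IsFastDiffusion n w A B) {s t : ℝ} (hs : A < s) (hst : s ≤ t)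
    (ht : t < B) (x : Euc n) :
    ∫ r in s..t, lap (w r) x = w t x ^ pexp n - w s x ^ pexp n := by
  refine intervalIntegral.integral_eq_sub_of_hasDerivAt (f := fun r => w r x ^ pexp n)
    (fun r hr => ?_) (Continuous.intervalIntegrable ?_ _ _)
  · rw [uIcc_of_le hst] at hr
    exact H.hasDerivAt r ⟨hs.trans_le hr.1, hr.2.trans_lt ht⟩ x
  · exact H.cont_lap.comp (continuous_id.prodMk continuous_const)

/-- Local energy estimate: the Dirichlet energy is controlled by the decay of `∫ w ^ 2*`. -/
lemma local_energy (H : IsFastDiffusion n w A B) (hn : 3 ≤ n) {ζ : Euc n → ℝ}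
    (hζ : ContDiff ℝ (⊤ : ℕ∞) ζ) (hζc : HasCompactSupport ζ) {s t : ℝ} (hs : A < s)
    (hst : s ≤ t) (ht : t < B) :
    qexp n / 2 * ∫ r in s..t, ∫ x, ζ x ^ 2 * gradSq (w r) x ≤
      (∫ x, ζ x ^ 2 * w s x ^ twoStar n) - (∫ x, ζ x ^ 2 * w t x ^ twoStar n) +
        2 * qexp n * ∫ r in s..t, ∫ x, w r x ^ 2 * gradSq ζ x := by
  have hq := qexp_pos hn
  have hζ' := hζ.continuous
  have hz : ∀ x ∉ tsupport ζ, ζ x = 0 := fun x hx => image_eq_zero_of_notMem_tsupport hx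
  have hz' : ∀ x ∉ tsupport ζ, gradSq ζ x = 0 := fun x hx =>
    gradSq_eq_zero_of_notMem_tsupport hx
  have hE : Continuous fun q : ℝ × Euc n => ζ q.2 ^ 2 * gradSq (w q.1) q.2 :=
    ((hζ'.comp continuous_snd).pow 2).mul H.cont_gradSq
  have hY : Continuous fun q : ℝ × Euc n => w q.1 q.2 ^ 2 * gradSq ζ q.2 :=
    (H.cont.pow 2).mul (hζ.continuous_gradSq.comp continuous_snd)
  have hP : Continuous fun q : ℝ × Euc n => ζ q.2 ^ 2 * w q.1 q.2 * lap (w q.1) q.2 :=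
    (((hζ'.comp continuous_snd).pow 2).mul H.cont).mul H.cont_lap
  have hslice : ∀ r, Continuous fun x : Euc n => ((r, x) : ℝ × Euc n) := fun r => by fun_prop
  have hInt : ∀ r, Integrable fun x => ζ x ^ 2 * w r x ^ twoStar n := fun r =>
    integrable_of_compact ((hζ'.pow 2).mul ((H.cont_rpow _).comp (hslice r))) hζc
      fun x hx => by simp [hz x hx]
  have key : ∀ r, ∫ x, ζ x ^ 2 * w r x * lap (w r) x ≤
      -(1 / 2) * (∫ x, ζ x ^ 2 * gradSq (w r) x) + 2 * ∫ x, w r x ^ 2 * gradSq ζ x := by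
    intro r
    have hφ : ContDiff ℝ (⊤ : ℕ∞) fun x => ζ x ^ 2 * w r x := (hζ.pow 2).mul (H.smooth r)
    have hφc : HasCompactSupport fun x => ζ x ^ 2 * w r x :=
      HasCompactSupport.intro hζc fun x hx => by simp [hz x hx]
    rw [integral_mul_lap hφ hφc (H.smooth r), ← integral_neg, ← integral_const_mul,
      ← integral_const_mul, ← integral_add]
    · refine integral_mono ?_ ?_ fun x => ?_
      · refine (integrable_of_compact (continuous_finsetSum _ fun i _ =>
          (hφ.pderiv i).continuous.mul ((H.smooth r).pderiv i).continuous) hφc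
            fun x hx => ?_).neg
        simp [pderiv_eq_zero_of_notMem_tsupport hx]
      · refine (integrable_of_compact (hE.comp (hslice r)) hζc fun x hx => ?_).const_mul _ |>.add
          ((integrable_of_compact (hY.comp (hslice r)) hζc fun x hx => ?_).const_mul _)
        · simp [hz x hx]
        · simp [hz' x hx]
      · simp only [gradSq, Finset.mul_sum, ← Finset.sum_neg_distrib, ← Finset.sum_add_distrib]
        refine Finset.sum_le_sum fun i _ => ?_
        rw [pderiv_sq_mul hζ (H.smooth r)]
        nlinarith [sq_nonneg (ζ x * pderiv i (w r) x + 2 * w r x * pderiv i ζ x)]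
    · exact (integrable_of_compact (hE.comp (hslice r)) hζc fun x hx => by
        simp [hz x hx]).const_mul _
    · exact (integrable_of_compact (hY.comp (hslice r)) hζc fun x hx => by
        simp [hz' x hx]).const_mul _
  have hcE := continuous_integral_of_compact (F := fun r x => ζ x ^ 2 * gradSq (w r) x) hE hζc
    fun r x hx => by simp [hz x hx]
  have hcY := continuous_integral_of_compact (F := fun r x => w r x ^ 2 * gradSq ζ x) hY hζc
    fun r x hx => by simp [hz' x hx]
  have hcP := continuous_integral_of_compact (F := fun r x => ζ x ^ 2 * w r x * lap (w r) x) hP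
    hζc fun r x hx => by simp [hz x hx]
  have hmono : ∫ r in s..t, ∫ x, ζ x ^ 2 * w r x * lap (w r) x ≤
      -(1 / 2) * (∫ r in s..t, ∫ x, ζ x ^ 2 * gradSq (w r) x) +
        2 * ∫ r in s..t, ∫ x, w r x ^ 2 * gradSq ζ x := by
    rw [← intervalIntegral.integral_const_mul, ← intervalIntegral.integral_const_mul,
      ← intervalIntegral.integral_add]
    · exact intervalIntegral.integral_mono_on hst (hcP.intervalIntegrable _ _)
        (Continuous.intervalIntegrable (by fun_prop) _ _) fun r _ => key r
    all_goals exact Continuous.intervalIntegrable (by fun_prop) _ _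
  have hftc : (∫ x, ζ x ^ 2 * w t x ^ twoStar n) - (∫ x, ζ x ^ 2 * w s x ^ twoStar n) =
      qexp n * ∫ r in s..t, ∫ x, ζ x ^ 2 * w r x * lap (w r) x := by
    rw [← integral_intervalIntegral_of_compact (F := fun r x => ζ x ^ 2 * w r x * lap (w r) x)
      hP hζc fun r x hx => by simp [hz x hx]]
    rw [← integral_sub (hInt t) (hInt s), ← integral_const_mul]
    refine integral_congr_ae (Eventually.of_forall fun x => ?_)
    have hc : Continuous fun r => qexp n * (w r x * lap (w r) x) :=
      ((H.cont.mul H.cont_lap).comp (continuous_id.prodMk continuous_const)).const_mul _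
    have h := intervalIntegral.integral_eq_sub_of_hasDerivAt (a := s) (b := t)
      (f := fun r => w r x ^ twoStar n)
      (f' := fun r => qexp n * (w r x * lap (w r) x)) (fun r hr => by
        rw [uIcc_of_le hst] at hr
        exact H.hasDerivAt_rpow_twoStar hn ⟨hs.trans_le hr.1, hr.2.trans_lt ht⟩ x)
      (hc.intervalIntegrable _ _)
    simp only [mul_assoc, intervalIntegral.integral_const_mul] at h ⊢
    rw [← mul_sub, ← h]
    ring
  nlinarith [mul_le_mul_of_nonneg_left hmono hq.le]

end IsFastDiffusion

/-- The partial derivatives of `w` integrated over the time window `[τ, τ + h]`. -/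
def windowPderiv {n : ℕ} (w : ℝ → Euc n → ℝ) (h : ℝ) (i : Fin n) (τ : ℝ) (x : Euc n) : ℝ :=
  ∫ σ in τ..τ + h, pderiv i (w σ) x

namespace IsFastDiffusion

variable {n : ℕ} {w : ℝ → Euc n → ℝ} {A B : ℝ}

lemma cont_pderiv_left (H : IsFastDiffusion n w A B) (i : Fin n) (x : Euc n) :
    Continuous fun r => pderiv i (w r) x :=
  (H.cont_pderiv i).comp (continuous_id.prodMk continuous_const)

lemma cont_windowPderiv (H : IsFastDiffusion n w A B) (h : ℝ) (i : Fin n) :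
    Continuous fun q : ℝ × Euc n => windowPderiv w h i q.1 q.2 := by
  have hc : Continuous (uncurry fun (q : ℝ × Euc n) (σ : ℝ) => pderiv i (w σ) q.2) :=
    (H.cont_pderiv i).comp (continuous_snd.prodMk (continuous_snd.comp continuous_fst))
  have h1 := intervalIntegral.continuous_parametric_intervalIntegral_of_continuous (μ := volume)
    (a₀ := 0) hc (continuous_fst.add continuous_const : Continuous fun q : ℝ × Euc n => q.1 + h)
  have h2 := intervalIntegral.continuous_parametric_intervalIntegral_of_continuous (μ := volume)
    (a₀ := 0) hc (continuous_fst : Continuous fun q : ℝ × Euc n => q.1)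
  refine (h1.sub h2).congr fun q => ?_
  exact intervalIntegral.integral_interval_sub_left
    ((H.cont_pderiv_left i q.2).intervalIntegrable _ _)
    ((H.cont_pderiv_left i q.2).intervalIntegrable _ _)

lemma hasDerivAt_windowPderiv (H : IsFastDiffusion n w A B) (h : ℝ) (i : Fin n) (τ : ℝ)
    (x : Euc n) :
    HasDerivAt (fun τ => windowPderiv w h i τ x)
      (pderiv i (w (τ + h)) x - pderiv i (w τ) x) τ := by
  have hc := H.cont_pderiv_left i x
  have hd : ∀ s, HasDerivAt (fun s => ∫ σ in (0 : ℝ)..s, pderiv i (w σ) x)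
      (pderiv i (w s) x) s := fun s =>
    intervalIntegral.integral_hasDerivAt_right (hc.intervalIntegrable _ _)
      hc.stronglyMeasurable.stronglyMeasurableAtFilter hc.continuousAt
  have h1 := (hd (τ + h)).comp_add_const τ h
  refine (h1.sub (hd τ)).congr_of_eventuallyEq (Eventually.of_forall fun s => ?_)
  exact (intervalIntegral.integral_interval_sub_left (hc.intervalIntegrable _ _)
    (hc.intervalIntegrable _ _)).symm

/-- Weak form of the equation, integrated over a time window. -/
lemma integral_mul_increment (H : IsFastDiffusion n w A B) {φ : Euc n → ℝ}
    (hφ : ContDiff ℝ (⊤ : ℕ∞) φ) (hφc : HasCompactSupport φ) {τ h : ℝ} (hτ : A < τ)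
    (hh : 0 < h) (hτh : τ + h < B) :
    ∫ x, φ x * (w (τ + h) x ^ pexp n - w τ x ^ pexp n) =
      -∫ x, ∑ i, pderiv i φ x * windowPderiv w h i τ x := by
  have hz : ∀ x ∉ tsupport φ, φ x = 0 := fun x hx => image_eq_zero_of_notMem_tsupport hx
  calc ∫ x, φ x * (w (τ + h) x ^ pexp n - w τ x ^ pexp n)
      = ∫ x, ∫ σ in τ..τ + h, φ x * lap (w σ) x := by
        refine integral_congr_ae (Eventually.of_forall fun x => ?_)
        simp only
        rw [intervalIntegral.integral_const_mul,
          H.intervalIntegral_lap hτ (by linarith) hτh]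
    _ = ∫ σ in τ..τ + h, ∫ x, φ x * lap (w σ) x :=
        integral_intervalIntegral_of_compact (F := fun σ x => φ x * lap (w σ) x)
          ((hφ.continuous.comp continuous_snd).mul H.cont_lap) hφc
          (fun r x hx => by simp [hz x hx]) _ _
    _ = ∫ σ in τ..τ + h, -∫ x, ∑ i, pderiv i φ x * pderiv i (w σ) x := by
        simp only [fun σ => integral_mul_lap hφ hφc (H.smooth σ)]
    _ = -∫ x, ∫ σ in τ..τ + h, ∑ i, pderiv i φ x * pderiv i (w σ) x := by
        rw [intervalIntegral.integral_neg, integral_intervalIntegral_of_compact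
          (F := fun σ x => ∑ i, pderiv i φ x * pderiv i (w σ) x)
          (continuous_finsetSum _ fun i _ => ((hφ.pderiv i).continuous.comp continuous_snd).mul
            (H.cont_pderiv i)) hφc]
        intro r x hx
        simp [pderiv_eq_zero_of_notMem_tsupport hx]
    _ = _ := by
        congr 1
        refine integral_congr_ae (Eventually.of_forall fun x => ?_)
        simp only
        rw [intervalIntegral.integral_finsetSum fun i _ =>
          ((H.cont_pderiv_left i x).const_mul _).intervalIntegrable _ _]
        simp only [intervalIntegral.integral_const_mul, windowPderiv]

lemma integral_sq_windowPderiv_le (H : IsFastDiffusion n w A B) {ζ : Euc n → ℝ}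
    (hζ : Continuous ζ) (hζc : HasCompactSupport ζ) (τ : ℝ) {h : ℝ} (hh : 0 < h) :
    ∫ x, ζ x ^ 2 * ∑ i, windowPderiv w h i τ x ^ 2 ≤
      h * ∫ σ in τ..τ + h, ∫ x, ζ x ^ 2 * gradSq (w σ) x := by
  have hz : ∀ x ∉ tsupport ζ, ζ x = 0 := fun x hx => image_eq_zero_of_notMem_tsupport hx
  have hE : Continuous fun q : ℝ × Euc n => ζ q.2 ^ 2 * gradSq (w q.1) q.2 :=
    ((hζ.comp continuous_snd).pow 2).mul H.cont_gradSq
  have hslice : Continuous fun x : Euc n => ((τ, x) : ℝ × Euc n) := by fun_prop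
  rw [← integral_intervalIntegral_of_compact (F := fun σ x => ζ x ^ 2 * gradSq (w σ) x) hE hζc
    (fun r x hx => by simp [hz x hx]), ← integral_const_mul]
  have hI : Continuous fun x => ∫ σ in τ..τ + h, ζ x ^ 2 * gradSq (w σ) x :=
    intervalIntegral.continuous_parametric_intervalIntegral_of_continuous'
      (f := fun x σ => ζ x ^ 2 * gradSq (w σ) x) (hE.comp continuous_swap) _ _
  refine integral_mono ?_ ?_ fun x => ?_
  · exact integrable_of_compact ((hζ.pow 2).mul (continuous_finsetSum _ fun i _ =>
      ((H.cont_windowPderiv h i).comp hslice).pow 2)) hζc fun x hx => by simp [hz x hx]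
  · exact (integrable_of_compact hI hζc fun x hx => by simp [hz x hx]).const_mul _
  · simp only [intervalIntegral.integral_const_mul, gradSq]
    have hInt : ∀ i ∈ Finset.univ,
        IntervalIntegrable (fun r => pderiv i (w r) x ^ 2) volume τ (τ + h) := fun i _ =>
      ((H.cont_pderiv_left i x).pow 2).intervalIntegrable _ _
    rw [intervalIntegral.integral_finsetSum hInt, mul_left_comm, Finset.mul_sum (a := h)]
    exact mul_le_mul_of_nonneg_left (Finset.sum_le_sum fun i _ =>
      sq_intervalIntegral_le (H.cont_pderiv_left i x) hh) (sq_nonneg _)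

/-- Localized monotonicity estimate for the time increments of the flow. -/
lemma integral_increment_le (H : IsFastDiffusion n w A B) {ζ : Euc n → ℝ}
    (hζ : ContDiff ℝ (⊤ : ℕ∞) ζ) (hζc : HasCompactSupport ζ) {a b h : ℝ} (ha : A < a)
    (hab : a ≤ b) (hh : 0 < h) (hb : b + h < B) :
    ∫ τ in a..b, ∫ x, ζ x ^ 2 * (w (τ + h) x - w τ x) *
        (w (τ + h) x ^ pexp n - w τ x ^ pexp n) ≤
      1 / 2 * (∫ x, ζ x ^ 2 * ∑ i, windowPderiv w h i a x ^ 2) +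
        (∫ τ in a..b, ∫ x, ζ x ^ 2 * ∑ i, windowPderiv w h i τ x ^ 2) +
        ∫ τ in a..b, ∫ x, (w (τ + h) x - w τ x) ^ 2 * gradSq ζ x := by
  have hz : ∀ x ∉ tsupport ζ, ζ x = 0 := fun x hx => image_eq_zero_of_notMem_tsupport hx
  have hz' : ∀ x ∉ tsupport ζ, gradSq ζ x = 0 := fun x hx =>
    gradSq_eq_zero_of_notMem_tsupport hx
  have hshift : Continuous fun q : ℝ × Euc n => (q.1 + h, q.2) := by fun_prop
  have hζ2 : Continuous fun q : ℝ × Euc n => ζ q.2 ^ 2 :=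
    (hζ.continuous.comp continuous_snd).pow 2
  have hdw : Continuous fun q : ℝ × Euc n => w (q.1 + h) q.2 - w q.1 q.2 :=
    (H.cont.comp hshift).sub H.cont
  have hcJ : Continuous fun q : ℝ × Euc n => ζ q.2 ^ 2 * (w (q.1 + h) q.2 - w q.1 q.2) *
      (w (q.1 + h) q.2 ^ pexp n - w q.1 q.2 ^ pexp n) :=
    (hζ2.mul hdw).mul (((H.cont_rpow _).comp hshift).sub (H.cont_rpow _))
  have hcD : Continuous fun q : ℝ × Euc n => ζ q.2 ^ 2 * ∑ i,
      (pderiv i (w (q.1 + h)) q.2 - pderiv i (w q.1) q.2) * windowPderiv w h i q.1 q.2 :=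
    hζ2.mul (continuous_finsetSum _ fun i _ =>
      (((H.cont_pderiv i).comp hshift).sub (H.cont_pderiv i)).mul (H.cont_windowPderiv h i))
  have hcV : Continuous fun q : ℝ × Euc n => ζ q.2 ^ 2 * ∑ i, windowPderiv w h i q.1 q.2 ^ 2 :=
    hζ2.mul (continuous_finsetSum _ fun i _ => (H.cont_windowPderiv h i).pow 2)
  have hcZ : Continuous fun q : ℝ × Euc n =>
      (w (q.1 + h) q.2 - w q.1 q.2) ^ 2 * gradSq ζ q.2 :=
    (hdw.pow 2).mul (hζ.continuous_gradSq.comp continuous_snd)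
  have hslice : ∀ r, Continuous fun x : Euc n => ((r, x) : ℝ × Euc n) := fun r => by fun_prop
  have iD : ∀ τ, Integrable fun x => ζ x ^ 2 * ∑ i,
      (pderiv i (w (τ + h)) x - pderiv i (w τ) x) * windowPderiv w h i τ x := fun τ =>
    integrable_of_compact (hcD.comp (hslice τ)) hζc fun x hx => by simp [hz x hx]
  have iV : ∀ τ, Integrable fun x => ζ x ^ 2 * ∑ i, windowPderiv w h i τ x ^ 2 := fun τ =>
    integrable_of_compact (hcV.comp (hslice τ)) hζc fun x hx => by simp [hz x hx]
  have iZ : ∀ τ, Integrable fun x => (w (τ + h) x - w τ x) ^ 2 * gradSq ζ x := fun τ =>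
    integrable_of_compact (hcZ.comp (hslice τ)) hζc fun x hx => by simp [hz' x hx]
  have key : ∀ τ ∈ Icc a b, ∫ x, ζ x ^ 2 * (w (τ + h) x - w τ x) *
      (w (τ + h) x ^ pexp n - w τ x ^ pexp n) ≤
      -(∫ x, ζ x ^ 2 * ∑ i,
        (pderiv i (w (τ + h)) x - pderiv i (w τ) x) * windowPderiv w h i τ x) +
      (∫ x, ζ x ^ 2 * ∑ i, windowPderiv w h i τ x ^ 2) +
      ∫ x, (w (τ + h) x - w τ x) ^ 2 * gradSq ζ x := by
    intro τ hτ
    have hδ : ContDiff ℝ (⊤ : ℕ∞) fun x => w (τ + h) x - w τ x :=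
      (H.smooth _).sub (H.smooth _)
    have hφ : ContDiff ℝ (⊤ : ℕ∞) fun x => ζ x ^ 2 * (w (τ + h) x - w τ x) :=
      (hζ.pow 2).mul hδ
    have hφc : HasCompactSupport fun x => ζ x ^ 2 * (w (τ + h) x - w τ x) :=
      HasCompactSupport.intro hζc fun x hx => by simp [hz x hx]
    have iDn : Integrable fun x => -(ζ x ^ 2 * ∑ i,
        (pderiv i (w (τ + h)) x - pderiv i (w τ) x) * windowPderiv w h i τ x) := (iD τ).neg
    have iDV : Integrable fun x => -(ζ x ^ 2 * ∑ i,
        (pderiv i (w (τ + h)) x - pderiv i (w τ) x) * windowPderiv w h i τ x) +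
        ζ x ^ 2 * ∑ i, windowPderiv w h i τ x ^ 2 := iDn.add (iV τ)
    rw [H.integral_mul_increment hφ hφc (ha.trans_le hτ.1) hh (by linarith [hτ.2]),
      ← integral_neg, ← integral_neg, ← integral_add iDn (iV τ), ← integral_add iDV (iZ τ)]
    refine integral_mono ?_ (iDV.add (iZ τ)) fun x => ?_
    · refine (integrable_of_compact (continuous_finsetSum _ fun i _ =>
        (hφ.pderiv i).continuous.mul ((H.cont_windowPderiv h i).comp (hslice τ))) hφc
          fun x hx => ?_).neg
      simp [pderiv_eq_zero_of_notMem_tsupport hx]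
    · simp only [gradSq, Finset.mul_sum, ← Finset.sum_neg_distrib, ← Finset.sum_add_distrib]
      refine Finset.sum_le_sum fun i _ => ?_
      have hsub : pderiv i (fun x => w (τ + h) x - w τ x) x =
          pderiv i (w (τ + h)) x - pderiv i (w τ) x := by
        simp only [pderiv]
        rw [fderiv_fun_sub ((H.smooth _).differentiable (by simp) x)
          ((H.smooth _).differentiable (by simp) x)]
        simp
      rw [pderiv_sq_mul hζ hδ, hsub]
      nlinarith [sq_nonneg (ζ x * windowPderiv w h i τ x +
        (w (τ + h) x - w τ x) * pderiv i ζ x)]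
  have cJ := continuous_integral_of_compact (F := fun τ x => ζ x ^ 2 * (w (τ + h) x - w τ x) *
      (w (τ + h) x ^ pexp n - w τ x ^ pexp n)) hcJ hζc fun r x hx => by simp [hz x hx]
  have cD := continuous_integral_of_compact (F := fun τ x => ζ x ^ 2 * ∑ i,
      (pderiv i (w (τ + h)) x - pderiv i (w τ) x) * windowPderiv w h i τ x) hcD hζc
      fun r x hx => by simp [hz x hx]
  have cV := continuous_integral_of_compact (F := fun τ x => ζ x ^ 2 * ∑ i,
      windowPderiv w h i τ x ^ 2) hcV hζc fun r x hx => by simp [hz x hx]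
  have cZ := continuous_integral_of_compact (F := fun τ x => (w (τ + h) x - w τ x) ^ 2 *
      gradSq ζ x) hcZ hζc fun r x hx => by simp [hz' x hx]
  have cDn : Continuous fun τ => -(∫ x, ζ x ^ 2 * ∑ i,
      (pderiv i (w (τ + h)) x - pderiv i (w τ) x) * windowPderiv w h i τ x) := cD.neg
  have cDV : Continuous fun τ => -(∫ x, ζ x ^ 2 * ∑ i,
      (pderiv i (w (τ + h)) x - pderiv i (w τ) x) * windowPderiv w h i τ x) +
      ∫ x, ζ x ^ 2 * ∑ i, windowPderiv w h i τ x ^ 2 := cDn.add cV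
  have hmono := intervalIntegral.integral_mono_on (μ := volume) hab
    (cJ.intervalIntegrable a b) ((cDV.add cZ).intervalIntegrable a b) key
  simp only [Pi.add_apply] at hmono
  rw [intervalIntegral.integral_add (cDV.intervalIntegrable _ _) (cZ.intervalIntegrable _ _),
    intervalIntegral.integral_add (cDn.intervalIntegrable _ _) (cV.intervalIntegrable _ _),
    intervalIntegral.integral_neg] at hmono
  have hD : -(1 / 2) * (∫ x, ζ x ^ 2 * ∑ i, windowPderiv w h i a x ^ 2) ≤
      ∫ τ in a..b, ∫ x, ζ x ^ 2 * ∑ i,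
        (pderiv i (w (τ + h)) x - pderiv i (w τ) x) * windowPderiv w h i τ x := by
    rw [← integral_intervalIntegral_of_compact (F := fun τ x => ζ x ^ 2 * ∑ i,
      (pderiv i (w (τ + h)) x - pderiv i (w τ) x) * windowPderiv w h i τ x) hcD hζc
      fun r x hx => by simp [hz x hx]]
    have hftc : ∀ x, ∫ τ in a..b, ζ x ^ 2 * ∑ i,
        (pderiv i (w (τ + h)) x - pderiv i (w τ) x) * windowPderiv w h i τ x =
        1 / 2 * (ζ x ^ 2 * ∑ i, windowPderiv w h i b x ^ 2) -
          1 / 2 * (ζ x ^ 2 * ∑ i, windowPderiv w h i a x ^ 2) := by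
      intro x
      refine intervalIntegral.integral_eq_sub_of_hasDerivAt
        (f := fun τ => 1 / 2 * (ζ x ^ 2 * ∑ i, windowPderiv w h i τ x ^ 2)) (fun τ _ => ?_)
        ((hcD.comp (continuous_id.prodMk continuous_const)).intervalIntegrable _ _)
      have := (((HasDerivAt.fun_sum fun i (_ : i ∈ Finset.univ) =>
        (H.hasDerivAt_windowPderiv h i τ x).fun_pow 2)).const_mul (ζ x ^ 2)).const_mul (1 / 2 : ℝ)
      refine this.congr_deriv ?_
      simp only [Finset.mul_sum]
      refine Finset.sum_congr rfl fun i _ => ?_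
      push_cast
      ring
    simp only [hftc]
    rw [integral_sub ((iV b).const_mul _) ((iV a).const_mul _), integral_const_mul,
      integral_const_mul]
    have : 0 ≤ ∫ x, ζ x ^ 2 * ∑ i, windowPderiv w h i b x ^ 2 :=
      integral_nonneg fun x => by positivity
    linarith
  linarith

/-- Quantitative localized bound for the time increments over windows of length `h`. -/
lemma integral_increment_le_of_bound (H : IsFastDiffusion n w A B) (hn : 3 ≤ n) {ζ : Euc n → ℝ}
    (hζ : ContDiff ℝ (⊤ : ℕ∞) ζ) (hζc : HasCompactSupport ζ) {a b h M : ℝ} (ha : A < a)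
    (hab : a ≤ b) (hh : 0 < h) (hb : b + h < B)
    (hM : ∀ r ∈ Icc a (a + h), ∫ x, ζ x ^ 2 * w r x ^ twoStar n ≤ M) :
    qexp n / 2 * ∫ τ in a..b, ∫ x, ζ x ^ 2 * (w (τ + h) x - w τ x) *
        (w (τ + h) x ^ pexp n - w τ x ^ pexp n) ≤
      h * (1 / 2 * ((∫ x, ζ x ^ 2 * w a x ^ twoStar n) -
        ∫ x, ζ x ^ 2 * w (a + h) x ^ twoStar n) + h * M) +
        2 * qexp n * (h * (1 / 2 + (b - a)) + 1) *
          ∫ r in a..b + h, ∫ x, w r x ^ 2 * gradSq ζ x := by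
  have hq := qexp_pos hn
  have hz : ∀ x ∉ tsupport ζ, ζ x = 0 := fun x hx => image_eq_zero_of_notMem_tsupport hx
  have hz' : ∀ x ∉ tsupport ζ, gradSq ζ x = 0 := fun x hx =>
    gradSq_eq_zero_of_notMem_tsupport hx
  have hslice : ∀ r, Continuous fun x : Euc n => ((r, x) : ℝ × Euc n) := fun r => by fun_prop
  have hζ2 : Continuous fun q : ℝ × Euc n => ζ q.2 ^ 2 :=
    (hζ.continuous.comp continuous_snd).pow 2
  have hcy : Continuous fun q : ℝ × Euc n => w q.1 q.2 ^ 2 * gradSq ζ q.2 :=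
    (H.cont.pow 2).mul (hζ.continuous_gradSq.comp continuous_snd)
  have iy : ∀ r, Integrable fun x => w r x ^ 2 * gradSq ζ x := fun r =>
    integrable_of_compact (hcy.comp (hslice r)) hζc fun x hx => by simp [hz' x hx]
  set Γ : ℝ → ℝ := fun r => ∫ x, ζ x ^ 2 * w r x ^ twoStar n with hΓ
  set y : ℝ → ℝ := fun r => ∫ x, w r x ^ 2 * gradSq ζ x with hy
  set V : ℝ → ℝ := fun τ => ∫ x, ζ x ^ 2 * ∑ i, windowPderiv w h i τ x ^ 2 with hV
  have cΓ : Continuous Γ := continuous_integral_of_compact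
    (F := fun r x => ζ x ^ 2 * w r x ^ twoStar n) (hζ2.mul (H.cont_rpow _)) hζc
    fun r x hx => by simp [hz x hx]
  have cy : Continuous y := continuous_integral_of_compact
    (F := fun r x => w r x ^ 2 * gradSq ζ x) hcy hζc fun r x hx => by simp [hz' x hx]
  have cV : Continuous V := continuous_integral_of_compact (F := fun τ x => ζ x ^ 2 * ∑ i,
    windowPderiv w h i τ x ^ 2) (hζ2.mul (continuous_finsetSum _ fun i _ =>
      (H.cont_windowPderiv h i).pow 2)) hζc fun r x hx => by simp [hz x hx]
  have y0 : ∀ r, 0 ≤ y r := fun r =>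
    integral_nonneg fun x => mul_nonneg (sq_nonneg _) (gradSq_nonneg _ _)
  have Γ0 : ∀ r, 0 ≤ Γ r := fun r =>
    integral_nonneg fun x => mul_nonneg (sq_nonneg _) (rpow_nonneg (H.pos r x).le _)
  have ysub : ∀ c d, a ≤ c → c ≤ d → d ≤ b + h →
      ∫ r in c..d, y r ≤ ∫ r in a..b + h, y r := fun c d h1 h2 h3 =>
    intervalIntegral.integral_mono_interval h1 h2 h3 (Eventually.of_forall y0)
      (cy.intervalIntegrable _ _)
  set Y := ∫ r in a..b + h, y r with hYdef
  have hVle : ∀ τ ∈ Icc a b,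
      qexp n / 2 * V τ ≤ h * (Γ τ - Γ (τ + h) + 2 * qexp n * Y) := by
    intro τ hτ
    have h1 := H.integral_sq_windowPderiv_le hζ.continuous hζc τ hh
    have h2 := H.local_energy hn hζ hζc (ha.trans_le hτ.1) (by linarith : τ ≤ τ + h)
      (by linarith [hτ.2])
    have h3 := ysub τ (τ + h) hτ.1 (by linarith) (by linarith [hτ.2])
    calc qexp n / 2 * V τ
        ≤ qexp n / 2 * (h * ∫ σ in τ..τ + h, ∫ x, ζ x ^ 2 * gradSq (w σ) x) :=
          mul_le_mul_of_nonneg_left h1 (by positivity)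
      _ = h * (qexp n / 2 * ∫ σ in τ..τ + h, ∫ x, ζ x ^ 2 * gradSq (w σ) x) := by ring
      _ ≤ h * (Γ τ - Γ (τ + h) + 2 * qexp n * ∫ r in τ..τ + h, y r) :=
          mul_le_mul_of_nonneg_left h2 hh.le
      _ ≤ _ := by gcongr
  have cΓh : Continuous fun τ => Γ (τ + h) := cΓ.comp (continuous_add_const h)
  have hVint : qexp n / 2 * ∫ τ in a..b, V τ ≤ h * (h * M + 2 * qexp n * Y * (b - a)) := by
    have h1 : ∫ τ in a..b, qexp n / 2 * V τ ≤
        ∫ τ in a..b, h * (Γ τ - Γ (τ + h) + 2 * qexp n * Y) :=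
      intervalIntegral.integral_mono_on hab ((cV.const_mul _).intervalIntegrable _ _)
        (Continuous.intervalIntegrable (by fun_prop) _ _) hVle
    have h2 : ∫ τ in a..b, (Γ τ - Γ (τ + h) + 2 * qexp n * Y) =
        (∫ τ in a..b, Γ τ) - (∫ τ in a + h..b + h, Γ τ) + (b - a) * (2 * qexp n * Y) := by
      rw [intervalIntegral.integral_add (Continuous.intervalIntegrable (by fun_prop) _ _)
        (Continuous.intervalIntegrable (by fun_prop) _ _), intervalIntegral.integral_sub
        (cΓ.intervalIntegrable _ _) (cΓh.intervalIntegrable _ _),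
        intervalIntegral.integral_comp_add_right]
      simp
      ring
    have h3 : (∫ τ in a..b, Γ τ) - (∫ τ in a + h..b + h, Γ τ) =
        (∫ τ in a..a + h, Γ τ) - ∫ τ in b..b + h, Γ τ :=
      intervalIntegral.integral_interval_sub_interval_comm (cΓ.intervalIntegrable _ _)
        (cΓ.intervalIntegrable _ _) (cΓ.intervalIntegrable _ _)
    have h4 : 0 ≤ ∫ τ in b..b + h, Γ τ :=
      intervalIntegral.integral_nonneg (by linarith) fun r _ => Γ0 r
    have h5 : ∫ τ in a..a + h, Γ τ ≤ ∫ τ in a..a + h, M :=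
      intervalIntegral.integral_mono_on (by linarith) (cΓ.intervalIntegrable _ _)
        (Continuous.intervalIntegrable (by fun_prop) _ _) hM
    rw [intervalIntegral.integral_const, smul_eq_mul, add_sub_cancel_left] at h5
    rw [intervalIntegral.integral_const_mul, intervalIntegral.integral_const_mul, h2, h3] at h1
    refine h1.trans (mul_le_mul_of_nonneg_left ?_ hh.le)
    linarith
  have hZ : ∫ τ in a..b, ∫ x, (w (τ + h) x - w τ x) ^ 2 * gradSq ζ x ≤ 4 * Y := by
    have cyh : Continuous fun τ => y (τ + h) := cy.comp (continuous_add_const h)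
    have hcZ : Continuous fun q : ℝ × Euc n =>
        (w (q.1 + h) q.2 - w q.1 q.2) ^ 2 * gradSq ζ q.2 :=
      (((H.cont.comp (by fun_prop : Continuous fun q : ℝ × Euc n => (q.1 + h, q.2))).sub
        H.cont).pow 2).mul (hζ.continuous_gradSq.comp continuous_snd)
    have h1 : ∫ τ in a..b, ∫ x, (w (τ + h) x - w τ x) ^ 2 * gradSq ζ x ≤
        ∫ τ in a..b, (2 * y (τ + h) + 2 * y τ) := by
      refine intervalIntegral.integral_mono_on hab
        (Continuous.intervalIntegrable (continuous_integral_of_compact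
          (F := fun τ x => (w (τ + h) x - w τ x) ^ 2 * gradSq ζ x) hcZ hζc
          fun r x hx => by simp [hz' x hx]) _ _)
        (Continuous.intervalIntegrable (by fun_prop) _ _) fun τ _ => ?_
      simp only [hy]
      rw [← integral_const_mul, ← integral_const_mul,
        ← integral_add ((iy _).const_mul _) ((iy _).const_mul _)]
      refine integral_mono (integrable_of_compact (hcZ.comp (hslice τ)) hζc
        fun x hx => by simp [hz' x hx]) (((iy _).const_mul _).add ((iy _).const_mul _))
        fun x => ?_
      have hg := gradSq_nonneg ζ x
      simp only
      nlinarith [mul_nonneg (sq_nonneg (w (τ + h) x + w τ x)) hg]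
    rw [intervalIntegral.integral_add (Continuous.intervalIntegrable (by fun_prop) _ _)
      (Continuous.intervalIntegrable (by fun_prop) _ _), intervalIntegral.integral_const_mul,
      intervalIntegral.integral_const_mul,
      intervalIntegral.integral_comp_add_right (fun τ => y τ)] at h1
    linarith [ysub (a + h) (b + h) (by linarith) (by linarith) le_rfl,
      ysub a b le_rfl hab (by linarith)]
  have hfin := H.integral_increment_le hζ hζc ha hab hh hb
  have hVa := hVle a ⟨le_rfl, hab⟩
  calc _ ≤ qexp n / 2 * (1 / 2 * V a + (∫ τ in a..b, V τ) + 4 * Y) := by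
        refine mul_le_mul_of_nonneg_left (hfin.trans ?_) (by positivity)
        gcongr
    _ = 1 / 2 * (qexp n / 2 * V a) + qexp n / 2 * (∫ τ in a..b, V τ) + 2 * qexp n * Y := by ring
    _ ≤ 1 / 2 * (h * (Γ a - Γ (a + h) + 2 * qexp n * Y)) +
          h * (h * M + 2 * qexp n * Y * (b - a)) + 2 * qexp n * Y := by gcongr
    _ = _ := by ring

end IsFastDiffusion

/-- Hölder's inequality for the cutoff error term. -/
lemma integral_sq_mul_gradSq_le {n : ℕ} (hn : 3 ≤ n) {u ζ : Euc n → ℝ} (hu : Continuous u)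
    (hpos : ∀ x, 0 < u x) (hInt : Integrable fun x => u x ^ twoStar n)
    (hζ : ContDiff ℝ (⊤ : ℕ∞) ζ) (hζc : HasCompactSupport ζ) {C : ℝ}
    (hC : ∫ x, gradSq ζ x ^ ((n : ℝ) / 2) ≤ C) {R : ℝ}
    (hR : ∀ x, ‖x‖ < R → gradSq ζ x = 0) :
    ∫ x, u x ^ 2 * gradSq ζ x ≤
      (∫ x in {x | R ≤ ‖x‖}, u x ^ twoStar n) ^ (((n : ℝ) - 2) / n) * C ^ (2 / (n : ℝ)) := by
  have h3 := three_le_cast hn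
  have hn0 : (n : ℝ) - 2 ≠ 0 := by linarith
  have hS : MeasurableSet {x : Euc n | R ≤ ‖x‖} := measurableSet_le measurable_const
    measurable_norm
  have hpq : ((n : ℝ) / (n - 2)).HolderConjugate ((n : ℝ) / 2) := by
    rw [Real.holderConjugate_iff]
    refine ⟨by rw [lt_div_iff₀] <;> linarith, ?_⟩
    field_simp
    ring
  have hpow : ∀ x, (u x ^ 2) ^ ((n : ℝ) / (n - 2)) = u x ^ twoStar n := fun x => by
    rw [← Real.rpow_natCast, ← Real.rpow_mul (hpos x).le, twoStar]
    congr 1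
    push_cast
    ring
  have hz : ∀ x ∉ tsupport ζ, gradSq ζ x = 0 := fun x hx =>
    gradSq_eq_zero_of_notMem_tsupport hx
  have m1 : MemLp (fun x => {x | R ≤ ‖x‖}.indicator (fun x => u x ^ 2) x)
      (ENNReal.ofReal ((n : ℝ) / (n - 2))) := by
    have hp0 : 0 < (n : ℝ) / (n - 2) := hpq.pos
    refine (integrable_norm_rpow_iff ?_ (by simpa using hp0) (by simp)).1 ?_
    · exact ((hu.pow 2).aestronglyMeasurable).indicator hS
    · rw [ENNReal.toReal_ofReal hp0.le]
      refine (hInt.indicator hS).congr (Eventually.of_forall fun x => ?_)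
      by_cases hx : x ∈ {x : Euc n | R ≤ ‖x‖}
      · simp only [indicator_of_mem hx, ← hpow, norm_of_nonneg (sq_nonneg _)]
      · simp only [indicator_of_notMem hx, norm_zero, zero_rpow hp0.ne']
  have m2 : MemLp (fun x => gradSq ζ x) (ENNReal.ofReal ((n : ℝ) / 2)) :=
    hζ.continuous_gradSq.memLp_of_hasCompactSupport (HasCompactSupport.intro hζc hz)
  have key := integral_mul_le_Lp_mul_Lq_of_nonneg hpq
    (Eventually.of_forall fun x => indicator_nonneg (fun x _ => sq_nonneg (u x)) x)
    (Eventually.of_forall fun x => gradSq_nonneg ζ x) m1 m2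
  have e1 : ∀ x, {x | R ≤ ‖x‖}.indicator (fun x => u x ^ 2) x * gradSq ζ x =
      u x ^ 2 * gradSq ζ x := fun x => by
    by_cases hx : x ∈ {x : Euc n | R ≤ ‖x‖}
    · rw [indicator_of_mem hx]
    · rw [hR x (not_le.1 hx)]; simp
  have e2 : ∀ x, ({x | R ≤ ‖x‖}.indicator (fun x => u x ^ 2) x) ^ ((n : ℝ) / (n - 2)) =
      {x | R ≤ ‖x‖}.indicator (fun x => u x ^ twoStar n) x := fun x => by
    by_cases hx : x ∈ {x : Euc n | R ≤ ‖x‖}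
    · simp only [indicator_of_mem hx, hpow]
    · simp only [indicator_of_notMem hx, zero_rpow hpq.pos.ne']
  simp only [e1, e2] at key
  rw [integral_indicator hS, one_div_div, one_div_div] at key
  refine key.trans (mul_le_mul_of_nonneg_left (rpow_le_rpow ?_ hC (by positivity)) ?_)
  · exact integral_nonneg fun x => rpow_nonneg (gradSq_nonneg _ _) _
  · exact rpow_nonneg (integral_nonneg fun x => rpow_nonneg (hpos x).le _) _

lemma tendsto_setIntegral_norm_ge {n : ℕ} {f : Euc n → ℝ} (hf : Integrable f) :
    Tendsto (fun k : ℕ => ∫ x in {x | (k : ℝ) ≤ ‖x‖}, f x) atTop (𝓝 0) := by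
  have hS : ∀ k : ℕ, MeasurableSet {x : Euc n | (k : ℝ) ≤ ‖x‖} := fun k =>
    measurableSet_le measurable_const measurable_norm
  have h := tendsto_integral_of_dominated_convergence (μ := (volume : Measure (Euc n)))
    (F := fun (k : ℕ) x => {x : Euc n | (k : ℝ) ≤ ‖x‖}.indicator f x) (f := fun _ => 0)
    (fun x => ‖f x‖) (fun k => hf.aestronglyMeasurable.indicator (hS k)) hf.norm
    (fun k => Eventually.of_forall fun x => norm_indicator_le_norm_self _ _)
    (Eventually.of_forall fun x => ?_)
  · simpa only [integral_zero, integral_indicator (hS _)] using h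
  · refine tendsto_const_nhds.congr' ?_
    obtain ⟨N, hN⟩ := exists_nat_gt ‖x‖
    filter_upwards [eventually_ge_atTop N] with k hk
    have : (N : ℝ) ≤ k := by exact_mod_cast hk
    exact (indicator_of_notMem (by simp only [mem_ofPred_eq, not_le]; linarith) f).symm

lemma tendsto_integral_cutoff {n : ℕ} {f : Euc n → ℝ} (hf : Integrable f) {ζ : ℕ → Euc n → ℝ}
    (hζ : ∀ k, Continuous (ζ k)) (h01 : ∀ k x, 0 ≤ ζ k x ∧ ζ k x ≤ 1)
    (hone : ∀ k : ℕ, ∀ x, ‖x‖ ≤ k → ζ k x = 1) :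
    Tendsto (fun k => ∫ x, ζ k x ^ 2 * f x) atTop (𝓝 (∫ x, f x)) := by
  refine tendsto_integral_of_dominated_convergence (fun x => ‖f x‖)
    (fun k => ((hζ k).pow 2).aestronglyMeasurable.mul hf.aestronglyMeasurable) hf.norm
    (fun k => Eventually.of_forall fun x => ?_) (Eventually.of_forall fun x => ?_)
  · rw [norm_mul, norm_of_nonneg (sq_nonneg _)]
    exact mul_le_of_le_one_left (norm_nonneg _) (pow_le_one₀ (h01 k x).1 (h01 k x).2)
  · refine tendsto_const_nhds.congr' ?_
    obtain ⟨N, hN⟩ := exists_nat_gt ‖x‖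
    filter_upwards [eventually_ge_atTop N] with k hk
    have : (N : ℝ) ≤ k := by exact_mod_cast hk
    rw [hone k x (by linarith)]
    ring

namespace IsFastDiffusion

variable {n : ℕ} {w : ℝ → Euc n → ℝ} {A B : ℝ}

lemma tendsto_integral_cutoff_error (H : IsFastDiffusion n w A B) (hn : 3 ≤ n)
    (hInt : ∀ r, Integrable fun x => w r x ^ twoStar n)
    (hG : Continuous fun r => ∫ x, w r x ^ twoStar n) {ζ : ℕ → Euc n → ℝ} {C : ℝ}
    (hζ : ∀ k, ContDiff ℝ (⊤ : ℕ∞) (ζ k)) (hζc : ∀ k, HasCompactSupport (ζ k))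
    (hR : ∀ k : ℕ, ∀ x, ‖x‖ < k → gradSq (ζ k) x = 0)
    (hC : ∀ k, ∫ x, gradSq (ζ k) x ^ ((n : ℝ) / 2) ≤ C) (a b : ℝ) :
    Tendsto (fun k => ∫ r in a..b, ∫ x, w r x ^ 2 * gradSq (ζ k) x) atTop (𝓝 0) := by
  have h3 := three_le_cast hn
  have he : 0 < ((n : ℝ) - 2) / n := div_pos (by linarith) (by linarith)
  have hw : ∀ r, Continuous (w r) := fun r => (H.smooth r).continuous
  have hC0 : 0 ≤ C := (integral_nonneg fun x => rpow_nonneg (gradSq_nonneg _ _) _).trans (hC 0)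
  have hle := fun k r => integral_sq_mul_gradSq_le hn (hw r) (H.pos r) (hInt r) (hζ k) (hζc k)
    (hC k) (hR k)
  have hnn : ∀ k r, 0 ≤ ∫ x, w r x ^ 2 * gradSq (ζ k) x := fun k r =>
    integral_nonneg fun x => mul_nonneg (sq_nonneg _) (gradSq_nonneg _ _)
  have hbd : ∀ k r, ∫ x, w r x ^ 2 * gradSq (ζ k) x ≤
      (∫ x, w r x ^ twoStar n) ^ (((n : ℝ) - 2) / n) * C ^ (2 / (n : ℝ)) := fun k r => by
    refine (hle k r).trans (mul_le_mul_of_nonneg_right (rpow_le_rpow ?_ ?_ he.le) (by positivity))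
    · exact integral_nonneg fun x => rpow_nonneg (H.pos r x).le _
    · exact setIntegral_le_integral (hInt r)
        (Eventually.of_forall fun x => rpow_nonneg (H.pos r x).le _)
  rw [← intervalIntegral.integral_zero (a := a) (b := b) (μ := volume) (E := ℝ)]
  refine intervalIntegral.tendsto_integral_filter_of_dominated_convergence
    (fun r => (∫ x, w r x ^ twoStar n) ^ (((n : ℝ) - 2) / n) * C ^ (2 / (n : ℝ))) ?_ ?_ ?_ ?_
  · refine Eventually.of_forall fun k => Continuous.aestronglyMeasurable ?_
    exact continuous_integral_of_compact (F := fun r x => w r x ^ 2 * gradSq (ζ k) x)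
      ((H.cont.pow 2).mul ((hζ k).continuous_gradSq.comp continuous_snd)) (hζc k)
      fun r x hx => by simp [gradSq_eq_zero_of_notMem_tsupport hx]
  · refine Eventually.of_forall fun k => Eventually.of_forall fun r _ => ?_
    rw [norm_of_nonneg (hnn k r)]
    exact hbd k r
  · exact ((hG.rpow_const fun _ => Or.inr he.le).mul_const _).intervalIntegrable _ _
  · refine Eventually.of_forall fun r _ => squeeze_zero (fun k => hnn k r) (fun k => hle k r) ?_
    have h := ((tendsto_setIntegral_norm_ge (hInt r)).rpow_const (Or.inr he.le)).mul_const
      (C ^ (2 / (n : ℝ)))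
    rwa [zero_rpow he.ne', zero_mul] at h

lemma mul_increment_nonneg (H : IsFastDiffusion n w A B) (hn : 3 ≤ n) (r s : ℝ) (x : Euc n) :
    0 ≤ (w r x - w s x) * (w r x ^ pexp n - w s x ^ pexp n) := by
  have hp := (pexp_pos hn).le
  rcases le_total (w s x) (w r x) with h | h
  · exact mul_nonneg (sub_nonneg.2 h)
      (sub_nonneg.2 (rpow_le_rpow (H.pos s x).le h hp))
  · exact mul_nonneg_of_nonpos_of_nonpos (sub_nonpos.2 h)
      (sub_nonpos.2 (rpow_le_rpow (H.pos r x).le h hp))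

/-- For every small window length there are arbitrarily large cutoffs for which the increments
are quadratically small. -/
lemma exists_cutoff_increment_le (H : IsFastDiffusion n w A B) (hn : 3 ≤ n)
    (hInt : ∀ r, Integrable fun x => w r x ^ twoStar n)
    (hG : Continuous fun r => ∫ x, w r x ^ twoStar n) {ζ : ℕ → Euc n → ℝ} {C : ℝ}
    (hζ : ∀ k, ContDiff ℝ (⊤ : ℕ∞) (ζ k)) (hζc : ∀ k, HasCompactSupport (ζ k))
    (h01 : ∀ k x, 0 ≤ ζ k x ∧ ζ k x ≤ 1) (hone : ∀ k : ℕ, ∀ x, ‖x‖ ≤ k → ζ k x = 1)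
    (hR : ∀ k : ℕ, ∀ x, ‖x‖ < k → gradSq (ζ k) x = 0)
    (hC : ∀ k, ∫ x, gradSq (ζ k) x ^ ((n : ℝ) / 2) ≤ C) {a b h L M : ℝ} (ha : A < a)
    (hab : a ≤ b) (hh : 0 < h) (hb : b + h < B)
    (hM : ∀ r ∈ Icc a (a + h), ∫ x, w r x ^ twoStar n ≤ M)
    (hL : (∫ x, w a x ^ twoStar n) - (∫ x, w (a + h) x ^ twoStar n) ≤ L * h) (N : ℕ) :
    ∃ k ≥ N, ∫ τ in a..b, ∫ x, ζ k x ^ 2 * (w (τ + h) x - w τ x) *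
        (w (τ + h) x ^ pexp n - w τ x ^ pexp n) ≤ 2 / qexp n * (L / 2 + M + 3 / 2) * h ^ 2 := by
  have hq := qexp_pos hn
  have hY := (H.tendsto_integral_cutoff_error hn hInt hG hζ hζc hR hC a (b + h)).const_mul
    (2 * qexp n * (h * (1 / 2 + (b - a)) + 1))
  have hΓ := fun r => tendsto_integral_cutoff (hInt r) (fun k => (hζ k).continuous) h01 hone
  have hΓ' := (hΓ a).sub (hΓ (a + h))
  rw [mul_zero] at hY
  obtain ⟨k, ⟨hk1, hk2⟩, hk⟩ := (((hY.eventually_le_const (by positivity : 0 < h ^ 2)).and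
    (hΓ'.eventually_le_const (by nlinarith : _ < L * h + h))).and (eventually_ge_atTop N)).exists
  refine ⟨k, hk, ?_⟩
  have hMk : ∀ r ∈ Icc a (a + h), ∫ x, ζ k x ^ 2 * w r x ^ twoStar n ≤ M := fun r hr => by
    refine (integral_mono_of_nonneg (Eventually.of_forall fun x => ?_) (hInt r)
      (Eventually.of_forall fun x => ?_)).trans (hM r hr)
    · exact mul_nonneg (sq_nonneg _) (rpow_nonneg (H.pos r x).le _)
    · exact mul_le_of_le_one_left (rpow_nonneg (H.pos r x).le _)
        (pow_le_one₀ (h01 k x).1 (h01 k x).2)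
  have hmain := H.integral_increment_le_of_bound hn (hζ k) (hζc k) ha hab hh hb hMk
  have hle : qexp n / 2 * ∫ τ in a..b, ∫ x, ζ k x ^ 2 * (w (τ + h) x - w τ x) *
      (w (τ + h) x ^ pexp n - w τ x ^ pexp n) ≤
      h * (1 / 2 * (L * h + h) + h * M) + h ^ 2 := by
    refine hmain.trans (add_le_add (mul_le_mul_of_nonneg_left ?_ hh.le) hk1)
    linarith
  calc _ = 2 / qexp n * (qexp n / 2 * ∫ τ in a..b, ∫ x, ζ k x ^ 2 * (w (τ + h) x - w τ x) *
        (w (τ + h) x ^ pexp n - w τ x ^ pexp n)) := by field_simp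
    _ ≤ 2 / qexp n * (h * (1 / 2 * (L * h + h) + h * M) + h ^ 2) :=
        mul_le_mul_of_nonneg_left hle (by positivity)
    _ = _ := by ring

lemma tendsto_increment (H : IsFastDiffusion n w A B) (hn : 3 ≤ n) {r : ℝ} (hr : r ∈ Ioo A B)
    (x : Euc n) {h : ℕ → ℝ} (hh : Tendsto h atTop (𝓝[≠] 0)) :
    Tendsto (fun j => (w (r + h j) x - w r x) * (w (r + h j) x ^ pexp n - w r x ^ pexp n) /
      h j ^ 2) atTop (𝓝 (lap (w r) x ^ 2 * w r x ^ (1 - pexp n) / pexp n)) := by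
  have h1 := (hasDerivAt_iff_tendsto_slope_zero.1 (H.hasDerivAt_self hn hr x)).comp hh
  have h2 := (hasDerivAt_iff_tendsto_slope_zero.1 (H.hasDerivAt r hr x)).comp hh
  convert h1.mul h2 using 2
  · simp only [comp_apply, smul_eq_mul]
    ring
  · ring

/-- The dissipation of the flow is integrable in space and time. -/
theorem lintegral_dissipation_lt_top (H : IsFastDiffusion n w A B) (hn : 3 ≤ n)
    (hInt : ∀ r, Integrable fun x => w r x ^ twoStar n)
    (hG : Continuous fun r => ∫ x, w r x ^ twoStar n) {a b G' : ℝ} (ha : A < a)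
    (hab : a ≤ b) (hb : b < B)
    (hG' : HasDerivAt (fun r => ∫ x, w r x ^ twoStar n) G' a) :
    ∫⁻ r in Ioc a b, ∫⁻ x, ENNReal.ofReal (lap (w r) x ^ 2 * w r x ^ (1 - pexp n)) < ⊤ := by
  have hp := pexp_pos hn
  have hq := qexp_pos hn
  obtain ⟨ζ, C, hcut⟩ := exists_cutoff n
  have hζ := fun k => (hcut k).1
  have hζc := fun k => (hcut k).2.1
  have h01 := fun k => (hcut k).2.2.1
  have hone := fun k => (hcut k).2.2.2.1
  set L := -G' + 1 with hLdef
  set h : ℕ → ℝ := fun j => ((j : ℝ) + 1)⁻¹ with hh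
  have h0 : ∀ j, 0 < h j := fun j => by simp only [hh]; positivity
  have hlim0 : Tendsto h atTop (𝓝 0) := by
    simpa only [hh, one_div] using tendsto_one_div_add_atTop_nhds_zero_nat (𝕜 := ℝ)
  have hlim : Tendsto h atTop (𝓝[≠] 0) :=
    tendsto_nhdsWithin_iff.2 ⟨hlim0, Eventually.of_forall fun j => (h0 j).ne'⟩
  obtain ⟨M, hM⟩ := (isCompact_Icc (a := a) (b := B)).bddAbove_image hG.continuousOn
  have hev : ∀ᶠ j in atTop, b + h j < B ∧
      (∫ x, w a x ^ twoStar n) - (∫ x, w (a + h j) x ^ twoStar n) ≤ L * h j := by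
    have e1 : ∀ᶠ j in atTop, h j < B - b := hlim0.eventually_lt_const (by linarith)
    have e2 := ((hasDerivAt_iff_tendsto_slope_zero.1 hG').comp hlim).eventually_const_le
      (by linarith : G' - 1 < G')
    filter_upwards [e1, e2] with j hj1 hj2
    refine ⟨by linarith, ?_⟩
    simp only [comp_apply, smul_eq_mul, le_inv_mul_iff₀ (h0 j)] at hj2
    linarith
  obtain ⟨N, hN⟩ := eventually_atTop.1 hev
  have hex : ∀ j, ∃ k ≥ j, j ≥ N → ∫ τ in a..b, ∫ x, ζ k x ^ 2 * (w (τ + h j) x - w τ x) *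
      (w (τ + h j) x ^ pexp n - w τ x ^ pexp n) ≤
        2 / qexp n * (L / 2 + M + 3 / 2) * h j ^ 2 := by
    intro j
    by_cases hj : j ≥ N
    · obtain ⟨hj1, hj2⟩ := hN j hj
      obtain ⟨k, hk, hk'⟩ := H.exists_cutoff_increment_le hn hInt hG hζ hζc h01 hone
        (fun k => (hcut k).2.2.2.2.1) (fun k => (hcut k).2.2.2.2.2) ha hab (h0 j) hj1
        (fun r hr => hM (mem_image_of_mem _ ⟨hr.1, by linarith [hr.2]⟩)) hj2 j
      exact ⟨k, hk, fun _ => hk'⟩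
    · exact ⟨j, le_rfl, fun h => absurd h hj⟩
  choose k hk hkle using hex
  set F : ℕ → ℝ → Euc n → ℝ := fun j r x => ζ (k j) x ^ 2 * (w (r + h j) x - w r x) *
    (w (r + h j) x ^ pexp n - w r x ^ pexp n) with hF
  have F0 : ∀ j r x, 0 ≤ F j r x := fun j r x => by
    simp only [hF, mul_assoc]
    exact mul_nonneg (sq_nonneg _) (H.mul_increment_nonneg hn _ _ x)
  have Fc : ∀ j, Continuous (uncurry (F j)) := fun j => by
    have hshift : Continuous fun q : ℝ × Euc n => (q.1 + h j, q.2) := by fun_prop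
    exact ((((hζ _).continuous.comp continuous_snd).pow 2).mul
      ((H.cont.comp hshift).sub H.cont)).mul
      (((H.cont_rpow _).comp hshift).sub (H.cont_rpow _))
  have Fint : ∀ j, Integrable (uncurry (F j)) ((volume.restrict (Ioc a b)).prod volume) :=
    fun j => integrable_prod_of_compact (Fc j) (hζc (k j))
      (fun r x hx => by simp [hF, image_eq_zero_of_notMem_tsupport hx])
      Ioc_subset_Icc_self measurableSet_Ioc
  have hbound : ∀ j ≥ N, ∫⁻ z, ENNReal.ofReal (uncurry (F j) z / h j ^ 2)
      ∂((volume.restrict (Ioc a b)).prod volume) ≤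
        ENNReal.ofReal (2 / qexp n * (L / 2 + M + 3 / 2)) := by
    intro j hj
    rw [← ofReal_integral_eq_lintegral_ofReal ((Fint j).div_const _)
      (Eventually.of_forall fun z => div_nonneg (F0 j z.1 z.2) (sq_nonneg _)),
      integral_div, integral_prod _ (Fint j)]
    refine ENNReal.ofReal_le_ofReal ?_
    rw [div_le_iff₀ (pow_pos (h0 j) 2), ← intervalIntegral.integral_of_le hab]
    exact hkle j hj
  have hD : Measurable fun z : ℝ × Euc n =>
      ENNReal.ofReal (lap (w z.1) z.2 ^ 2 * w z.1 z.2 ^ (1 - pexp n)) :=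
    ((H.cont_lap.pow 2).mul (H.cont_rpow _)).measurable.ennreal_ofReal
  have hlimF : ∀ᵐ z ∂((volume.restrict (Ioc a b)).prod (volume : Measure (Euc n))),
      Tendsto (fun j => ENNReal.ofReal (uncurry (F j) z / h j ^ 2)) atTop
        (𝓝 (ENNReal.ofReal (lap (w z.1) z.2 ^ 2 * w z.1 z.2 ^ (1 - pexp n) / pexp n))) := by
    have hmem : ∀ᵐ z ∂((volume.restrict (Ioc a b)).prod (volume : Measure (Euc n))),
        z.1 ∈ Ioc a b :=
      Measure.quasiMeasurePreserving_fst.ae (ae_restrict_mem measurableSet_Ioc)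
    filter_upwards [hmem] with z hz
    refine ENNReal.tendsto_ofReal ?_
    refine (H.tendsto_increment hn ⟨ha.trans hz.1, hz.2.trans_lt hb⟩ z.2 hlim).congr' ?_
    obtain ⟨N', hN'⟩ := exists_nat_gt ‖z.2‖
    filter_upwards [eventually_ge_atTop N'] with j hj
    have h1 : (N' : ℝ) ≤ k j := by exact_mod_cast hj.trans (hk j)
    simp only [hF, uncurry, hone (k j) z.2 (by linarith), one_pow, one_mul]
  have hfatou : ∫⁻ z, ENNReal.ofReal (lap (w z.1) z.2 ^ 2 * w z.1 z.2 ^ (1 - pexp n) / pexp n)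
      ∂((volume.restrict (Ioc a b)).prod volume) ≤
        ENNReal.ofReal (2 / qexp n * (L / 2 + M + 3 / 2)) := by
    rw [lintegral_congr_ae (hlimF.mono fun z hz => hz.liminf_eq.symm)]
    refine (lintegral_liminf_le fun j =>
      ((Fc j).measurable.div_const _).ennreal_ofReal).trans ?_
    refine liminf_le_of_frequently_le' (Eventually.frequently ?_)
    filter_upwards [eventually_ge_atTop N] with j hj using hbound j hj
  rw [← lintegral_prod _ hD.aemeasurable]
  have hsplit : ∀ z : ℝ × Euc n,
      ENNReal.ofReal (lap (w z.1) z.2 ^ 2 * w z.1 z.2 ^ (1 - pexp n)) = ENNReal.ofReal (pexp n) *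
        ENNReal.ofReal (lap (w z.1) z.2 ^ 2 * w z.1 z.2 ^ (1 - pexp n) / pexp n) := fun z => by
    rw [← ENNReal.ofReal_mul hp.le, mul_div_cancel₀ _ hp.ne']
  simp only [hsplit]
  rw [lintegral_const_mul' _ _ ENNReal.ofReal_ne_top]
  exact ENNReal.mul_lt_top ENNReal.ofReal_lt_top (hfatou.trans_lt ENNReal.ofReal_lt_top)

end IsFastDiffusion

lemma contDiffOn_pderiv {n : ℕ} {w : ℝ → Euc n → ℝ}
    (hw : ContDiffOn ℝ (⊤ : ℕ∞) (fun q : ℝ × Euc n => w q.1 q.2) (Ioi 0 ×ˢ univ)) (i : Fin n) :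
    ContDiffOn ℝ (⊤ : ℕ∞) (fun q : ℝ × Euc n => pderiv i (w q.1) q.2) (Ioi 0 ×ˢ univ) := by
  have hopen : IsOpen (Ioi (0 : ℝ) ×ˢ (univ : Set (Euc n))) := isOpen_Ioi.prod isOpen_univ
  have h1 := (hw.fderiv_of_isOpen hopen (m := (⊤ : ℕ∞)) (by simp)).clm_apply
    (contDiffOn_const (c := ((0 : ℝ), (EuclideanSpace.single i 1 : Euc n))))
  refine h1.congr fun q hq => ?_
  have hd : HasFDerivAt (fun q : ℝ × Euc n => w q.1 q.2) _ (q.1, q.2) :=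
    ((hw.differentiableOn (by simp)).differentiableAt (hopen.mem_nhds hq)).hasFDerivAt
  have h2 := hd.comp q.2 (hasFDerivAt_prodMk_right q.1 q.2)
  have h3 : fderiv ℝ (w q.1) q.2 = _ := h2.fderiv
  rw [pderiv, h3]
  simp

lemma contDiff_slice {n : ℕ} {w : ℝ → Euc n → ℝ}
    (hw : ContDiffOn ℝ (⊤ : ℕ∞) (fun q : ℝ × Euc n => w q.1 q.2) (Ioi 0 ×ˢ univ)) {r : ℝ}
    (hr : 0 < r) : ContDiff ℝ (⊤ : ℕ∞) (w r) := by
  rw [← contDiffOn_univ]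
  exact hw.comp (contDiff_prodMk_right r).contDiffOn fun x _ => ⟨hr, mem_univ x⟩

lemma continuousOn_lap {n : ℕ} {w : ℝ → Euc n → ℝ}
    (hw : ContDiffOn ℝ (⊤ : ℕ∞) (fun q : ℝ × Euc n => w q.1 q.2) (Ioi 0 ×ˢ univ)) :
    ContinuousOn (fun q : ℝ × Euc n => lap (w q.1) q.2) (Ioi 0 ×ˢ univ) :=
  continuousOn_finsetSum _ fun i _ => (contDiffOn_pderiv (w := fun r x => pderiv i (w r) x)
    (contDiffOn_pderiv hw i) i).continuousOn

lemma pderiv_const_mul {n : ℕ} (c : ℝ) (u : Euc n → ℝ) (i : Fin n) (x : Euc n) :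
    pderiv i (fun y => c * u y) x = c * pderiv i u x := by
  have h : fderiv ℝ (fun y => c * u y) x = c • fderiv ℝ u x :=
    congrFun (fderiv_const_smul_field c) x
  rw [pderiv, h]
  rfl

lemma lap_const_mul {n : ℕ} (c : ℝ) (u : Euc n → ℝ) (x : Euc n) :
    lap (fun y => c * u y) x = c * lap u x := by
  have h : ∀ i, (fun y => pderiv i (fun z => c * u z) y) = fun y => c * pderiv i u y :=
    fun i => funext fun y => pderiv_const_mul c u i y
  simp only [lap_eq_sum_pderiv, Finset.mul_sum]
  refine Finset.sum_congr rfl fun i _ => ?_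
  rw [← pderiv_const_mul, ← h i]

lemma inv_one_sub_mexp {n : ℕ} (hn : 3 ≤ n) : (1 - mexp n)⁻¹ = ((n : ℝ) + 2) / 4 := by
  have := three_le_cast hn
  have h2 : (n : ℝ) + 2 ≠ 0 := by linarith
  rw [inv_eq_iff_eq_inv, inv_div, mexp]
  field_simp
  ring

/-- Rescaling in time turns `∂ᵣ(w ^ p) = Δw + w ^ p / (1 - m)` into `∂ᵣ(w ^ p) = Δw`. -/
lemma isFastDiffusion_rescale {n : ℕ} (hn : 3 ≤ n) {w : ℝ → Euc n → ℝ}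
    (hpos : ∀ s, 0 < s → ∀ x, 0 < w s x)
    (hsmooth : ContDiffOn ℝ (⊤ : ℕ∞) (fun q : ℝ × Euc n => w q.1 q.2) (Ioi 0 ×ˢ univ))
    (hpde : ∀ s, 0 < s → ∀ x, HasDerivAt (fun r => w r x ^ pexp n)
      (lap (w s) x + w s x ^ pexp n / (1 - mexp n)) s)
    {ρ : ℝ → ℝ} {A B : ℝ} (hρ : Continuous ρ) (hρ0 : ∀ τ, 0 < ρ τ)
    (hρd : ∀ τ ∈ Ioo A B, HasDerivAt ρ (exp (ρ τ)) τ) :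
    IsFastDiffusion n (fun τ x => exp (-(((n : ℝ) - 2) / 4 * ρ τ)) * w (ρ τ) x) A B := by
  have h3 := three_le_cast hn
  have hmap : Continuous fun q : ℝ × Euc n => (ρ q.1, q.2) := by fun_prop
  have hmem : ∀ q : ℝ × Euc n, (ρ q.1, q.2) ∈ Ioi (0 : ℝ) ×ˢ (univ : Set (Euc n)) :=
    fun q => ⟨hρ0 q.1, mem_univ _⟩
  have hexp : Continuous fun q : ℝ × Euc n => exp (-(((n : ℝ) - 2) / 4 * ρ q.1)) := by fun_prop
  refine ⟨fun r => contDiff_const.mul (contDiff_slice hsmooth (hρ0 r)),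
    hexp.mul (hsmooth.continuousOn.comp_continuous hmap hmem), fun i => ?_, ?_,
    fun r x => mul_pos (exp_pos _) (hpos _ (hρ0 r) x), fun r hr x => ?_⟩
  · simp only [pderiv_const_mul]
    exact hexp.mul ((contDiffOn_pderiv hsmooth i).continuousOn.comp_continuous hmap hmem)
  · simp only [lap_const_mul]
    exact hexp.mul ((continuousOn_lap hsmooth).comp_continuous hmap hmem)
  · have hp : ((n : ℝ) - 2) / 4 * pexp n = ((n : ℝ) + 2) / 4 := by
      have : (n : ℝ) - 2 ≠ 0 := by linarith
      rw [pexp]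
      field_simp
    have h1 := (hpde (ρ r) (hρ0 r) x).comp r (hρd r hr)
    have h2 := ((hρd r hr).const_mul (((n : ℝ) + 2) / 4)).neg.exp
    refine ((h2.mul h1).congr_of_eventuallyEq (Eventually.of_forall fun s => ?_)).congr_deriv ?_
    · simp only [Pi.mul_apply, Pi.neg_apply, comp_apply]
      rw [mul_rpow (exp_pos _).le (hpos _ (hρ0 s) x).le, ← Real.exp_mul, ← hp]
      congr 2
      ring
    · rw [lap_const_mul, div_eq_mul_inv (w (ρ r) x ^ pexp n), inv_one_sub_mexp hn]
      have he : exp (-(((n : ℝ) - 2) / 4 * ρ r)) =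
          exp (-(((n : ℝ) + 2) / 4 * ρ r)) * exp (ρ r) := by
        rw [← Real.exp_add]
        congr 1
        ring
      rw [he]
      simp only [Pi.neg_apply, comp_apply]
      ring

/-- The time change `τ ↦ -log (-τ)`, truncated outside `(-β, -α)`. -/
def clampedTime (α β τ : ℝ) : ℝ := -log (max α (min β (-τ)))

section clampedTime

variable {α β : ℝ}

lemma continuous_clampedTime (hα : 0 < α) : Continuous (clampedTime α β) := by
  refine (Continuous.log (by fun_prop) fun τ => ?_).neg
  exact (hα.trans_le (le_max_left _ _)).ne'

lemma clampedTime_pos (hα : 0 < α) (hαβ : α < β) (hβ : β < 1) (τ : ℝ) :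
    0 < clampedTime α β τ := by
  refine neg_pos.2 (log_neg (hα.trans_le (le_max_left _ _)) (max_lt (hαβ.trans hβ) ?_))
  exact (min_le_left _ _).trans_lt hβ

lemma clampedTime_of_mem {τ : ℝ} (hτ : τ ∈ Ioo (-β) (-α)) : clampedTime α β τ = -log (-τ) := by
  rw [clampedTime, min_eq_right (by linarith [hτ.1]), max_eq_right (by linarith [hτ.2])]

lemma hasDerivAt_clampedTime (hα : 0 < α) {τ : ℝ} (hτ : τ ∈ Ioo (-β) (-α)) :
    HasDerivAt (clampedTime α β) (exp (clampedTime α β τ)) τ := by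
  have hτ0 : 0 < -τ := by linarith [hτ.2]
  have h := ((hasDerivAt_neg τ).log hτ0.ne').neg
  refine (h.congr_of_eventuallyEq ?_).congr_deriv ?_
  · filter_upwards [isOpen_Ioo.mem_nhds hτ] with σ hσ using clampedTime_of_mem hσ
  · rw [clampedTime_of_mem hτ, Real.exp_neg, Real.exp_log hτ0, neg_div, neg_neg, one_div]

end clampedTime

/-- The dissipation `∫∫ (Δw)² w ^ (1 - p)` is finite on compact time intervals. -/
lemma lintegral_dissipation_lt_top {n : ℕ} (hn : 3 ≤ n) {w : ℝ → Euc n → ℝ}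
    (hpos : ∀ s, 0 < s → ∀ x, 0 < w s x)
    (hsmooth : ContDiffOn ℝ (⊤ : ℕ∞) (fun q : ℝ × Euc n => w q.1 q.2) (Ioi 0 ×ˢ univ))
    (hpde : ∀ s, 0 < s → ∀ x, HasDerivAt (fun r => w r x ^ pexp n)
      (lap (w s) x + w s x ^ pexp n / (1 - mexp n)) s)
    (hL2star : ∀ r, 0 < r → Integrable fun x => w r x ^ twoStar n)
    (hdiff : ∀ s, 0 < s → DifferentiableAt ℝ (fun r => ∫ x, w r x ^ twoStar n) s)
    {t s : ℝ} (ht : 0 < t) (hts : t < s) :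
    ∫⁻ r in Ioc t s, ∫⁻ x, ENNReal.ofReal (lap (w r) x ^ 2 * w r x ^ (1 - pexp n)) < ⊤ := by
  set α := exp (-(s + 1)) with hα
  set β := exp (-(t / 2)) with hβ
  set κ := ((n : ℝ) - 2) / 4 with hκ
  have hα0 : 0 < α := exp_pos _
  have hαβ : α < β := exp_lt_exp.2 (by linarith)
  have hβ1 : β < 1 := exp_lt_one_iff.2 (by linarith)
  set ρ := clampedTime α β with hρdef
  have hρ0 : ∀ τ, 0 < ρ τ := clampedTime_pos hα0 hαβ hβ1
  have hρc : Continuous ρ := continuous_clampedTime hα0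
  have H := isFastDiffusion_rescale hn hpos hsmooth hpde hρc hρ0
    fun τ hτ => hasDerivAt_clampedTime hα0 hτ
  have hmul : ∀ τ x (c : ℝ), (exp (-(κ * ρ τ)) * w (ρ τ) x) ^ c =
      exp (-(κ * ρ τ)) ^ c * w (ρ τ) x ^ c := fun τ x c =>
    mul_rpow (exp_pos _).le (hpos _ (hρ0 τ) x).le
  have hGeq : (fun τ => ∫ x, (exp (-(κ * ρ τ)) * w (ρ τ) x) ^ twoStar n) =
      fun τ => exp (-(κ * ρ τ)) ^ twoStar n * ∫ x, w (ρ τ) x ^ twoStar n := by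
    ext τ
    simp only [hmul, integral_const_mul]
  have hφmem : ∀ r, t / 2 < r → r < s + 1 → -exp (-r) ∈ Ioo (-β) (-α) := fun r h1 h2 =>
    ⟨neg_lt_neg (exp_lt_exp.2 (by linarith)), neg_lt_neg (exp_lt_exp.2 (by linarith))⟩
  have hρφ : ∀ r, t / 2 < r → r < s + 1 → ρ (-exp (-r)) = r := fun r h1 h2 => by
    rw [hρdef, clampedTime_of_mem (hφmem r h1 h2), neg_neg, Real.log_exp, neg_neg]
  have ha := hφmem t (by linarith) (by linarith)
  have hb := hφmem s (by linarith) (by linarith)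
  have hab : -exp (-t) ≤ -exp (-s) := neg_le_neg (exp_le_exp.2 (by linarith))
  have hρd := hasDerivAt_clampedTime hα0 ha
  have hE : ∀ τ, 0 < exp (-(κ * ρ τ)) := fun τ => exp_pos _
  have hfin := H.lintegral_dissipation_lt_top hn
    (fun τ => ((hL2star _ (hρ0 τ)).const_mul _).congr
      (Eventually.of_forall fun x => (hmul τ x _).symm))
    (by
      rw [hGeq]
      refine Continuous.mul (Continuous.rpow_const (by fun_prop) fun τ => Or.inl (hE τ).ne') ?_
      exact continuous_iff_continuousAt.2 fun τ =>
        ContinuousAt.comp (f := ρ) (hdiff _ (hρ0 τ)).continuousAt hρc.continuousAt)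
    ha.1 hab hb.2
    (DifferentiableAt.hasDerivAt (by
      rw [hGeq]
      refine DifferentiableAt.mul ?_
        (DifferentiableAt.comp (f := ρ) _ (hdiff _ (hρ0 _)) hρd.differentiableAt)
      exact ((hρd.differentiableAt.const_mul κ).fun_neg.exp).rpow_const (Or.inl (hE _).ne')))
  set X : ℝ → ENNReal := fun r =>
    ∫⁻ x, ENNReal.ofReal (lap (w r) x ^ 2 * w r x ^ (1 - pexp n)) with hX
  set e : ℝ → ℝ := fun r => exp (-(κ * r)) with he
  have hg : ∀ τ, ∫⁻ x, ENNReal.ofReal (lap (fun x => e (ρ τ) * w (ρ τ) x) x ^ 2 *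
      (e (ρ τ) * w (ρ τ) x) ^ (1 - pexp n)) =
      ENNReal.ofReal (e (ρ τ) ^ 2 * e (ρ τ) ^ (1 - pexp n)) * X (ρ τ) := by
    intro τ
    rw [hX, ← lintegral_const_mul' _ _ ENNReal.ofReal_ne_top]
    refine lintegral_congr fun x => ?_
    rw [← ENNReal.ofReal_mul (by positivity), lap_const_mul, hmul]
    congr 1
    ring
  have hφd : ∀ r ∈ Ioc t s, HasDerivWithinAt (fun r => -exp (-r)) (exp (-r)) (Ioc t s) r :=
    fun r _ => by
      have h := (hasDerivAt_neg r).exp.fun_neg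
      simp only [mul_neg, mul_one, neg_neg] at h
      exact h.hasDerivWithinAt
  have hinj : InjOn (fun r => -exp (-r)) (Ioc t s) := fun r _ r' _ h => by
    simpa using h
  have hcv := lintegral_image_eq_lintegral_abs_deriv_mul measurableSet_Ioc hφd hinj
    fun τ => ∫⁻ x, ENNReal.ofReal (lap (fun x => e (ρ τ) * w (ρ τ) x) x ^ 2 *
      (e (ρ τ) * w (ρ τ) x) ^ (1 - pexp n))
  have himg : (fun r => -exp (-r)) '' Ioc t s ⊆ Ioc (-exp (-t)) (-exp (-s)) := by
    rintro _ ⟨r, hr, rfl⟩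
    exact ⟨neg_lt_neg (exp_lt_exp.2 (neg_lt_neg hr.1)),
      neg_le_neg (exp_le_exp.2 (neg_le_neg hr.2))⟩
  have hlt := (hcv.symm.trans_le (lintegral_mono_set himg)).trans_lt hfin
  set ν := 1 + κ * (3 - pexp n) with hν
  have hle : ∫⁻ r in Ioc t s, X r ≤ ENNReal.ofReal (exp (|ν| * s)) *
      ∫⁻ r in Ioc t s, ENNReal.ofReal |exp (-r)| *
        ∫⁻ x, ENNReal.ofReal (lap (fun x => e (ρ (-exp (-r))) * w (ρ (-exp (-r))) x) x ^ 2 *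
          (e (ρ (-exp (-r))) * w (ρ (-exp (-r))) x) ^ (1 - pexp n)) := by
    rw [← lintegral_const_mul' _ _ ENNReal.ofReal_ne_top]
    refine setLIntegral_mono' measurableSet_Ioc fun r hr => ?_
    rw [hg, hρφ r (by linarith [hr.1]) (by linarith [hr.2]), ← mul_assoc, ← mul_assoc,
      ← ENNReal.ofReal_mul (exp_pos _).le, ← ENNReal.ofReal_mul (by positivity)]
    refine le_mul_of_one_le_left zero_le ?_
    rw [← ENNReal.ofReal_one]
    refine ENNReal.ofReal_le_ofReal ?_
    rw [abs_of_pos (exp_pos _), he]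
    simp only
    rw [← Real.exp_mul, ← Real.exp_nat_mul, ← Real.exp_add, ← Real.exp_add, ← Real.exp_add]
    refine one_le_exp ?_
    have h1 : ν * r ≤ |ν| * s := by
      have := hr.2
      have := ht.trans hr.1
      calc ν * r ≤ |ν| * r := by gcongr; exact le_abs_self ν
        _ ≤ |ν| * s := by gcongr
    rw [hν] at h1
    push_cast
    linarith
  exact hle.trans_lt (ENNReal.mul_lt_top ENNReal.ofReal_lt_top hlt)

/-- The right-hand side `Δw + w ^ p / (1 - m)` of the flow equation. -/
def flowRhs (n : ℕ) (w : ℝ → Euc n → ℝ) (r : ℝ) (x : Euc n) : ℝ :=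
  lap (w r) x + w r x ^ pexp n / (1 - mexp n)

lemma abs_sub_rpow_le {P a b : ℝ} (hP : 1 ≤ P) (ha : 0 ≤ a) (hb : 0 ≤ b) :
    |a - b| ^ P ≤ |a ^ P - b ^ P| := by
  wlog hab : b ≤ a generalizing a b
  · rw [abs_sub_comm a b, abs_sub_comm (a ^ P)]
    exact this hb ha (le_of_not_ge hab)
  rw [abs_of_nonneg (sub_nonneg.2 hab),
    abs_of_nonneg (sub_nonneg.2 (rpow_le_rpow hb hab (by linarith)))]
  have h := Real.add_rpow_le_rpow_add (sub_nonneg.2 hab) hb hP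
  rw [sub_add_cancel] at h
  linarith

lemma holderConjugate_qexp_twoStar {n : ℕ} (hn : 3 ≤ n) : (qexp n).HolderConjugate (twoStar n) := by
  have h3 := three_le_cast hn
  have h1 : (n : ℝ) - 2 ≠ 0 := by linarith
  rw [Real.holderConjugate_iff]
  refine ⟨one_lt_qexp hn, ?_⟩
  unfold qexp twoStar
  field_simp
  ring

/-- Young's inequality with the weight `w ^ (1 - p)`. -/
lemma abs_add_rpow_qexp_le {n : ℕ} (hn : 3 ≤ n) {a c u : ℝ} (hu : 0 < u) :
    |a + u ^ pexp n * c| ^ qexp n ≤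
      2 * (a ^ 2 * u ^ (1 - pexp n)) + (2 * c ^ 2 + 1) * u ^ twoStar n := by
  have h3 := three_le_cast hn
  have h1 : (n : ℝ) - 2 ≠ 0 := by linarith
  have h2 : (n : ℝ) + 2 ≠ 0 := by linarith
  have hq := qexp_pos hn
  have hq2 : qexp n ≤ 2 := by
    rw [qexp, div_le_iff₀ (by linarith)]
    linarith
  set f := a + u ^ pexp n * c with hf
  have hu1 : 0 < u ^ (1 - pexp n) := rpow_pos_of_pos hu _
  have hu2 : 0 < u ^ twoStar n := rpow_pos_of_pos hu _
  have hgm := Real.geom_mean_le_arith_mean2_weighted (w₁ := qexp n / 2) (w₂ := 1 - qexp n / 2)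
    (p₁ := f ^ 2 * u ^ (1 - pexp n)) (p₂ := u ^ twoStar n) (by positivity) (by linarith)
    (by positivity) hu2.le (by ring)
  have hexp : (1 - pexp n) * (qexp n / 2) + twoStar n * (1 - qexp n / 2) = 0 := by
    unfold pexp qexp twoStar
    field_simp
    ring
  have hpow : (f ^ 2 * u ^ (1 - pexp n)) ^ (qexp n / 2) * (u ^ twoStar n) ^ (1 - qexp n / 2) =
      |f| ^ qexp n := by
    rw [mul_rpow (sq_nonneg _) hu1.le, mul_assoc, ← rpow_mul hu.le, ← rpow_mul hu.le,
      ← rpow_add hu, hexp, rpow_zero, mul_one, ← sq_abs, ← rpow_natCast,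
      ← rpow_mul (abs_nonneg _)]
    congr 1
    push_cast
    ring
  have hsq : f ^ 2 * u ^ (1 - pexp n) ≤
      2 * (a ^ 2 * u ^ (1 - pexp n)) + 2 * c ^ 2 * u ^ twoStar n := by
    have e : u ^ twoStar n = (u ^ pexp n) ^ 2 * u ^ (1 - pexp n) := by
      rw [← rpow_natCast, ← rpow_mul hu.le, ← rpow_add hu]
      congr 1
      unfold twoStar pexp
      push_cast
      field_simp
      ring
    rw [e, hf]
    nlinarith [mul_nonneg (sq_nonneg (a - u ^ pexp n * c)) hu1.le]
  rw [hpow] at hgm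
  have hA : 0 ≤ f ^ 2 * u ^ (1 - pexp n) := by positivity
  nlinarith

section Flow

variable {n : ℕ} {w : ℝ → Euc n → ℝ}

lemma continuousOn_rpow_flow (hpos : ∀ s, 0 < s → ∀ x, 0 < w s x)
    (hsmooth : ContDiffOn ℝ (⊤ : ℕ∞) (fun q : ℝ × Euc n => w q.1 q.2) (Ioi 0 ×ˢ univ)) (c : ℝ) :
    ContinuousOn (fun q : ℝ × Euc n => w q.1 q.2 ^ c) (Ioi 0 ×ˢ univ) :=
  hsmooth.continuousOn.rpow_const fun q hq => Or.inl (hpos q.1 hq.1 q.2).ne'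

lemma continuousOn_flowRhs (hpos : ∀ s, 0 < s → ∀ x, 0 < w s x)
    (hsmooth : ContDiffOn ℝ (⊤ : ℕ∞) (fun q : ℝ × Euc n => w q.1 q.2) (Ioi 0 ×ˢ univ)) :
    ContinuousOn (fun q : ℝ × Euc n => flowRhs n w q.1 q.2) (Ioi 0 ×ˢ univ) :=
  (continuousOn_lap hsmooth).add ((continuousOn_rpow_flow hpos hsmooth _).div_const _)

lemma hasDerivAt_rpow_twoStar_flow (hn : 3 ≤ n) (hpos : ∀ s, 0 < s → ∀ x, 0 < w s x)
    (hpde : ∀ s, 0 < s → ∀ x, HasDerivAt (fun r => w r x ^ pexp n) (flowRhs n w s x) s)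
    {r : ℝ} (hr : 0 < r) (x : Euc n) :
    HasDerivAt (fun r => w r x ^ twoStar n) (qexp n * (flowRhs n w r x * w r x)) r := by
  have h := (hpde r hr x).rpow_const (p := qexp n)
    (Or.inl (rpow_pos_of_pos (hpos r hr x) _).ne')
  refine (h.congr_of_eventuallyEq ?_).congr_deriv ?_
  · filter_upwards [isOpen_Ioi.mem_nhds hr] with s hs
    rw [← rpow_mul (hpos s hs x).le, pexp_mul_qexp hn]
  · rw [← rpow_mul (hpos r hr x).le, pexp_mul_qexp_sub_one hn, rpow_one]
    ring

/-- A function continuous on positive times is measurable on compact time intervals. -/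
lemma aestronglyMeasurable_prod_of_continuousOn {F : ℝ × Euc n → ℝ}
    (hF : ContinuousOn F (Ioi 0 ×ˢ univ)) {t s : ℝ} (ht : 0 < t) :
    AEStronglyMeasurable F ((volume.restrict (Ioc t s)).prod (volume : Measure (Euc n))) := by
  have h : AEStronglyMeasurable F
      ((volume.prod (volume : Measure (Euc n))).restrict (Ioc t s ×ˢ univ)) :=
    (hF.mono (prod_mono_left fun r hr => ht.trans hr.1)).aestronglyMeasurable
      (measurableSet_Ioc.prod MeasurableSet.univ)
  rwa [← Measure.prod_restrict, Measure.restrict_univ] at h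

lemma integrableOn_integral_flowRhs (hn : 3 ≤ n) (hpos : ∀ s, 0 < s → ∀ x, 0 < w s x)
    (hsmooth : ContDiffOn ℝ (⊤ : ℕ∞) (fun q : ℝ × Euc n => w q.1 q.2) (Ioi 0 ×ˢ univ))
    (hpde : ∀ s, 0 < s → ∀ x, HasDerivAt (fun r => w r x ^ pexp n) (flowRhs n w s x) s)
    (hL2star : ∀ r, 0 < r → Integrable fun x => w r x ^ twoStar n)
    (hLq : ∀ r, 0 < r → Integrable fun x => |flowRhs n w r x| ^ qexp n)
    (hdiff : ∀ s, 0 < s → DifferentiableAt ℝ (fun r => ∫ x, w r x ^ twoStar n) s)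
    {t s : ℝ} (ht : 0 < t) (hts : t < s) :
    IntegrableOn (fun r => ∫ x, |flowRhs n w r x| ^ qexp n) (Ioc t s) := by
  have hq := qexp_pos hn
  set c := (1 - mexp n)⁻¹ with hc
  have hGc : ContinuousOn (fun r => ∫ x, w r x ^ twoStar n) (Icc t s) := fun r hr =>
    (hdiff r (ht.trans_le hr.1)).continuousAt.continuousWithinAt
  have hX := lintegral_dissipation_lt_top hn hpos hsmooth hpde hL2star hdiff ht hts
  have hGi : IntegrableOn (fun r => (2 * c ^ 2 + 1) * ∫ x, w r x ^ twoStar n) (Ioc t s) :=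
    ((hGc.integrableOn_Icc).mono_set Ioc_subset_Icc_self).const_mul _
  have hmeas : AEStronglyMeasurable (fun r => ∫ x, |flowRhs n w r x| ^ qexp n)
      (volume.restrict (Ioc t s)) :=
    (aestronglyMeasurable_prod_of_continuousOn ((continuousOn_flowRhs hpos hsmooth).abs.rpow_const
      fun _ _ => Or.inr hq.le) ht).integral_prod_right'
  have hnn : ∀ r, 0 ≤ ∫ x, |flowRhs n w r x| ^ qexp n := fun r =>
    integral_nonneg fun x => rpow_nonneg (abs_nonneg _) _
  refine ⟨hmeas, (hasFiniteIntegral_iff_ofReal (Eventually.of_forall hnn)).2 ?_⟩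
  have hle : ∫⁻ r in Ioc t s, ENNReal.ofReal (∫ x, |flowRhs n w r x| ^ qexp n) ≤
      ∫⁻ r in Ioc t s, (2 * (∫⁻ x, ENNReal.ofReal (lap (w r) x ^ 2 * w r x ^ (1 - pexp n))) +
        ENNReal.ofReal ((2 * c ^ 2 + 1) * ∫ x, w r x ^ twoStar n)) := by
    refine setLIntegral_mono' measurableSet_Ioc fun r hr => ?_
    have hr0 : 0 < r := ht.trans hr.1
    have hΦ0 : ∀ x, 0 ≤ w r x ^ twoStar n := fun x => rpow_nonneg (hpos r hr0 x).le _
    rw [ofReal_integral_eq_lintegral_ofReal (hLq r hr0)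
      (Eventually.of_forall fun x => rpow_nonneg (abs_nonneg _) _), ← integral_const_mul,
      ofReal_integral_eq_lintegral_ofReal ((hL2star r hr0).const_mul _)
      (Eventually.of_forall fun x => mul_nonneg (by positivity) (hΦ0 x)),
      ← lintegral_const_mul' _ _ (by simp), ← lintegral_add_right']
    · refine lintegral_mono fun x => ?_
      have h := abs_add_rpow_qexp_le hn (a := lap (w r) x) (c := c) (hpos r hr0 x)
      rw [← div_eq_mul_inv] at h
      refine (ENNReal.ofReal_le_ofReal h).trans (ENNReal.ofReal_add_le.trans_eq ?_)
      rw [ENNReal.ofReal_mul (by norm_num : (0 : ℝ) ≤ 2)]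
      simp
    · exact ((hL2star r hr0).const_mul _).aestronglyMeasurable.aemeasurable.ennreal_ofReal
  refine hle.trans_lt ?_
  rw [lintegral_add_right' _ hGi.aestronglyMeasurable.aemeasurable.ennreal_ofReal,
    lintegral_const_mul' _ _ (by simp)]
  refine ENNReal.add_lt_top.2 ⟨ENNReal.mul_lt_top (by simp) hX, ?_⟩
  refine (hasFiniteIntegral_iff_ofReal ?_).1 hGi.2
  refine (ae_restrict_mem measurableSet_Ioc).mono fun r hr => mul_nonneg (by positivity) ?_
  exact integral_nonneg fun x => rpow_nonneg (hpos r (ht.trans hr.1) x).le _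

lemma integrableOn_flow_norms (hn : 3 ≤ n) (hpos : ∀ s, 0 < s → ∀ x, 0 < w s x)
    (hsmooth : ContDiffOn ℝ (⊤ : ℕ∞) (fun q : ℝ × Euc n => w q.1 q.2) (Ioi 0 ×ˢ univ))
    (hpde : ∀ s, 0 < s → ∀ x, HasDerivAt (fun r => w r x ^ pexp n) (flowRhs n w s x) s)
    (hL2star : ∀ r, 0 < r → Integrable fun x => w r x ^ twoStar n)
    (hLq : ∀ r, 0 < r → Integrable fun x => |flowRhs n w r x| ^ qexp n)
    (hdiff : ∀ s, 0 < s → DifferentiableAt ℝ (fun r => ∫ x, w r x ^ twoStar n) s)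
    {t s : ℝ} (ht : 0 < t) (hts : t < s) :
    IntegrableOn (fun r => (∫ x, |flowRhs n w r x| ^ qexp n) ^ (1 / qexp n) *
      (∫ x, w r x ^ twoStar n) ^ (1 / twoStar n)) (Ioc t s) := by
  have hq := qexp_pos hn
  have hP := twoStar_pos hn
  have hZ := integrableOn_integral_flowRhs hn hpos hsmooth hpde hL2star hLq hdiff ht hts
  have hGc : ContinuousOn (fun r => (∫ x, w r x ^ twoStar n) ^ (1 / twoStar n)) (Icc t s) :=
    ContinuousOn.rpow_const (fun r hr =>
      (hdiff r (ht.trans_le hr.1)).continuousAt.continuousWithinAt) fun _ _ =>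
      Or.inr (by positivity)
  have hroot : IntegrableOn (fun r => (∫ x, |flowRhs n w r x| ^ qexp n) ^ (1 / qexp n))
      (Ioc t s) := by
    refine Integrable.mono' (g := fun r => 1 + ∫ x, |flowRhs n w r x| ^ qexp n)
      ((integrable_const 1).add hZ)
      (hZ.aestronglyMeasurable.aemeasurable.pow_const _).aestronglyMeasurable
      (Eventually.of_forall fun r => ?_)
    have h0 : 0 ≤ ∫ x, |flowRhs n w r x| ^ qexp n :=
      integral_nonneg fun x => rpow_nonneg (abs_nonneg _) _
    rw [norm_of_nonneg (rpow_nonneg h0 _)]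
    have h1 : 1 / qexp n ≤ 1 := (div_le_one hq).2 (one_lt_qexp hn).le
    calc (∫ x, |flowRhs n w r x| ^ qexp n) ^ (1 / qexp n)
        ≤ (1 + ∫ x, |flowRhs n w r x| ^ qexp n) ^ (1 / qexp n) :=
          rpow_le_rpow h0 (by linarith) (by positivity)
      _ ≤ (1 + ∫ x, |flowRhs n w r x| ^ qexp n) ^ (1 : ℝ) :=
          rpow_le_rpow_of_exponent_le (by linarith) h1
      _ = _ := rpow_one _
  obtain ⟨M, hM⟩ := isCompact_Icc.exists_bound_of_continuousOn hGc
  refine hroot.mul_bdd (c := M)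
    ((hGc.mono Ioc_subset_Icc_self).aestronglyMeasurable measurableSet_Ioc) ?_
  exact (ae_restrict_mem measurableSet_Ioc).mono fun r hr => hM r (Ioc_subset_Icc_self hr)

lemma lintegral_flowRhs_mul_le (hn : 3 ≤ n) (hpos : ∀ s, 0 < s → ∀ x, 0 < w s x)
    (hsmooth : ContDiffOn ℝ (⊤ : ℕ∞) (fun q : ℝ × Euc n => w q.1 q.2) (Ioi 0 ×ˢ univ))
    (hL2star : ∀ r, 0 < r → Integrable fun x => w r x ^ twoStar n)
    (hLq : ∀ r, 0 < r → Integrable fun x => |flowRhs n w r x| ^ qexp n) {r : ℝ} (hr : 0 < r) :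
    ∫⁻ x, ‖flowRhs n w r x * w r x‖ₑ ≤
      ENNReal.ofReal ((∫ x, |flowRhs n w r x| ^ qexp n) ^ (1 / qexp n) *
        (∫ x, w r x ^ twoStar n) ^ (1 / twoStar n)) := by
  have hq := qexp_pos hn
  have hP := twoStar_pos hn
  have hconj := holderConjugate_qexp_twoStar hn
  have hslice : Continuous fun x : Euc n => (r, x) := by fun_prop
  have hmem : ∀ x : Euc n, (r, x) ∈ Ioi (0 : ℝ) ×ˢ (univ : Set (Euc n)) := fun x =>
    ⟨hr, mem_univ x⟩
  have cf : Continuous fun x => flowRhs n w r x :=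
    (continuousOn_flowRhs hpos hsmooth).comp_continuous hslice hmem
  have cw : Continuous fun x => w r x := hsmooth.continuousOn.comp_continuous hslice hmem
  have mf : MemLp (fun x => |flowRhs n w r x|) (ENNReal.ofReal (qexp n)) := by
    refine (integrable_norm_rpow_iff cf.abs.aestronglyMeasurable (by simpa using hq) (by simp)).1 ?_
    simpa [ENNReal.toReal_ofReal hq.le] using hLq r hr
  have mw : MemLp (fun x => w r x) (ENNReal.ofReal (twoStar n)) := by
    refine (integrable_norm_rpow_iff cw.aestronglyMeasurable (by simpa using hP) (by simp)).1 ?_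
    simpa only [ENNReal.toReal_ofReal hP.le, norm_of_nonneg (hpos r hr _).le] using hL2star r hr
  have hnn : ∀ x, 0 ≤ |flowRhs n w r x| * w r x := fun x =>
    mul_nonneg (abs_nonneg _) (hpos r hr x).le
  have hInt : Integrable fun x => |flowRhs n w r x| * w r x := by
    refine Integrable.mono' (((hLq r hr).div_const (qexp n)).add
      ((hL2star r hr).div_const (twoStar n))) (cf.abs.mul cw).aestronglyMeasurable
      (Eventually.of_forall fun x => ?_)
    rw [norm_of_nonneg (hnn x)]
    exact Real.young_inequality_of_nonneg (abs_nonneg _) (hpos r hr x).le hconj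
  have habs : ∀ x, ‖flowRhs n w r x * w r x‖ₑ = ENNReal.ofReal (|flowRhs n w r x| * w r x) :=
    fun x => by rw [Real.enorm_eq_ofReal_abs, abs_mul, abs_of_pos (hpos r hr x)]
  simp only [habs]
  rw [← ofReal_integral_eq_lintegral_ofReal hInt (Eventually.of_forall hnn)]
  exact ENNReal.ofReal_le_ofReal (integral_mul_le_Lp_mul_Lq_of_nonneg hconj
    (Eventually.of_forall fun x => abs_nonneg _)
    (Eventually.of_forall fun x => (hpos r hr x).le) mf mw)

lemma abs_sub_rpow_twoStar_le_lintegral (hn : 3 ≤ n) (hpos : ∀ s, 0 < s → ∀ x, 0 < w s x)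
    (hsmooth : ContDiffOn ℝ (⊤ : ℕ∞) (fun q : ℝ × Euc n => w q.1 q.2) (Ioi 0 ×ˢ univ))
    (hpde : ∀ s, 0 < s → ∀ x, HasDerivAt (fun r => w r x ^ pexp n) (flowRhs n w s x) s)
    {t s : ℝ} (ht : 0 < t) (hts : t < s) (x : Euc n) :
    ENNReal.ofReal (|w s x - w t x| ^ twoStar n) ≤
      ENNReal.ofReal (qexp n) * ∫⁻ r in Ioc t s, ‖flowRhs n w r x * w r x‖ₑ := by
  have hq := qexp_pos hn
  have hcont : ContinuousOn (fun r => qexp n * (flowRhs n w r x * w r x)) (uIcc t s) := by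
    rw [uIcc_of_le hts.le]
    have hslice : ContinuousOn (fun r : ℝ => (r, x)) (Icc t s) := by fun_prop
    have hmem : MapsTo (fun r : ℝ => (r, x)) (Icc t s)
        (Ioi (0 : ℝ) ×ˢ (univ : Set (Euc n))) := fun r hr =>
      mk_mem_prod (ht.trans_le hr.1) (mem_univ x)
    have cf : ContinuousOn (fun r => flowRhs n w r x) (Icc t s) :=
      ContinuousOn.comp (g := fun q : ℝ × Euc n => flowRhs n w q.1 q.2)
        (f := fun r : ℝ => (r, x)) (continuousOn_flowRhs hpos hsmooth) hslice hmem
    have cw : ContinuousOn (fun r => w r x) (Icc t s) :=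
      ContinuousOn.comp (g := fun q : ℝ × Euc n => w q.1 q.2)
        (f := fun r : ℝ => (r, x)) hsmooth.continuousOn hslice hmem
    exact continuousOn_const.mul (cf.mul cw)
  have hftc := intervalIntegral.integral_eq_sub_of_hasDerivAt (a := t) (b := s)
    (fun r hr => hasDerivAt_rpow_twoStar_flow hn hpos hpde
      (ht.trans_le (uIcc_of_le hts.le ▸ hr).1) x) hcont.intervalIntegrable
  rw [intervalIntegral.integral_const_mul, intervalIntegral.integral_of_le hts.le] at hftc
  calc ENNReal.ofReal (|w s x - w t x| ^ twoStar n)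
      ≤ ENNReal.ofReal |w s x ^ twoStar n - w t x ^ twoStar n| :=
        ENNReal.ofReal_le_ofReal (abs_sub_rpow_le (one_le_twoStar hn)
          (hpos s (ht.trans hts) x).le (hpos t ht x).le)
    _ = ENNReal.ofReal (qexp n) * ‖∫ r in Ioc t s, flowRhs n w r x * w r x‖ₑ := by
        rw [← hftc, abs_mul, abs_of_pos hq, ENNReal.ofReal_mul hq.le, Real.enorm_eq_ofReal_abs]
    _ ≤ _ := by
        gcongr
        exact enorm_integral_le_lintegral_enorm _

end Flow

end FlowEstimates

/-- **`L^{2*}` Cauchy estimate along the flow.** If `w` is a smooth positive solution of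
`∂_s(w^p) = Δw + w^p/(1-m)` with `w(r) ∈ L^{2*}`, `Δw(r) + w(r)^p/(1-m) ∈ L^{2n/(n+2)}`,
and with enough regularity to differentiate `∫ w^{2*}` under the integral sign, then for
all `0 < t < s`:
`∫ |w(s)-w(t)|^{2*} ≤ (2n/(n+2)) ∫_t^s ‖Δw(r)+w(r)^p/(1-m)‖_{L^{2n/(n+2)}} ‖w(r)‖_{L^{2*}} dr`. -/
theorem cauchy_estimate_L2star (n : ℕ) (hn : 3 ≤ n)
    (w : ℝ → Euc n → ℝ)
    (hpos : ∀ s, 0 < s → ∀ x, 0 < w s x)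
    (hsmooth : ContDiffOn ℝ (⊤ : ℕ∞) (fun q : ℝ × Euc n => w q.1 q.2) (Set.Ioi 0 ×ˢ Set.univ))
    (hpde : ∀ s, 0 < s → ∀ x,
      HasDerivAt (fun r => w r x ^ pexp n)
        (lap (fun y => w s y) x + w s x ^ pexp n / (1 - mexp n)) s)
    (hL2star : ∀ r, 0 < r → Integrable fun x => w r x ^ twoStar n)
    (hLq : ∀ r, 0 < r → Integrable fun x =>
      |lap (w r) x + w r x ^ pexp n / (1 - mexp n)| ^ (2 * (n : ℝ) / ((n : ℝ) + 2)))
    (hdiff : ∀ s, 0 < s →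
      HasDerivAt (fun r => ∫ x, w r x ^ twoStar n)
        (∫ x, (2 * (n : ℝ) / ((n : ℝ) + 2)) *
          ((lap (w s) x + w s x ^ pexp n / (1 - mexp n)) * w s x)) s) :
    ∀ t s : ℝ, 0 < t → t < s →
      (∫ x, |w s x - w t x| ^ twoStar n) ≤
        (2 * (n : ℝ) / ((n : ℝ) + 2)) *
          ∫ r in t..s,
            (∫ x, |lap (w r) x + w r x ^ pexp n / (1 - mexp n)| ^ (2 * (n : ℝ) / ((n : ℝ) + 2)))
                ^ (((n : ℝ) + 2) / (2 * (n : ℝ))) *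
              (∫ x, w r x ^ twoStar n) ^ (1 / twoStar n) := by
  intro t s ht hts
  have hq := qexp_pos hn
  change ∀ s, 0 < s → ∀ x, HasDerivAt (fun r => w r x ^ pexp n) (flowRhs n w s x) s at hpde
  change ∀ r, 0 < r → Integrable fun x => |flowRhs n w r x| ^ qexp n at hLq
  have hN := integrableOn_flow_norms hn hpos hsmooth hpde hL2star hLq
    (fun r hr => (hdiff r hr).differentiableAt) ht hts
  rw [show ((n : ℝ) + 2) / (2 * (n : ℝ)) = 1 / qexp n by rw [qexp, one_div_div]]
  change ∫ x, |w s x - w t x| ^ twoStar n ≤ qexp n * ∫ r in t..s,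
    (∫ x, |flowRhs n w r x| ^ qexp n) ^ (1 / qexp n) *
      (∫ x, w r x ^ twoStar n) ^ (1 / twoStar n)
  have hN0 : ∀ r ∈ Set.Ioc t s, 0 ≤ (∫ x, |flowRhs n w r x| ^ qexp n) ^ (1 / qexp n) *
      (∫ x, w r x ^ twoStar n) ^ (1 / twoStar n) := fun r hr =>
    mul_nonneg (rpow_nonneg (integral_nonneg fun x => rpow_nonneg (abs_nonneg _) _) _)
      (rpow_nonneg (integral_nonneg fun x => rpow_nonneg (hpos r (ht.trans hr.1) x).le _) _)
  rw [intervalIntegral.integral_of_le hts.le]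
  have hsub : Continuous fun x => w s x - w t x :=
    (contDiff_slice hsmooth (ht.trans hts)).continuous.sub (contDiff_slice hsmooth ht).continuous
  rw [integral_eq_lintegral_of_nonneg_ae
    (Eventually.of_forall fun x => rpow_nonneg (abs_nonneg _) _)
    (hsub.abs.rpow_const fun _ => Or.inr (twoStar_pos hn).le).aestronglyMeasurable]
  refine ENNReal.toReal_le_of_le_ofReal
    (mul_nonneg hq.le (setIntegral_nonneg measurableSet_Ioc hN0)) ?_
  have hmeas : AEMeasurable (Function.uncurry fun r x => ‖flowRhs n w r x * w r x‖ₑ)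
      ((volume.restrict (Set.Ioc t s)).prod volume) :=
    (aestronglyMeasurable_prod_of_continuousOn
      ((continuousOn_flowRhs hpos hsmooth).mul hsmooth.continuousOn) ht).enorm
  calc ∫⁻ x, ENNReal.ofReal (|w s x - w t x| ^ twoStar n)
      ≤ ∫⁻ x, ENNReal.ofReal (qexp n) *
          ∫⁻ r in Set.Ioc t s, ‖flowRhs n w r x * w r x‖ₑ :=
        lintegral_mono fun x => abs_sub_rpow_twoStar_le_lintegral hn hpos hsmooth hpde ht hts x
    _ = ENNReal.ofReal (qexp n) *
          ∫⁻ r in Set.Ioc t s, ∫⁻ x, ‖flowRhs n w r x * w r x‖ₑ := by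
        rw [lintegral_const_mul' _ _ ENNReal.ofReal_ne_top, lintegral_lintegral_swap hmeas]
    _ ≤ ENNReal.ofReal (qexp n) * ∫⁻ r in Set.Ioc t s,
          ENNReal.ofReal ((∫ x, |flowRhs n w r x| ^ qexp n) ^ (1 / qexp n) *
            (∫ x, w r x ^ twoStar n) ^ (1 / twoStar n)) := by
        refine mul_le_mul_right ?_ _
        exact setLIntegral_mono' measurableSet_Ioc fun r hr =>
          lintegral_flowRhs_mul_le hn hpos hsmooth hL2star hLq (ht.trans hr.1)
    _ = _ := by
        rw [ENNReal.ofReal_mul hq.le, ofReal_integral_eq_lintegral_ofReal hN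
          ((ae_restrict_mem measurableSet_Ioc).mono hN0)]
end
end
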